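/- (Path Replacement Lemma, structured form) Let G be a finite simple 3-connected graph with an edge ru, let D = (P_0,...,P_{m-n}) be a Mondshein sequence of G avoiding ru, and let G' be obtained from G by one BG-operation that adds the edge vw, where (if applicable) v subdivides the edge ab of G with birth(a) <= birth(b) and w subdivides the edge cd of G with birth(c) <= birth(d) and birth(d) <= birth(b); let S ⊆ {av, vb, vw, cw, wd} be the set of new edges of G'. Then there exists a Mondshein sequence D' = (P'_0,...,P'_{m-n+1}) of G' avoiding the edge corresponding to ru that is obtained from D by the following modifications only: (M1) replacing the long ear P_{birth(b)} with between 1 and 3 consecutive long ears each consisting of edges in P_{birth(b)} ∪ S; (M2) if P_{birth(cd)} is long and birth(d) < birth(b), replacing P_{birth(cd)} with the long ear obtained from P_{birth(cd)} by subdividing cd with w; (M3) if P_{birth(ab)} is short, deleting it or replacing it with a single edge from {va, vb, vw}, and if P_{birth(cd)} is short, deleting it or replacing it with a single edge from {wc, wd}; (M4) possibly adding vw as a new last ear. -/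

import Mathlib

open SimpleGraph

universe u

variable {V : Type u}

/-- An ear decomposition `(P₀, P₁, …, P_k)` of a graph `G`: `P₀` is a cycle and each
subsequent ear `Pᵢ` (`1 ≤ i ≤ k`, here indexed by `Fin k`) is a path that intersects the
union of the previous ears exactly in its two endpoints; the edge sets of the ears
partition the edge set of `G`. -/
structure EarDecomposition {V : Type u} (G : SimpleGraph V) where
  /-- the number of path-ears; the ears are `P₀, P₁, …, P_k`. -/
  k : ℕ
  /-- base point of the initial cycle `P₀` -/
  v0 : V
  /-- the initial ear `P₀` -/
  cycle : G.Walk v0 v0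
  cycle_isCycle : cycle.IsCycle
  /-- the first endpoint of the ear `Pᵢ` -/
  s : Fin k → V
  /-- the second endpoint of the ear `Pᵢ` -/
  t : Fin k → V
  /-- the ear `Pᵢ`, `1 ≤ i ≤ k` (indexed here by `i-1 : Fin k`) -/
  path : (i : Fin k) → G.Walk (s i) (t i)
  path_isPath : ∀ i, (path i).IsPath
  path_length_pos : ∀ i, 0 < (path i).length
  /-- the ears cover all edges of `G` -/
  edges_cover : ∀ e ∈ G.edgeSet, e ∈ cycle.edges ∨ ∃ i, e ∈ (path i).edges
  /-- distinct ears have disjoint edge sets -/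
  cycle_path_disjoint : ∀ (i : Fin k), ∀ e ∈ (path i).edges, e ∉ cycle.edges
  path_path_disjoint : ∀ i j : Fin k, i ≠ j → ∀ e ∈ (path i).edges, e ∉ (path j).edges
  /-- each ear intersects the union of the previous ears exactly in its endpoints -/
  meets_prev : ∀ (i : Fin k), ∀ x ∈ (path i).support,
    ((x ∈ cycle.support ∨ ∃ j, j < i ∧ x ∈ (path j).support) ↔ (x = s i ∨ x = t i))

namespace EarDecomposition

variable {G : SimpleGraph V} (D : EarDecomposition G)

/-- The `i`-th ear `Pᵢ` as a subgraph of `G` (`P₀` is the initial cycle). -/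
def ear (i : ℕ) : G.Subgraph :=
  if i = 0 then D.cycle.toSubgraph
  else if h : i - 1 < D.k then (D.path ⟨i - 1, h⟩).toSubgraph else ⊥

/-- The vertex set of the `i`-th ear. -/
def earSupport (i : ℕ) : Set V := (D.ear i).verts

/-- The edge set of the `i`-th ear. -/
def earEdges (i : ℕ) : Set (Sym2 V) := (D.ear i).edgeSet

/-- The set of inner vertices of the `i`-th ear: for a path-ear, the vertices that are
not endpoints; every vertex of the initial cycle `P₀` counts as inner. -/
def inner (i : ℕ) : Set V :=
  if i = 0 then D.earSupport 0
  else if h : i - 1 < D.k then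
    {x | x ∈ (D.path ⟨i - 1, h⟩).support ∧ x ≠ D.s ⟨i - 1, h⟩ ∧ x ≠ D.t ⟨i - 1, h⟩}
  else ∅

/-- Ear `Pᵢ` is long if it is not a single edge. -/
def IsLong (i : ℕ) : Prop :=
  i = 0 ∨ ∃ h : i - 1 < D.k, 2 ≤ (D.path ⟨i - 1, h⟩).length

/-- The subgraph `G_i = P₀ ∪ P₁ ∪ ⋯ ∪ P_i`. -/
def partialGraph (i : ℕ) : G.Subgraph := ⨆ j ∈ Finset.range (i + 1), D.ear j

/-- `V̄ᵢ = V(G) − V(G_i)`. -/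
def Vbar (i : ℕ) : Set V := (D.partialGraph i).vertsᶜ

/-- `Ḡᵢ`, the subgraph of `G` induced by `V̄ᵢ`. -/
def Gbar (i : ℕ) : G.Subgraph := (⊤ : G.Subgraph).induce (D.Vbar i)

/-- An ear decomposition is non-separating if, for every `i`, every inner vertex of `Pᵢ`
has a neighbor in `Ḡᵢ` unless `Ḡᵢ` is empty. -/
def NonSeparating : Prop :=
  ∀ i ≤ D.k, (D.Vbar i).Nonempty → ∀ x ∈ D.inner i, ∃ y ∈ D.Vbar i, G.Adj x y

/-- `birth v` is the minimal `i` such that `Pᵢ` contains `v`. -/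
noncomputable def birth (v : V) : ℕ := sInf {i | v ∈ D.earSupport i}

/-- `birthEdge e` is the index `i` such that `Pᵢ` contains the edge `e`. -/
noncomputable def birthEdge (e : Sym2 V) : ℕ := sInf {i | e ∈ D.earEdges i}

end EarDecomposition

/-- A graph is `k`-connected if it has more than `k` vertices and deleting any set of
fewer than `k` vertices leaves it connected. -/
def KConnected (k : ℕ) (G : SimpleGraph V) : Prop :=
  k + 1 ≤ Nat.card V ∧ ∀ S : Set V, S.ncard < k → (G.induce Sᶜ).Connected

/-- A Mondshein sequence avoiding the edge `ru`: an ear decomposition of `G` such that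
(1) `r ∈ P₀`; (2) `P_{birth u}` is the last long ear, contains `u` as its only inner
vertex and does not contain the edge `ru`; (3) the decomposition is non-separating. -/
def IsMondshein {G : SimpleGraph V} (D : EarDecomposition G) (r u : V) : Prop :=
  r ∈ D.earSupport 0 ∧
  D.IsLong (D.birth u) ∧
  (∀ j ≤ D.k, D.IsLong j → j ≤ D.birth u) ∧
  D.inner (D.birth u) = {u} ∧
  s(r, u) ∉ D.earEdges (D.birth u) ∧
  D.NonSeparating

section BGOperations

variable {W : Type u}

/-- Vertex-vertex-addition: `G'` is obtained from `G` by adding an edge between two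
distinct non-adjacent vertices. -/
def IsVVAdd (G : SimpleGraph V) (G' : SimpleGraph W) : Prop :=
  ∃ (e : V ≃ W) (x y : V), x ≠ y ∧ ¬G.Adj x y ∧
    ∀ z z' : V, G'.Adj (e z) (e z') ↔ (G.Adj z z' ∨ (z = x ∧ z' = y) ∨ (z = y ∧ z' = x))

/-- Edge-vertex-addition: `G'` is obtained from `G` by subdividing an edge `ab`, `a ≠ b`,
by a new vertex `v` and adding the edge `vw` for a vertex `w ∉ {a, b}`. -/
def IsEVAdd (G : SimpleGraph V) (G' : SimpleGraph W) : Prop :=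
  ∃ (f : V ↪ W) (v : W) (a b w : V),
    (∀ x, f x ≠ v) ∧ (∀ z : W, z = v ∨ ∃ x, f x = z) ∧
    G.Adj a b ∧ w ≠ a ∧ w ≠ b ∧
    (∀ x y : V, G'.Adj (f x) (f y) ↔ (G.Adj x y ∧ s(x, y) ≠ s(a, b))) ∧
    (∀ x : V, G'.Adj v (f x) ↔ (x = a ∨ x = b ∨ x = w))

/-- Edge-edge-addition: `G'` is obtained from `G` by subdividing two distinct edges `ab`
and `cd` by new vertices `v` and `w`, respectively, and adding the edge `vw`. -/
def IsEEAdd (G : SimpleGraph V) (G' : SimpleGraph W) : Prop :=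
  ∃ (f : V ↪ W) (v w : W) (a b c d : V),
    v ≠ w ∧ (∀ x, f x ≠ v ∧ f x ≠ w) ∧ (∀ z : W, z = v ∨ z = w ∨ ∃ x, f x = z) ∧
    G.Adj a b ∧ G.Adj c d ∧ s(a, b) ≠ s(c, d) ∧
    (∀ x y : V, G'.Adj (f x) (f y) ↔ (G.Adj x y ∧ s(x, y) ≠ s(a, b) ∧ s(x, y) ≠ s(c, d))) ∧
    (∀ x : V, G'.Adj v (f x) ↔ (x = a ∨ x = b)) ∧
    (∀ x : V, G'.Adj w (f x) ↔ (x = c ∨ x = d)) ∧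
    G'.Adj v w

/-- `G'` is obtained from `G` by a single BG-operation. -/
def IsBGOp (G : SimpleGraph V) (G' : SimpleGraph W) : Prop :=
  IsVVAdd G G' ∨ IsEVAdd G G' ∨ IsEEAdd G G'

/-- The graphs constructible from `K₄` by a sequence of BG-operations. -/
inductive BGConstructible : (Σ V : Type u, SimpleGraph V) → Prop
  | base {V : Type u} (G : SimpleGraph V) (h : Nonempty (G ≃g completeGraph (Fin 4))) :
      BGConstructible ⟨V, G⟩
  | step {V W : Type u} (G : SimpleGraph V) (G' : SimpleGraph W)
      (hG : BGConstructible ⟨V, G⟩) (hop : IsBGOp G G') : BGConstructible ⟨W, G'⟩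

end BGOperations

/-- The list of edge sets of the ears `P₀, …, P_k` of an ear decomposition. -/
def EarDecomposition.earList {G : SimpleGraph V} (D : EarDecomposition G) :
    List (Set (Sym2 V)) :=
  (List.range (D.k + 1)).map D.earEdges

/-- The image of a set of edges under a vertex map. -/
def mapEdgeSet {W : Type u} (f : V → W) (E : Set (Sym2 V)) : Set (Sym2 W) :=
  Sym2.map f '' E

set_option linter.all false

/-! ### Edges of vertex lists -/

/-- The list of consecutive pairs of a list. -/
def ledges {W : Type u} : List W → List (Sym2 W)
  | a :: b :: l => s(a, b) :: ledges (b :: l)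
  | _ => []

section ListFacts
variable {W : Type u}

theorem ledges_nil : ledges ([] : List W) = [] := rfl
theorem ledges_single (a : W) : ledges [a] = [] := rfl
theorem ledges_cons2 (a b : W) (l : List W) :
    ledges (a :: b :: l) = s(a, b) :: ledges (b :: l) := rfl

theorem ledges_split (A : List W) (x : W) (B : List W) :
    ledges (A ++ x :: B) = ledges (A ++ [x]) ++ ledges (x :: B) := by
  induction A with
  | nil => simp [ledges]
  | cons a A ih =>
    cases A with
    | nil => simp [ledges]
    | cons a' A => simpa [ledges] using ih

theorem ledges_split2 (A : List W) (x y : W) (B : List W) :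
    ledges (A ++ x :: y :: B) = ledges (A ++ [x]) ++ s(x, y) :: ledges (y :: B) := by
  rw [ledges_split]; rfl

theorem mem_of_mem_ledges {l : List W} {e : Sym2 W} (he : e ∈ ledges l) {x : W} (hx : x ∈ e) :
    x ∈ l := by
  induction l with
  | nil => simp [ledges] at he
  | cons a l ih =>
    cases l with
    | nil => simp [ledges] at he
    | cons b l =>
      simp only [ledges_cons2, List.mem_cons] at he
      rcases he with rfl | he
      · simp at hx; rcases hx with rfl | rfl <;> simp
      · exact List.mem_cons_of_mem _ (ih he)

theorem left_mem_of_mem_ledges {l : List W} {x y : W} (he : s(x, y) ∈ ledges l) : x ∈ l :=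
  mem_of_mem_ledges he (by simp)

theorem right_mem_of_mem_ledges {l : List W} {x y : W} (he : s(x, y) ∈ ledges l) : y ∈ l :=
  mem_of_mem_ledges he (by simp)

theorem mem_ledges_reverse {l : List W} {e : Sym2 W} :
    e ∈ ledges l.reverse ↔ e ∈ ledges l := by
  induction l with
  | nil => simp
  | cons a l ih =>
    cases l with
    | nil => simp
    | cons b l =>
      simp only [List.reverse_cons, List.append_assoc, List.cons_append, List.nil_append] at ih ⊢
      rw [ledges_split2]
      simp only [ledges_cons2, ledges_single, List.mem_append, List.mem_cons, ih,
        List.not_mem_nil, or_false, Sym2.eq_swap (a := a) (b := b)]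
      tauto

theorem ledges_map {V : Type u} (f : V → W) (l : List V) :
    ledges (l.map f) = (ledges l).map (Sym2.map f) := by
  induction l with
  | nil => rfl
  | cons a l ih =>
    cases l with
    | nil => rfl
    | cons b l => simpa [ledges] using ih

theorem exists_split_of_mem_ledges {l : List W} {e : Sym2 W} (he : e ∈ ledges l) :
    ∃ A x y B, l = A ++ x :: y :: B ∧ e = s(x, y) := by
  induction l with
  | nil => simp [ledges] at he
  | cons a l ih =>
    cases l with
    | nil => simp [ledges] at he
    | cons b l =>
      simp only [ledges_cons2, List.mem_cons] at he
      rcases he with rfl | he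
      · exact ⟨[], a, b, l, rfl, rfl⟩
      · obtain ⟨A, x, y, B, h, h'⟩ := ih he
        exact ⟨a :: A, x, y, B, by simp [h], h'⟩

theorem ledges_nodup_of_nodup {l : List W} (h : l.Nodup) : (ledges l).Nodup := by
  induction l with
  | nil => simp [ledges]
  | cons a l ih =>
    cases l with
    | nil => simp [ledges]
    | cons b l =>
      simp only [ledges_cons2, List.nodup_cons]
      refine ⟨fun hm => ?_, ih (List.nodup_cons.1 h).2⟩
      exact (List.nodup_cons.1 h).1 (left_mem_of_mem_ledges hm)

/-- Vertex-level validity of an ear given as a vertex list: either a path meeting the visited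
set exactly in its end vertices, or (if nothing has been visited) a cycle based at `r`. -/
inductive EarV (r : W) (Vis : Set W) : List W → Prop
  | path (s : W) (M : List W) (t : W) (hst : s ≠ t) (hs : s ∈ Vis) (ht : t ∈ Vis)
      (hM : M.Nodup) (hV : ∀ x ∈ M, x ∉ Vis) : EarV r Vis (s :: (M ++ [t]))
  | cyc (M : List W) (h0 : Vis = ∅) (hM : (r :: M).Nodup) (hl : 2 ≤ M.length) :
      EarV r Vis (r :: (M ++ [r]))

theorem EarV.reverse {r : W} {Vis : Set W} {l : List W} (h : EarV r Vis l) :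
    EarV r Vis l.reverse := by
  cases h with
  | path s M t hst hs ht hM hV =>
    simpa using EarV.path (r := r) t M.reverse s hst.symm ht hs (by simpa using hM) (by simpa using hV)
  | cyc M h0 hM hl =>
    simpa using EarV.cyc (r := r) M.reverse h0 (by simpa using hM) (by simpa using hl)

theorem EarV.ledges_nodup {r : W} {Vis : Set W} {l : List W} (h : EarV r Vis l) :
    (ledges l).Nodup := by
  cases h with
  | path s M t hst hs ht hM hV =>
    apply ledges_nodup_of_nodup
    have h1 : s ∉ M := fun h => hV _ h hs
    have h2 : t ∉ M := fun h => hV _ h ht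
    simp [List.nodup_append, hM, h1, hst]
    intro a ha h; exact h2 (h ▸ ha)
  | cyc M h0 hM hl =>
    match M, hl with
    | a :: b :: M, _ =>
      simp only [List.cons_append, ledges_cons2, List.nodup_cons, List.mem_cons] at hM ⊢
      have hb : (b :: (M ++ [r])).Nodup := by
        simp [List.nodup_append]; grind
      refine ⟨?_, ?_, ledges_nodup_of_nodup hb⟩
      · rintro (h | h)
        · simp only [Sym2.eq_iff] at h; grind
        · have := right_mem_of_mem_ledges h
          grind
      · intro h
        have := left_mem_of_mem_ledges h
        grind

theorem EarV.junction {r : W} {Vis : Set W} {A C : List W} {x y : W}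
    (h : EarV r Vis (A ++ x :: y :: C)) :
    s(x, y) ∉ ledges (A ++ [x]) ∧ s(x, y) ∉ ledges (y :: C) := by
  have := h.ledges_nodup
  rw [ledges_split2, List.nodup_append] at this
  obtain ⟨h1, h2, h3⟩ := this
  refine ⟨fun h => h3 _ h _ List.mem_cons_self rfl, (List.nodup_cons.1 h2).1⟩

theorem mid_form {s t x y : W} {M A B C : List W} (h : s :: (M ++ [t]) = A ++ x :: (B ++ y :: C)) :
    ∃ A' C', M = A' ++ (B ++ C') ∧ A ++ [x] = s :: A' ∧ y :: C = C' ++ [t] := by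
  obtain ⟨A', hA⟩ : ∃ A', A ++ [x] = s :: A' := by
    cases A with
    | nil => exact ⟨[], by simp at h; simp [h.1]⟩
    | cons a A => exact ⟨A ++ [x], by simp at h; simp [h.1]⟩
  obtain ⟨C', t', hC⟩ : ∃ C' t', y :: C = C' ++ [t'] := by
    rcases List.eq_nil_or_concat' (y :: C) with h | h
    · simp at h
    · exact h
  have h2 : s :: (M ++ [t]) = (A ++ [x]) ++ (B ++ (y :: C)) := by simpa using h
  rw [hA, hC] at h2
  have h3 : M ++ [t] = (A' ++ (B ++ C')) ++ [t'] := by simpa using h2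
  obtain ⟨h4, h5⟩ := List.append_inj' h3 rfl
  simp at h5
  exact ⟨A', C', h4, hA, by rw [hC, h5]⟩

/-- middle segments consist of new vertices -/
theorem EarV.sub {r : W} {Vis : Set W} {A B C : List W} {x y : W}
    (h : EarV r Vis (A ++ x :: (B ++ y :: C))) :
    B.Nodup ∧ ∀ z ∈ B, z ∉ Vis ∧ z ∉ A ∧ z ≠ x ∧ z ≠ y ∧ z ∉ C := by
  have key : B.Nodup ∧ ∀ z ∈ B, z ∉ Vis ∧ z ∉ A ++ [x] ∧ z ∉ y :: C := by
    generalize hl : A ++ x :: (B ++ y :: C) = l at h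
    cases h with
    | path s M t hst hs ht hM hV =>
      obtain ⟨A', C', rfl, hA, hC⟩ := mid_form hl.symm
      rw [hA, hC]
      simp [List.nodup_append] at hM ⊢
      grind
    | cyc M h0 hM hl' =>
      subst h0
      obtain ⟨A', C', rfl, hA, hC⟩ := mid_form hl.symm
      rw [hA, hC]
      simp [List.nodup_append] at hM ⊢
      grind
  refine ⟨key.1, fun z hz => ?_⟩
  have := key.2 z hz
  grind

/-- replacing a middle segment by new vertices -/
theorem EarV.replace {r : W} {Vis : Set W} {A B C N : List W} {x y : W}
    (h : EarV r Vis (A ++ x :: (B ++ y :: C))) (hxy : x ≠ y ∨ 2 ≤ N.length) (hN : N.Nodup) (hN0 : N ≠ [])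
    (hNV : ∀ z ∈ N, z ∉ Vis ∧ z ∉ A ∧ z ≠ x ∧ z ≠ y ∧ z ∉ C) :
    EarV r Vis (A ++ x :: (N ++ y :: C)) := by
  have hlN : 1 ≤ N.length := List.length_pos_iff.2 hN0
  have hNA : ∀ z ∈ N, z ∉ Vis ∧ z ∉ A ++ [x] ∧ z ∉ y :: C := by grind
  have e : A ++ x :: (N ++ y :: C) = (A ++ [x]) ++ (N ++ (y :: C)) := by simp
  rw [e]
  generalize hl : A ++ x :: (B ++ y :: C) = l at h
  cases h with
  | path s M t hst hs ht hM hV =>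
    obtain ⟨A', C', rfl, hA, hC⟩ := mid_form hl.symm
    rw [hA, hC] at hNA ⊢
    have := EarV.path (r := r) s (A' ++ (N ++ C')) t hst hs ht (by
      simp [List.nodup_append] at hM hNA ⊢
      grind) (by grind)
    simpa using this
  | cyc M h0 hM hl' =>
    subst h0
    obtain ⟨A', C', rfl, hA, hC⟩ := mid_form hl.symm
    have h2 : A' ≠ [] ∨ C' ≠ [] ∨ 2 ≤ N.length := by
      by_contra hcon
      push Not at hcon
      obtain ⟨rfl, rfl, h3⟩ := hcon
      simp at hC
      have := congrArg List.getLast? hA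
      simp at this
      exact hxy.elim (fun h => h (this.trans hC.1.symm)) (by omega)
    rw [hA, hC] at hNA ⊢
    have := EarV.cyc (r := r) (Vis := ∅) (A' ++ (N ++ C')) rfl (by
      simp [List.nodup_append] at hM hNA ⊢
      grind) (by
        have : 1 ≤ A'.length ∨ 1 ≤ C'.length ∨ 2 ≤ N.length :=
          h2.imp List.length_pos_iff.2 (Or.imp List.length_pos_iff.2 id)
        simp; omega)
    simpa using this

theorem EarV.length {r : W} {Vis : Set W} {l : List W} (h : EarV r Vis l) : 2 ≤ l.length := by
  cases h <;> simp

/-- In the path regime: first vertex. -/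
theorem EarV.path_form {r q : W} {Vis : Set W} {l : List W} (h : EarV r Vis l) (hq : q ∈ Vis) :
    ∃ s M t, l = s :: (M ++ [t]) ∧ s ≠ t ∧ s ∈ Vis ∧ t ∈ Vis ∧ M.Nodup ∧ ∀ x ∈ M, x ∉ Vis := by
  cases h with
  | path s M t hst hs ht hM hV => exact ⟨s, M, t, rfl, hst, hs, ht, hM, hV⟩
  | cyc M h0 hM hl => subst h0; simp at hq

/-- initial edges -/
def LL (A : List W) (x : W) : List (Sym2 W) := ledges (A ++ [x])
/-- suffix edges -/
def RR (x : W) (A : List W) : List (Sym2 W) := ledges (x :: A)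
/-- middle edges -/
def MM (x : W) (A : List W) (y : W) : List (Sym2 W) := ledges (x :: (A ++ [y]))

theorem ledges_A (A : List W) (x : W) (B : List W) :
    ledges (A ++ x :: B) = LL A x ++ RR x B := ledges_split _ _ _
theorem ledges_R (x : W) (B : List W) : ledges (x :: B) = RR x B := rfl
theorem RR_nil (x : W) : RR x [] = [] := rfl
theorem RR_cons (x y : W) (B : List W) : RR x (y :: B) = s(x, y) :: RR y B := rfl
theorem RR_app (x : W) (B : List W) (y : W) (C : List W) :
    RR x (B ++ y :: C) = MM x B y ++ RR y C := ledges_split (x :: B) _ _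
theorem mem_RR_reverse (x : W) (A : List W) (e : Sym2 W) :
    e ∈ RR x A.reverse ↔ e ∈ LL A x := by
  have := mem_ledges_reverse (l := A ++ [x]) (e := e)
  simpa [LL, RR] using this
theorem MM_cons (p : W) (y z : W) (B : List W) : MM p (y :: B) z = s(p, y) :: MM y B z := rfl
theorem MM_nil (p : W) (z : W) : MM p [] z = [s(p, z)] := rfl
/-- first edge of a middle part -/
theorem MM_head {B K : List W} {z y : W} (h : B ++ [z] = y :: K) (p : W) :
    MM p B z = s(p, y) :: RR y K := by
  rw [MM, h]; rfl
/-- first and last edges of a middle part -/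
theorem MM_both {B B1 B2 : List W} {x y : W} (h1 : B = x :: B1) (h2 : B = B2 ++ [y]) (p q : W) :
    MM p B q = s(p, x) :: (ledges B ++ [s(y, q)]) := by
  have : ledges (B ++ [q]) = ledges B ++ [s(y, q)] := by
    rw [h2, List.append_assoc]
    exact ledges_split2 B2 y q []
  rw [← this, h1]; rfl

theorem EarV.nodup {r q : W} {Vis : Set W} {l : List W} (h : EarV r Vis l) (hq : q ∈ Vis) :
    l.Nodup := by
  obtain ⟨s, M, t, rfl, hst, hs, ht, hM, hV⟩ := h.path_form hq
  have h1 : s ∉ M := fun h => hV _ h hs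
  have h2 : t ∉ M := fun h => hV _ h ht
  simp [List.nodup_append, hM, h1, hst]
  intro a ha h; exact h2 (h ▸ ha)

/-- a suffix, entered through new vertices -/
theorem EarV.suf {r p q : W} {Vis Vis' : Set W} {A N B : List W} (h : EarV r Vis (A ++ B))
    (hA : A ≠ []) (hB : B ≠ []) (hq : q ∈ Vis) (hsub : Vis ⊆ Vis')
    (hBV : ∀ z ∈ B, z ∈ Vis' → z ∈ Vis) (hp : p ∈ Vis') (hpB : p ∉ B) (hN : N.Nodup)
    (hNV : ∀ z ∈ N, z ∉ Vis' ∧ z ∉ B) : EarV r Vis' (p :: (N ++ B)) := by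
  obtain ⟨s, M, t, hl, hst, hs, ht, hM, hV⟩ := h.path_form hq
  obtain ⟨a, A, rfl⟩ := List.exists_cons_of_ne_nil hA
  rcases List.eq_nil_or_concat' B with rfl | ⟨B, t', rfl⟩
  · simp at hB
  have : s = a ∧ M = A ++ B ∧ t = t' := by
    have e : (a :: (A ++ B)) ++ [t'] = (s :: M) ++ [t] := by simpa using hl
    obtain ⟨h4, h5⟩ := List.append_inj' e rfl
    simp at h4 h5
    exact ⟨h4.1.symm, h4.2.symm, h5.symm⟩
  obtain ⟨rfl, rfl, rfl⟩ := this
  have := EarV.path (r := r) (Vis := Vis') p (N ++ B) t (by grind) hp (hsub ht) (by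
    simp [List.nodup_append] at hM ⊢; grind) (by grind)
  simpa using this

/-- an initial part, left through new vertices -/
theorem EarV.pre {r p q : W} {Vis Vis' : Set W} {A N B : List W} (h : EarV r Vis (A ++ B))
    (hA : A ≠ []) (hB : B ≠ []) (hq : q ∈ Vis) (hsub : Vis ⊆ Vis')
    (hBV : ∀ z ∈ A, z ∈ Vis' → z ∈ Vis) (hp : p ∈ Vis') (hpB : p ∉ A) (hN : N.Nodup)
    (hNV : ∀ z ∈ N, z ∉ Vis' ∧ z ∉ A) : EarV r Vis' (A ++ (N ++ [p])) := by
  have h1 := h.reverse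
  rw [List.reverse_append] at h1
  have := EarV.suf (N := N.reverse) h1 (by simpa using hB) (by simpa using hA) hq hsub
    (by simpa using hBV) hp (by simpa using hpB) (by simpa using hN) (by simpa using hNV)
  simpa using this.reverse

theorem EarV.notin_pre {r q : W} {Vis : Set W} {A B : List W} (h : EarV r Vis (A ++ B))
    (hB : B ≠ []) (hq : q ∈ Vis) (hne : (A ++ B).head? ≠ some q) : q ∉ A := by
  obtain ⟨s, M, t, hl, hst, hs, ht, hM, hV⟩ := h.path_form hq
  rcases List.eq_nil_or_concat' B with rfl | ⟨B, t', rfl⟩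
  · simp at hB
  cases A with
  | nil => simp
  | cons a A =>
    have e : (a :: (A ++ B)) ++ [t'] = (s :: M) ++ [t] := by simpa using hl
    obtain ⟨h4, h5⟩ := List.append_inj' e rfl
    simp at h4 h5 hne
    grind

theorem EarV.pre_or {r q : W} {Vis : Set W} {l : List W} (h : EarV r Vis l) (hq : q ∈ Vis) :
    l.head? ≠ some q ∨ l.reverse.head? ≠ some q := by
  obtain ⟨s, M, t, rfl, hst, hs, ht, hM, hV⟩ := h.path_form hq
  by_cases h : s = q
  · right; subst h; simp; exact fun h => hst h.symm
  · left; simp [h]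

theorem first_terminal (p : W → Prop) {l : List W} (h : ∃ x ∈ l, p x) :
    ∃ A x B, l = A ++ x :: B ∧ p x ∧ ∀ z ∈ A, ¬ p z := by
  induction l with
  | nil => simp at h
  | cons a l ih =>
    by_cases ha : p a
    · exact ⟨[], a, l, rfl, ha, by simp⟩
    · obtain ⟨A, x, B, rfl, h1, h2⟩ := ih (by
        obtain ⟨x, hx, hp⟩ := h
        simp at hx
        rcases hx with rfl | hx
        · exact absurd hp ha
        · exact ⟨x, hx, hp⟩)
      exact ⟨a :: A, x, B, rfl, h1, by simpa using ⟨ha, h2⟩⟩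

end ListFacts

/-! ### Blocks: replacing one long ear by a few long ears -/

section Blocks
variable {W : Type u}

/-- A sequence of vertex-level valid ears; every new vertex from `Z` must have a neighbour
(via an edge from `S`) that is born later. -/
def BSeq (r : W) (Z : Set W) (S : Set (Sym2 W)) : Set W → List (List W) → Prop
  | _, [] => True
  | Vis, Q :: Qs => EarV r Vis Q ∧
      (∀ x ∈ Q, x ∉ Vis → x ∈ Z → ∃ y, s(x, y) ∈ S ∧ y ∉ Vis ∧ y ∉ Q) ∧
      BSeq r Z S (Vis ∪ {x | x ∈ Q}) Qs

/-- `Qs` is a block of long ears replacing the ear `P`. -/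
structure Blk (r : W) (Z Vis : Set W) (P : List W) (N : Set W)
    (rem S Left : Set (Sym2 W)) (Qs : List (List W)) : Prop where
  seq : BSeq r Z S Vis Qs
  long : ∀ Q ∈ Qs, 3 ≤ Q.length
  ne : 1 ≤ Qs.length
  le : Qs.length ≤ 3
  verts : ∀ x, (x ∈ Vis ∨ ∃ Q ∈ Qs, x ∈ Q) ↔ (x ∈ Vis ∨ x ∈ P ∨ x ∈ N)
  edges : ∀ e, (∃ Q ∈ Qs, e ∈ ledges Q) ↔ ((e ∈ ledges P ∧ e ∉ rem) ∨ (e ∈ S ∧ e ∉ Left))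

theorem Blk.reverse {r : W} {Z Vis : Set W} {P : List W} {N : Set W}
    {rem S Left : Set (Sym2 W)} {Qs : List (List W)}
    (h : Blk r Z Vis P.reverse N rem S Left Qs) : Blk r Z Vis P N rem S Left Qs where
  seq := h.seq
  long := h.long
  ne := h.ne
  le := h.le
  verts := by simpa using h.verts
  edges := by simpa [mem_ledges_reverse] using h.edges

theorem EarV.path' {r : W} {Vis : Set W} {l : List W} (s : W) (M : List W) (t : W)
    (e : l = s :: (M ++ [t])) (hst : s ≠ t) (hs : s ∈ Vis) (ht : t ∈ Vis)
    (hM : M.Nodup) (hV : ∀ x ∈ M, x ∉ Vis) : EarV r Vis l := e ▸ .path s M t hst hs ht hM hV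

section
variable {r v w : W} {Vis : Set W} {rem S : Set (Sym2 W)}

/-- three terminals on the ear -/
theorem blk_S3 {A B1 B2 C : List W} {x y z : W}
    (hP : EarV r Vis (A ++ x :: (B1 ++ y :: (B2 ++ z :: C)))) (hxz : x ≠ z)
    (hv : v ∉ Vis) (hvP : v ∉ A ++ x :: (B1 ++ y :: (B2 ++ z :: C)))
    (hS : ∀ e, e ∈ S ↔ e = s(v, x) ∨ e = s(v, y) ∨ e = s(v, z))
    (hrem : ∀ e ∈ ledges (A ++ x :: (B1 ++ y :: (B2 ++ z :: C))), e ∉ rem) :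
    Blk r {v} Vis (A ++ x :: (B1 ++ y :: (B2 ++ z :: C))) {v} rem S {s(v, y)}
      [A ++ x :: v :: z :: C, x :: (B1 ++ y :: (B2 ++ [z]))] := by
  have hP' : EarV r Vis (A ++ x :: ((B1 ++ y :: B2) ++ z :: C)) := by simpa using hP
  obtain ⟨hn, hsub⟩ := hP'.sub
  have hsubL : ∀ q ∈ B1 ++ y :: B2, q ≠ v := by rintro q hq rfl; simp at hq hvP; tauto
  have hy := hsub y (by simp)
  refine ⟨⟨?_, ?_, ?_, ?_, trivial⟩, by simp; omega, by simp, by simp, ?_, ?_⟩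
  · exact hP'.replace (N := [v]) (.inl hxz) (by simp) (by simp) (by simp at hvP ⊢; grind)
  · rintro q hq hqV rfl
    refine ⟨y, (hS _).2 (by simp), ?_⟩
    simp at hvP ⊢; grind
  · refine .path' x (B1 ++ y :: B2) z (by simp) hxz (by simp) (by simp) hn ?_
    intro q hq
    have := hsub q hq
    have := hsubL q hq
    simp; tauto
  · rintro q hq hqV rfl
    simp at hqV
  · intro q; simp; tauto
  · intro e
    have hr := hrem e
    have h1 : s(v, x) ≠ s(v, y) := by simp; grind
    have h2 : s(v, z) ≠ s(v, y) := by simp; grind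
    clear hP hP' hn hsub hsubL hrem
    simp only [ledges_A, ledges_R, RR_app, RR_cons, RR_nil, List.mem_append, List.mem_cons, hS,
      Sym2.eq_swap (a := x) (b := v), Set.mem_singleton_iff, List.not_mem_nil, or_false,
      exists_eq_or_imp, exists_eq_left] at hr ⊢
    grind

end
end Blocks

section BlocksEV
variable {W : Type u} {r v w q : W} {Vis : Set W} {rem S : Set (Sym2 W)}

theorem blk_S1 {A C : List W} {x y : W}
    (hP : EarV r Vis (A ++ x :: y :: C)) (hxy : x ≠ y)
    (hv : v ∉ Vis) (hvP : v ∉ A ++ x :: y :: C) (hq : q ∉ Vis)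
    (hqP : q ∉ A ++ x :: y :: C) (hqv : q ≠ v)
    (hS : ∀ e, e ∈ S ↔ e = s(v, x) ∨ e = s(v, y) ∨ e = s(v, q))
    (hrem : ∀ e ∈ ledges (A ++ x :: y :: C), e ∈ rem ↔ e = s(x, y)) :
    Blk r {v} Vis (A ++ x :: y :: C) {v} rem S {s(v, q)} [A ++ x :: v :: y :: C] := by
  have hP' : EarV r Vis (A ++ x :: ([] ++ y :: C)) := by simpa using hP
  have hj := hP.junction
  refine ⟨⟨?_, ?_, trivial⟩, by simp; omega, by simp, by simp, ?_, ?_⟩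
  · exact hP'.replace (N := [v]) (.inl hxy) (by simp) (by simp) (by simp at hvP ⊢; grind)
  · rintro p hp hpV rfl
    refine ⟨q, (hS _).2 (by simp), ?_⟩
    simp at hqP ⊢; grind
  · intro p; simp; tauto
  · intro e
    have hr := hrem e
    have h1 : s(v, x) ≠ s(v, q) := by simp; grind
    have h2 : s(v, y) ≠ s(v, q) := by simp; grind
    clear hP hP' hrem
    simp only [ledges_A, ledges_R, RR_app, RR_cons, RR_nil, List.mem_append, List.mem_cons, hS,
      Sym2.eq_swap (a := x) (b := v), Set.mem_singleton_iff, List.not_mem_nil, or_false,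
      exists_eq_or_imp, exists_eq_left] at hr hj ⊢
    grind [LL]

theorem blk_S2 {P : List W} {a b : W}
    (hP : EarV r Vis P) (hlong : 3 ≤ P.length) (hab : a ≠ b)
    (ha : a ∈ Vis ∨ a ∈ P) (hb : b ∈ Vis ∨ b ∈ P)
    (hv : v ∉ Vis) (hvP : v ∉ P) (hq : q ∉ Vis) (hqP : q ∉ P) (hqv : q ≠ v)
    (hS : ∀ e, e ∈ S ↔ e = s(v, a) ∨ e = s(v, b) ∨ e = s(v, q))
    (hrem : ∀ e ∈ ledges P, e ∉ rem) :
    Blk r {v} Vis P {v} rem S {s(v, q)} [P, [a, v, b]] := by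
  refine ⟨⟨hP, ?_, ?_, ?_, trivial⟩, by simpa using hlong, by simp, by simp, ?_, ?_⟩
  · rintro p hp hpV rfl
    exact absurd hp hvP
  · exact .path' a [v] b (by simp) hab (by simpa using ha) (by simpa using hb) (by simp)
      (by simp [hv, hvP])
  · rintro p hp hpV rfl
    refine ⟨q, (hS _).2 (by simp), ?_⟩
    simp; grind
  · intro p; simp; grind
  · intro e
    have hr := hrem e
    have h1 : s(v, a) ≠ s(v, q) := by simp; grind
    have h2 : s(v, b) ≠ s(v, q) := by simp; grind
    clear hP hrem
    simp only [ledges_A, ledges_R, RR_app, RR_cons, RR_nil, List.mem_append, List.mem_cons, hS,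
      Sym2.eq_swap (a := a) (b := v), Set.mem_singleton_iff, List.not_mem_nil, or_false,
      exists_eq_or_imp, exists_eq_left] at hr ⊢
    grind

theorem blk_S4 {A B C : List W} {x y : W}
    (hP : EarV r Vis (A ++ x :: y :: (B ++ q :: C))) (hxq : x ≠ q)
    (hv : v ∉ Vis) (hvP : v ∉ A ++ x :: y :: (B ++ q :: C))
    (hS : ∀ e, e ∈ S ↔ e = s(v, x) ∨ e = s(v, y) ∨ e = s(v, q))
    (hrem : ∀ e ∈ ledges (A ++ x :: y :: (B ++ q :: C)), e ∈ rem ↔ e = s(x, y)) :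
    Blk r {v} Vis (A ++ x :: y :: (B ++ q :: C)) {v} rem S ∅
      [A ++ x :: v :: q :: C, v :: y :: (B ++ [q])] := by
  have hP' : EarV r Vis (A ++ x :: ((y :: B) ++ q :: C)) := by simpa using hP
  obtain ⟨hn, hsub⟩ := hP'.sub
  have hsubL : ∀ q ∈ y :: B, q ≠ v := by rintro q hq rfl; simp at hq hvP; tauto
  have hy := hsub y (by simp)
  have hj := hP.junction
  have hvq : v ≠ q := by rintro rfl; simp at hvP
  refine ⟨⟨?_, ?_, ?_, ?_, trivial⟩, by simp; omega, by simp, by simp, ?_, ?_⟩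
  · exact hP'.replace (N := [v]) (.inl hxq) (by simp) (by simp) (by simp at hvP ⊢; grind)
  · rintro p hp hpV rfl
    refine ⟨y, (hS _).2 (by simp), ?_⟩
    simp at hvP ⊢; grind
  · refine .path' v (y :: B) q (by simp) hvq (by simp) (by simp) hn ?_
    intro p hp
    have := hsub p hp
    have := hsubL p hp
    simp; tauto
  · rintro q hq hqV rfl
    simp at hqV
  · intro p; simp; tauto
  · intro e
    have hr := hrem e
    clear hP hP' hn hsub hsubL hrem
    simp only [ledges_A, ledges_R, RR_app, RR_cons, RR_nil, List.mem_append, List.mem_cons, hS,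
      Sym2.eq_swap (a := x) (b := v), Set.mem_empty_iff_false, List.not_mem_nil, or_false,
      exists_eq_or_imp, exists_eq_left] at hr hj ⊢
    grind [LL]

theorem blk_T1 {P : List W} {a b : W}
    (hP : EarV r Vis P) (hlong : 3 ≤ P.length)
    (ha : a ∈ Vis) (hb : b ∉ Vis) (hbP : b ∈ P) (hq : q ∈ Vis) (haq : a ≠ q)
    (hv : v ∉ Vis) (hvP : v ∉ P)
    (hS : ∀ e, e ∈ S ↔ e = s(v, a) ∨ e = s(v, b) ∨ e = s(v, q))
    (hrem : ∀ e ∈ ledges P, e ∉ rem) :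
    Blk r {v} Vis P {v} rem S {s(v, b)} [[a, v, q], P] := by
  refine ⟨⟨?_, ?_, ?_, ?_, trivial⟩, by simpa using hlong, by simp, by simp, ?_, ?_⟩
  · exact .path' a [v] q (by simp) haq ha hq (by simp) (by simp [hv])
  · rintro p hp hpV rfl
    refine ⟨b, (hS _).2 (by simp), hb, ?_⟩
    simp; grind
  · obtain ⟨s, M, t, rfl, hst, hs, ht, hM, hV⟩ := hP.path_form hq
    refine .path s M t hst (.inl hs) (.inl ht) hM ?_
    simp at hvP ⊢; grind
  · rintro p hp hpV rfl
    exact absurd hp hvP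
  · intro p; simp; grind
  · intro e
    have hr := hrem e
    have h1 : s(v, a) ≠ s(v, b) := by simp; grind
    have h2 : s(v, q) ≠ s(v, b) := by simp; grind
    clear hP hrem
    simp only [ledges_A, ledges_R, RR_app, RR_cons, RR_nil, List.mem_append, List.mem_cons, hS,
      Sym2.eq_swap (a := a) (b := v), Set.mem_singleton_iff, List.not_mem_nil, or_false,
      exists_eq_or_imp, exists_eq_left] at hr ⊢
    grind

theorem blk_T2 {A B : List W} {x y : W}
    (hP : EarV r Vis (A ++ x :: B)) (hq : q ∈ Vis) (hqA : (A ++ x :: B).head? ≠ some q)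
    (hy : y ∈ B) (hyV : y ∉ Vis) (hxy : x ≠ y)
    (hv : v ∉ Vis) (hvP : v ∉ A ++ x :: B)
    (hS : ∀ e, e ∈ S ↔ e = s(v, x) ∨ e = s(v, y) ∨ e = s(v, q))
    (hrem : ∀ e ∈ ledges (A ++ x :: B), e ∉ rem) :
    Blk r {v} Vis (A ++ x :: B) {v} rem S {s(v, y)} [A ++ x :: v :: [q], x :: B] := by
  have hB0 : B ≠ [] := by rintro rfl; simp at hy
  have hP' : EarV r Vis ((A ++ [x]) ++ B) := by simpa using hP
  have hnd := hP.nodup hq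
  have hqA' := hP'.notin_pre hB0 hq (by simpa using hqA)
  have hE2 : EarV r (Vis ∪ {p | p ∈ A ++ x :: v :: [q]}) (x :: ([] ++ B)) := by
    refine hP'.suf (by simp) hB0 hq (by simp) ?_ (by simp) ?_ (by simp) (by simp)
    · simp [List.nodup_append] at hnd hvP ⊢; grind
    · simp [List.nodup_append] at hnd hvP ⊢; grind
  have hl : 2 ≤ B.length := by
    match B, hB0, hy with
    | [z], _, hy =>
      exfalso
      obtain ⟨s, M, t, hl, hst, hs, ht, hM, hV⟩ := hP.path_form hq
      have := congrArg List.getLast? hl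
      simp at this hy
      grind
    | _ :: _ :: _, _, _ => simp
  refine ⟨⟨?_, ?_, by simpa using hE2, ?_, trivial⟩, by simp; omega, by simp, by simp, ?_, ?_⟩
  · have := hP'.pre (N := [v]) (p := q) (Vis' := Vis) (by simp) hB0 hq (by simp) (by grind) hq hqA'
      (by simp) (by simp at hvP ⊢; grind)
    simpa using this
  · rintro p hp hpV rfl
    refine ⟨y, (hS _).2 (by simp), hyV, ?_⟩
    simp [List.nodup_append] at hvP hnd ⊢; grind
  · rintro p hp hpV rfl
    simp at hpV
  · intro p; simp; grind
  · intro e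
    have hr := hrem e
    have h1 : s(v, x) ≠ s(v, y) := by simp; grind
    have h2 : s(v, q) ≠ s(v, y) := by simp; grind
    clear hP hrem
    simp only [ledges_A, ledges_R, RR_app, RR_cons, RR_nil, List.mem_append, List.mem_cons, hS,
      Sym2.eq_swap (a := x) (b := v), Set.mem_singleton_iff, List.not_mem_nil, or_false,
      exists_eq_or_imp, exists_eq_left] at hr ⊢
    grind

theorem blk_T3 {A B : List W} {x y : W}
    (hP : EarV r Vis (A ++ x :: y :: B)) (hq : q ∈ Vis) (hqA : (A ++ x :: y :: B).head? ≠ some q)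
    (hyV : y ∉ Vis) (hqv : q ≠ v)
    (hv : v ∉ Vis) (hvP : v ∉ A ++ x :: y :: B)
    (hS : ∀ e, e ∈ S ↔ e = s(v, x) ∨ e = s(v, y) ∨ e = s(v, q))
    (hrem : ∀ e ∈ ledges (A ++ x :: y :: B), e ∈ rem ↔ e = s(x, y)) :
    Blk r {v} Vis (A ++ x :: y :: B) {v} rem S ∅ [A ++ x :: v :: [q], v :: y :: B] := by
  have hP' : EarV r Vis ((A ++ [x]) ++ y :: B) := by simpa using hP
  have hnd := hP.nodup hq
  have hqA' := hP'.notin_pre (by simp) hq (by simpa using hqA)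
  have hj := hP.junction
  have hE2 : EarV r (Vis ∪ {p | p ∈ A ++ x :: v :: [q]}) (v :: ([] ++ y :: B)) := by
    refine hP'.suf (by simp) (by simp) hq (by simp) ?_ (by simp) ?_ (by simp) (by simp)
    · simp [List.nodup_append] at hnd hvP ⊢; grind
    · simp [List.nodup_append] at hnd hvP ⊢; grind
  have hl : 1 ≤ B.length := by
    match B with
    | [] =>
      exfalso
      obtain ⟨s, M, t, hl, hst, hs, ht, hM, hV⟩ := hP.path_form hq
      have := congrArg List.getLast? hl
      simp at this
      grind
    | _ :: _ => simp
  refine ⟨⟨?_, ?_, by simpa using hE2, ?_, trivial⟩, by simp; omega, by simp, by simp, ?_, ?_⟩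
  · have := hP'.pre (N := [v]) (p := q) (Vis' := Vis) (by simp) (by simp) hq (by simp) (by grind) hq
      hqA' (by simp) (by simp at hvP ⊢; grind)
    simpa using this
  · rintro p hp hpV rfl
    refine ⟨y, (hS _).2 (by simp), hyV, ?_⟩
    simp [List.nodup_append] at hvP hnd ⊢; grind
  · rintro p hp hpV rfl
    simp at hpV
  · intro p; simp; grind
  · intro e
    have hr := hrem e
    clear hP hrem
    simp only [ledges_A, ledges_R, RR_app, RR_cons, RR_nil, List.mem_append, List.mem_cons, hS,
      Sym2.eq_swap (a := x) (b := v), Set.mem_empty_iff_false, List.not_mem_nil, or_false,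
      exists_eq_or_imp, exists_eq_left] at hr hj ⊢
    grind [LL]

/-- subdividing the edge `ru` itself -/
theorem blk_ru {P : List W} {a b : W}
    (hP : EarV r Vis P) (hlong : 3 ≤ P.length) (hbV : b ∉ Vis) (hbP : b ∈ P)
    (hq : q ∈ Vis) (ha : a ∈ Vis) (haq : a ≠ q)
    (hv : v ∉ Vis) (hvP : v ∉ P)
    (hS : ∀ e, e ∈ S ↔ e = s(v, a) ∨ e = s(v, b) ∨ e = s(v, q))
    (hrem : ∀ e ∈ ledges P, e ∉ rem) :
    Blk r {b} Vis P {v} rem S {s(v, a)} [P, [b, v, q]] := by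
  have hbq : b ≠ q := by rintro rfl; exact hbV hq
  have hbv : b ≠ v := by rintro rfl; exact hvP hbP
  refine ⟨⟨hP, ?_, ?_, ?_, trivial⟩, by simpa using hlong, by simp, by simp, ?_, ?_⟩
  · rintro p hp hpV rfl
    exact ⟨v, (hS _).2 (by simp [Sym2.eq_swap (a := p)]), hv, hvP⟩
  · exact .path' b [v] q (by simp) hbq (by simp [hbP]) (by simp [hq]) (by simp)
      (by simp [hv, hvP])
  · rintro p hp hpV rfl
    simp [hbP] at hpV
  · intro p; simp; grind
  · intro e
    have hr := hrem e
    have h1 : s(v, b) ≠ s(v, a) := by simp; grind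
    have h2 : s(v, q) ≠ s(v, a) := by simp; grind
    clear hP hrem
    simp only [ledges_A, ledges_R, RR_app, RR_cons, RR_nil, List.mem_append, List.mem_cons, hS,
      Sym2.eq_swap (a := b) (b := v), Set.mem_singleton_iff, List.not_mem_nil, or_false,
      exists_eq_or_imp, exists_eq_left] at hr ⊢
    grind

end BlocksEV

section BlocksEE
variable {W : Type u} {r v w : W} {Vis : Set W} {rem S : Set (Sym2 W)}

theorem blk_S5 {A B C B1 B2 : List W} {x1 x2 y1 y2 : W}
    (hP : EarV r Vis (A ++ x1 :: (B ++ y2 :: C))) (hB1 : B = x2 :: B1) (hB2 : B = B2 ++ [y1])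
    (hv : v ∉ Vis) (hw : w ∉ Vis) (hvw : v ≠ w) (hvP : v ∉ A ++ x1 :: (B ++ y2 :: C)) (hwP : w ∉ A ++ x1 :: (B ++ y2 :: C))
    (hS : ∀ e, e ∈ S ↔ e = s(v, x1) ∨ e = s(v, x2) ∨ e = s(v, w) ∨ e = s(w, y1) ∨ e = s(w, y2))
    (hrem : ∀ e ∈ ledges (A ++ x1 :: (B ++ y2 :: C)), e ∈ rem ↔ e = s(x1, x2) ∨ e = s(y1, y2)) :
    Blk r {v, w} Vis (A ++ x1 :: (B ++ y2 :: C)) {v, w} rem S ∅ [A ++ x1 :: v :: w :: y2 :: C, v :: (B ++ [w])] := by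
  have hP' : EarV r Vis (A ++ x1 :: (B ++ y2 :: C)) := by simpa using hP
  obtain ⟨hn, hsub⟩ := hP'.sub
  have hsubL : ∀ p ∈ B, p ≠ v ∧ p ≠ w := by
    intro p hp
    constructor <;> (rintro rfl; simp at hp hvP hwP; tauto)
  have hj := hP.ledges_nodup
  have hx2 := hsub x2 (by simp [hB1])
  have hy1 := hsub y1 (by simp [hB2])
  have hx2' := hsubL x2 (by simp [hB1])
  have hy1' := hsubL y1 (by simp [hB2])
  have hlB : 1 ≤ B.length := by simp [hB1]
  refine ⟨⟨?_, ?_, ?_, ?_, trivial⟩, by simp; try omega, by simp, by simp, ?_, ?_⟩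
  · exact hP'.replace (N := [v, w]) (.inr (by simp)) (by simp [hvw]) (by simp) (by simp at hvP hwP ⊢; grind)
  · rintro p hp hpV (rfl | rfl)
    · refine ⟨x2, (hS _).2 (by simp), ?_⟩
      simp [List.nodup_append] at hvP hwP hpV ⊢; grind
    · refine ⟨y1, (hS _).2 (by simp), ?_⟩
      simp [List.nodup_append] at hvP hwP hpV ⊢; grind
  · refine .path' v (B) w (by simp) (hvw) (by simp) (by simp) (hn) ?_
    intro p hp
    have := hsub p (by first | exact hp | (simp at hp ⊢; tauto))
    have := hsubL p (by first | exact hp | (simp at hp ⊢; tauto))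
    simp; tauto
  · rintro p hp hpV (rfl | rfl)
    · exfalso; simp [List.nodup_append] at hp hpV hvP hwP <;> grind
    · exfalso; simp [List.nodup_append] at hp hpV hvP hwP <;> grind
  · intro p; simp; grind
  · intro e
    have hr := hrem e
    clear hP hP' hn hsub hsubL hrem hx2 hy1
    simp only [ledges_A, ledges_R, RR_app, RR_cons, RR_nil, List.mem_append, List.mem_cons, hS, MM_both hB1 hB2, List.nodup_append, List.nodup_cons, 
      Sym2.eq_swap (a := x1) (b := v),
      Sym2.eq_swap (a := y1) (b := w),
      Set.mem_singleton_iff, Set.mem_insert_iff, Set.mem_empty_iff_false, List.not_mem_nil, or_false,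
      exists_eq_or_imp, exists_eq_left] at hr hj ⊢
    grind [LL]

theorem blk_S6 {A B C : List W} {x y X Y : W}
    (hP : EarV r Vis (A ++ x :: y :: (B ++ Y :: C))) (hX : X ∈ y :: B) 
    (hv : v ∉ Vis) (hw : w ∉ Vis) (hvw : v ≠ w) (hvP : v ∉ A ++ x :: y :: (B ++ Y :: C)) (hwP : w ∉ A ++ x :: y :: (B ++ Y :: C))
    (hS : ∀ e, e ∈ S ↔ e = s(v, x) ∨ e = s(v, y) ∨ e = s(v, w) ∨ e = s(w, X) ∨ e = s(w, Y))
    (hrem : ∀ e ∈ ledges (A ++ x :: y :: (B ++ Y :: C)), e ∈ rem ↔ e = s(x, y)) :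
    Blk r {v, w} Vis (A ++ x :: y :: (B ++ Y :: C)) {v, w} rem S {s(w, X)} [A ++ x :: v :: w :: Y :: C, v :: y :: (B ++ [Y])] := by
  have hP' : EarV r Vis (A ++ x :: ((y :: B) ++ Y :: C)) := by simpa using hP
  obtain ⟨hn, hsub⟩ := hP'.sub
  have hsubL : ∀ p ∈ y :: B, p ≠ v ∧ p ≠ w := by
    intro p hp
    constructor <;> (rintro rfl; simp at hp hvP hwP; tauto)
  have hj := hP.junction
  have hy := hsub y (by simp)
  have hX1 := hsub X hX
  have hX2 := hsubL X hX
  have hy2 := hsubL y (by simp)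
  refine ⟨⟨?_, ?_, ?_, ?_, trivial⟩, by simp; try omega, by simp, by simp, ?_, ?_⟩
  · exact hP'.replace (N := [v, w]) (.inr (by simp)) (by simp [hvw]) (by simp) (by simp at hvP hwP ⊢; grind)
  · rintro p hp hpV (rfl | rfl)
    · refine ⟨y, (hS _).2 (by simp), ?_⟩
      simp [List.nodup_append] at hvP hwP hpV ⊢; grind
    · refine ⟨X, (hS _).2 (by simp), ?_⟩
      simp [List.nodup_append] at hvP hwP hpV ⊢; grind
  · refine .path' v (y :: B) Y (by simp) (by rintro rfl; simp at hvP) (by simp) (by simp) (hn) ?_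
    intro p hp
    have := hsub p (by first | exact hp | (simp at hp ⊢; tauto))
    have := hsubL p (by first | exact hp | (simp at hp ⊢; tauto))
    simp; tauto
  · rintro p hp hpV (rfl | rfl)
    · exfalso; simp [List.nodup_append] at hp hpV hvP hwP <;> grind
    · exfalso; simp [List.nodup_append] at hp hpV hvP hwP <;> grind
  · intro p; simp; grind
  · intro e
    have hr := hrem e
    have hne0 : s(v, x) ≠ s(w, X) := by simp; grind
    have hne1 : s(v, y) ≠ s(w, X) := by simp; grind
    have hne2 : s(v, w) ≠ s(w, X) := by simp; grind
    have hne3 : s(w, Y) ≠ s(w, X) := by simp; grind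
    clear hP hP' hn hsub hsubL hrem
    simp only [ledges_A, ledges_R, RR_app, RR_cons, RR_nil, List.mem_append, List.mem_cons, hS, 
      Sym2.eq_swap (a := x) (b := v),
      Set.mem_singleton_iff, Set.mem_insert_iff, Set.mem_empty_iff_false, List.not_mem_nil, or_false,
      exists_eq_or_imp, exists_eq_left] at hr hj ⊢
    grind [LL]

theorem blk_S7 {A B1 B2 C K : List W} {x y X Y : W}
    (hP : EarV r Vis (A ++ X :: (B1 ++ x :: (B2 ++ Y :: C)))) (hK : B2 ++ [Y] = y :: K) (hXY : X ≠ Y)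
    (hv : v ∉ Vis) (hw : w ∉ Vis) (hvw : v ≠ w) (hvP : v ∉ A ++ X :: (B1 ++ x :: (B2 ++ Y :: C))) (hwP : w ∉ A ++ X :: (B1 ++ x :: (B2 ++ Y :: C)))
    (hS : ∀ e, e ∈ S ↔ e = s(v, x) ∨ e = s(v, y) ∨ e = s(v, w) ∨ e = s(w, X) ∨ e = s(w, Y))
    (hrem : ∀ e ∈ ledges (A ++ X :: (B1 ++ x :: (B2 ++ Y :: C))), e ∈ rem ↔ e = s(x, y)) :
    Blk r {v, w} Vis (A ++ X :: (B1 ++ x :: (B2 ++ Y :: C))) {v, w} rem S ∅ [A ++ X :: w :: Y :: C, w :: v :: (B2 ++ [Y]), X :: (B1 ++ x :: [v])] := by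
  have hP' : EarV r Vis (A ++ X :: ((B1 ++ x :: B2) ++ Y :: C)) := by simpa using hP
  obtain ⟨hn, hsub⟩ := hP'.sub
  have hsubL : ∀ p ∈ B1 ++ x :: B2, p ≠ v ∧ p ≠ w := by
    intro p hp
    constructor <;> (rintro rfl; simp at hp hvP hwP; tauto)
  have hj := hP.ledges_nodup
  have hx := hsub x (by simp)
  have hx2 := hsubL x (by simp)
  have hn' := hn
  simp [List.nodup_append] at hn'
  refine ⟨⟨?_, ?_, ?_, ?_, ?_, ?_, trivial⟩, by simp; try omega, by simp, by simp, ?_, ?_⟩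
  · exact hP'.replace (N := [w]) (.inl hXY) (by simp [hvw]) (by simp) (by simp at hvP hwP ⊢; grind)
  · rintro p hp hpV (rfl | rfl)
    · exfalso; simp [List.nodup_append] at hp hpV hvP hwP <;> grind
    · refine ⟨v, (hS _).2 (by simp [Sym2.eq_swap]), ?_⟩
      simp [List.nodup_append] at hvP hwP hpV ⊢; grind
  · refine .path' w (v :: B2) Y (by simp) (by rintro rfl; simp at hwP) (by simp) (by simp) ?_ ?_
    · have : v ∉ B2 := fun h => (hsubL v (by simp [h])).1 rfl
      simp [this]; tauto
    · intro p hp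
      have h1 := hsub p
      have h2 := hsubL p
      simp at hp hvP hwP h1 h2 ⊢; grind
  · rintro p hp hpV (rfl | rfl)
    · refine ⟨x, (hS _).2 (by simp), ?_⟩
      simp [List.nodup_append] at hvP hwP hpV ⊢; grind
    · exfalso; simp [List.nodup_append] at hp hpV hvP hwP <;> grind
  · refine .path' X (B1 ++ [x]) v (by simp) (by rintro rfl; simp at hvP) (by simp) (by simp) ?_ ?_
    · simp [List.nodup_append]; grind
    · intro p hp
      have h1 := hsub p (by simp at hp ⊢; tauto)
      have h2 := hsubL p (by simp at hp ⊢; tauto)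
      simp at hp ⊢; grind
  · rintro p hp hpV (rfl | rfl)
    · exfalso; simp [List.nodup_append] at hp hpV hvP hwP <;> grind
    · exfalso; simp [List.nodup_append] at hp hpV hvP hwP <;> grind
  · intro p; simp; grind
  · intro e
    have hr := hrem e
    clear hP hP' hn hsub hsubL hrem hn'
    simp only [ledges_A, ledges_R, RR_app, RR_cons, RR_nil, List.mem_append, List.mem_cons, hS, MM_head hK, List.nodup_append, List.nodup_cons, 
      Sym2.eq_swap (a := x) (b := v),
      Sym2.eq_swap (a := w) (b := v),
      Sym2.eq_swap (a := X) (b := w),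
      Set.mem_singleton_iff, Set.mem_insert_iff, Set.mem_empty_iff_false, List.not_mem_nil, or_false,
      exists_eq_or_imp, exists_eq_left] at hr hj ⊢
    grind [LL]

theorem blk_S8 {A B C : List W} {x1 x2 y1 y2 : W}
    (hP : EarV r Vis (A ++ x1 :: (B ++ y2 :: C))) (hx2 : x2 ∈ B) (hy1 : y1 ∈ B) (hxy : x1 ≠ y2)
    (hv : v ∉ Vis) (hw : w ∉ Vis) (hvw : v ≠ w) (hvP : v ∉ A ++ x1 :: (B ++ y2 :: C)) (hwP : w ∉ A ++ x1 :: (B ++ y2 :: C))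
    (hS : ∀ e, e ∈ S ↔ e = s(v, x1) ∨ e = s(v, x2) ∨ e = s(v, w) ∨ e = s(w, y1) ∨ e = s(w, y2))
    (hrem : ∀ e ∈ ledges (A ++ x1 :: (B ++ y2 :: C)), e ∉ rem) :
    Blk r {v, w} Vis (A ++ x1 :: (B ++ y2 :: C)) {v, w} rem S {s(v, x2), s(w, y1)} [A ++ x1 :: v :: w :: y2 :: C, x1 :: (B ++ [y2])] := by
  have hP' : EarV r Vis (A ++ x1 :: (B ++ y2 :: C)) := by simpa using hP
  obtain ⟨hn, hsub⟩ := hP'.sub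
  have hsubL : ∀ p ∈ B, p ≠ v ∧ p ≠ w := by
    intro p hp
    constructor <;> (rintro rfl; simp at hp hvP hwP; tauto)
  have hx3 := hsub x2 hx2
  have hy3 := hsub y1 hy1
  have hx4 := hsubL x2 hx2
  have hy4 := hsubL y1 hy1
  have hlB : 1 ≤ B.length := List.length_pos_of_mem hx2
  refine ⟨⟨?_, ?_, ?_, ?_, trivial⟩, by simp; try omega, by simp, by simp, ?_, ?_⟩
  · exact hP'.replace (N := [v, w]) (.inl hxy) (by simp [hvw]) (by simp) (by simp at hvP hwP ⊢; grind)
  · rintro p hp hpV (rfl | rfl)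
    · refine ⟨x2, (hS _).2 (by simp), ?_⟩
      simp [List.nodup_append] at hvP hwP hpV ⊢; grind
    · refine ⟨y1, (hS _).2 (by simp), ?_⟩
      simp [List.nodup_append] at hvP hwP hpV ⊢; grind
  · refine .path' x1 (B) y2 (by simp) (hxy) (by simp) (by simp) (hn) ?_
    intro p hp
    have := hsub p (by first | exact hp | (simp at hp ⊢; tauto))
    have := hsubL p (by first | exact hp | (simp at hp ⊢; tauto))
    simp; tauto
  · rintro p hp hpV (rfl | rfl)
    · exfalso; simp [List.nodup_append] at hp hpV hvP hwP <;> grind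
    · exfalso; simp [List.nodup_append] at hp hpV hvP hwP <;> grind
  · intro p; simp; grind
  · intro e
    have hr := hrem e
    have hne0 : s(v, x1) ≠ s(v, x2) := by simp; grind
    have hne1 : s(v, x1) ≠ s(w, y1) := by simp; grind
    have hne2 : s(v, w) ≠ s(v, x2) := by simp; grind
    have hne3 : s(v, w) ≠ s(w, y1) := by simp; grind
    have hne4 : s(w, y2) ≠ s(w, y1) := by simp; grind
    have hne5 : s(w, y2) ≠ s(v, x2) := by simp; grind
    clear hP hP' hn hsub hsubL hrem
    simp only [ledges_A, ledges_R, RR_app, RR_cons, RR_nil, List.mem_append, List.mem_cons, hS, 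
      Sym2.eq_swap (a := x1) (b := v),
      Set.mem_singleton_iff, Set.mem_insert_iff, Set.mem_empty_iff_false, List.not_mem_nil, or_false,
      exists_eq_or_imp, exists_eq_left] at hr  ⊢
    grind [LL]

theorem blk_S9 {A B1 B2 B3 C : List W} {x1 x2 y1 y2 : W}
    (hP : EarV r Vis (A ++ x1 :: (B1 ++ y1 :: (B2 ++ y2 :: (B3 ++ x2 :: C))))) (hxy : x1 ≠ x2)
    (hv : v ∉ Vis) (hw : w ∉ Vis) (hvw : v ≠ w) (hvP : v ∉ A ++ x1 :: (B1 ++ y1 :: (B2 ++ y2 :: (B3 ++ x2 :: C)))) (hwP : w ∉ A ++ x1 :: (B1 ++ y1 :: (B2 ++ y2 :: (B3 ++ x2 :: C))))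
    (hS : ∀ e, e ∈ S ↔ e = s(v, x1) ∨ e = s(v, x2) ∨ e = s(v, w) ∨ e = s(w, y1) ∨ e = s(w, y2))
    (hrem : ∀ e ∈ ledges (A ++ x1 :: (B1 ++ y1 :: (B2 ++ y2 :: (B3 ++ x2 :: C)))), e ∉ rem) :
    Blk r {v, w} Vis (A ++ x1 :: (B1 ++ y1 :: (B2 ++ y2 :: (B3 ++ x2 :: C)))) {v, w} rem S {s(w, y1)} [A ++ x1 :: v :: x2 :: C, v :: w :: y2 :: (B3 ++ [x2]), x1 :: (B1 ++ y1 :: (B2 ++ [y2]))] := by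
  have hP' : EarV r Vis (A ++ x1 :: ((B1 ++ y1 :: (B2 ++ y2 :: B3)) ++ x2 :: C)) := by simpa using hP
  obtain ⟨hn, hsub⟩ := hP'.sub
  have hsubL : ∀ p ∈ B1 ++ y1 :: (B2 ++ y2 :: B3), p ≠ v ∧ p ≠ w := by
    intro p hp
    constructor <;> (rintro rfl; simp at hp hvP hwP; tauto)
  have hy1 := hsub y1 (by simp)
  have hy2 := hsub y2 (by simp)
  have hy1' := hsubL y1 (by simp)
  have hy2' := hsubL y2 (by simp)
  have hn' := hn
  simp [List.nodup_append] at hn'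
  refine ⟨⟨?_, ?_, ?_, ?_, ?_, ?_, trivial⟩, by simp; try omega, by simp, by simp, ?_, ?_⟩
  · exact hP'.replace (N := [v]) (.inl hxy) (by simp [hvw]) (by simp) (by simp at hvP hwP ⊢; grind)
  · rintro p hp hpV (rfl | rfl)
    · refine ⟨w, (hS _).2 (by simp [Sym2.eq_swap]), ?_⟩
      simp [List.nodup_append] at hvP hwP hpV ⊢; grind
    · exfalso; simp [List.nodup_append] at hp hpV hvP hwP <;> grind
  · refine .path' v (w :: y2 :: B3) x2 (by simp) (by rintro rfl; simp at hvP) (by simp) (by simp) ?_ ?_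
    · have : w ∉ y2 :: B3 := fun h => (hsubL w (by simp at h ⊢; tauto)).2 rfl
      simp at this ⊢; grind
    · intro p hp
      have h1 := hsub p
      have h2 := hsubL p
      simp at hp hvP hwP h1 h2 ⊢; grind
  · rintro p hp hpV (rfl | rfl)
    · exfalso; simp [List.nodup_append] at hp hpV hvP hwP <;> grind
    · refine ⟨y1, (hS _).2 (by simp), ?_⟩
      simp [List.nodup_append] at hvP hwP hpV ⊢; grind
  · refine .path' x1 (B1 ++ y1 :: B2) y2 (by simp) (by grind) (by simp) (by simp) ?_ ?_
    · simp [List.nodup_append]; grind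
    · intro p hp
      have h1 := hsub p (by simp at hp ⊢; tauto)
      have h2 := hsubL p (by simp at hp ⊢; tauto)
      simp at hp ⊢; grind
  · rintro p hp hpV (rfl | rfl)
    · exfalso; simp [List.nodup_append] at hp hpV hvP hwP <;> grind
    · exfalso; simp [List.nodup_append] at hp hpV hvP hwP <;> grind
  · intro p; simp; grind
  · intro e
    have hr := hrem e
    have hne0 : s(v, x1) ≠ s(w, y1) := by simp; grind
    have hne1 : s(v, x2) ≠ s(w, y1) := by simp; grind
    have hne2 : s(v, w) ≠ s(w, y1) := by simp; grind
    have hne3 : s(w, y2) ≠ s(w, y1) := by simp; grind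
    clear hP hP' hn hsub hsubL hrem
    simp only [ledges_A, ledges_R, RR_app, RR_cons, RR_nil, List.mem_append, List.mem_cons, hS, 
      Sym2.eq_swap (a := x1) (b := v),
      Set.mem_singleton_iff, Set.mem_insert_iff, Set.mem_empty_iff_false, List.not_mem_nil, or_false,
      exists_eq_or_imp, exists_eq_left] at hr  ⊢
    grind [LL]

theorem blk_S9' {A B C : List W} {x1 x2 y1 : W}
    (hP : EarV r Vis (A ++ x1 :: (B ++ x2 :: C))) (hxy : x1 ≠ x2) (hy : y1 ∈ B)
    (hv : v ∉ Vis) (hw : w ∉ Vis) (hvw : v ≠ w) (hvP : v ∉ A ++ x1 :: (B ++ x2 :: C)) (hwP : w ∉ A ++ x1 :: (B ++ x2 :: C))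
    (hS : ∀ e, e ∈ S ↔ e = s(v, x1) ∨ e = s(v, x2) ∨ e = s(v, w) ∨ e = s(w, y1) ∨ e = s(w, x2))
    (hrem : ∀ e ∈ ledges (A ++ x1 :: (B ++ x2 :: C)), e ∉ rem) :
    Blk r {v, w} Vis (A ++ x1 :: (B ++ x2 :: C)) {v, w} rem S {s(w, y1)} [A ++ x1 :: v :: x2 :: C, [v, w, x2], x1 :: (B ++ [x2])] := by
  have hP' : EarV r Vis (A ++ x1 :: (B ++ x2 :: C)) := by simpa using hP
  obtain ⟨hn, hsub⟩ := hP'.sub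
  have hsubL : ∀ p ∈ B, p ≠ v ∧ p ≠ w := by
    intro p hp
    constructor <;> (rintro rfl; simp at hp hvP hwP; tauto)
  have hy1 := hsub y1 hy
  have hy1' := hsubL y1 hy
  have hlB : 1 ≤ B.length := List.length_pos_of_mem hy
  refine ⟨⟨?_, ?_, ?_, ?_, ?_, ?_, trivial⟩, by simp; try omega, by simp, by simp, ?_, ?_⟩
  · exact hP'.replace (N := [v]) (.inl hxy) (by simp [hvw]) (by simp) (by simp at hvP hwP ⊢; grind)
  · rintro p hp hpV (rfl | rfl)
    · refine ⟨w, (hS _).2 (by simp [Sym2.eq_swap]), ?_⟩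
      simp [List.nodup_append] at hvP hwP hpV ⊢; grind
    · exfalso; simp [List.nodup_append] at hp hpV hvP hwP <;> grind
  · refine .path' v [w] x2 (by simp) (by rintro rfl; simp at hvP) (by simp) (by simp) (by simp) ?_
    intro p hp
    simp at hp hvP hwP ⊢; grind
  · rintro p hp hpV (rfl | rfl)
    · exfalso; simp [List.nodup_append] at hp hpV hvP hwP <;> grind
    · refine ⟨y1, (hS _).2 (by simp), ?_⟩
      simp [List.nodup_append] at hvP hwP hpV ⊢; grind
  · refine .path' x1 (B) x2 (by simp) (hxy) (by simp) (by simp) (hn) ?_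
    intro p hp
    have := hsub p (by first | exact hp | (simp at hp ⊢; tauto))
    have := hsubL p (by first | exact hp | (simp at hp ⊢; tauto))
    simp; tauto
  · rintro p hp hpV (rfl | rfl)
    · exfalso; simp [List.nodup_append] at hp hpV hvP hwP <;> grind
    · exfalso; simp [List.nodup_append] at hp hpV hvP hwP <;> grind
  · intro p; simp; grind
  · intro e
    have hr := hrem e
    have hne0 : s(v, x1) ≠ s(w, y1) := by simp; grind
    have hne1 : s(v, x2) ≠ s(w, y1) := by simp; grind
    have hne2 : s(v, w) ≠ s(w, y1) := by simp; grind
    have hne3 : s(w, x2) ≠ s(w, y1) := by simp; grind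
    clear hP hP' hn hsub hsubL hrem
    simp only [ledges_A, ledges_R, RR_app, RR_cons, RR_nil, List.mem_append, List.mem_cons, hS, 
      Sym2.eq_swap (a := x1) (b := v),
      Set.mem_singleton_iff, Set.mem_insert_iff, Set.mem_empty_iff_false, List.not_mem_nil, or_false,
      exists_eq_or_imp, exists_eq_left] at hr  ⊢
    grind [LL]

end BlocksEE

section BlocksEET
variable {W : Type u} {r v w a b c d : W} {Vis : Set W} {rem S : Set (Sym2 W)}

theorem EarV.suf' {p q : W} {Vis Vis' : Set W} {A N B l : List W} (h : EarV r Vis (A ++ B))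
    (e : l = p :: (N ++ B))
    (hA : A ≠ []) (hB : B ≠ []) (hq : q ∈ Vis) (hsub : Vis ⊆ Vis')
    (hBV : ∀ z ∈ B, z ∈ Vis' → z ∈ Vis) (hp : p ∈ Vis') (hpB : p ∉ B) (hN : N.Nodup)
    (hNV : ∀ z ∈ N, z ∉ Vis' ∧ z ∉ B) : EarV r Vis' l :=
  e ▸ h.suf hA hB hq hsub hBV hp hpB hN hNV

theorem EarV.pre' {p q : W} {Vis Vis' : Set W} {A N B l : List W} (h : EarV r Vis (A ++ B))
    (e : l = A ++ (N ++ [p]))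
    (hA : A ≠ []) (hB : B ≠ []) (hq : q ∈ Vis) (hsub : Vis ⊆ Vis')
    (hBV : ∀ z ∈ A, z ∈ Vis' → z ∈ Vis) (hp : p ∈ Vis') (hpB : p ∉ A) (hN : N.Nodup)
    (hNV : ∀ z ∈ N, z ∉ Vis' ∧ z ∉ A) : EarV r Vis' l :=
  e ▸ h.pre hA hB hq hsub hBV hp hpB hN hNV

theorem EarV.preR {p q : W} {Vis Vis' : Set W} {A N B l : List W} (h : EarV r Vis (A ++ B))
    (e : l = (A ++ (N ++ [p])).reverse)
    (hA : A ≠ []) (hB : B ≠ []) (hq : q ∈ Vis) (hsub : Vis ⊆ Vis')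
    (hBV : ∀ z ∈ A, z ∈ Vis' → z ∈ Vis) (hp : p ∈ Vis') (hpB : p ∉ A) (hN : N.Nodup)
    (hNV : ∀ z ∈ N, z ∉ Vis' ∧ z ∉ A) : EarV r Vis' l :=
  e ▸ (h.pre hA hB hq hsub hBV hp hpB hN hNV).reverse

theorem blk_T5 {A B : List W} {x y : W}
    (hP : EarV r Vis (A ++ x :: y :: B)) (hc : c ∈ Vis) (hcA0 : (A ++ x :: y :: B).head? ≠ some c) (hy : y ∉ Vis)
    (hd : d ∉ Vis) (hdB : d ∈ y :: B)
    (hv : v ∉ Vis) (hw : w ∉ Vis) (hvw : v ≠ w) (hvP : v ∉ A ++ x :: y :: B) (hwP : w ∉ A ++ x :: y :: B)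
    (hS : ∀ e, e ∈ S ↔ e = s(v, x) ∨ e = s(v, y) ∨ e = s(v, w) ∨ e = s(w, c) ∨ e = s(w, d))
    (hrem : ∀ e ∈ ledges (A ++ x :: y :: B), e ∈ rem ↔ e = s(x, y)) :
    Blk r {v, w} Vis (A ++ x :: y :: B) {v, w} rem S {s(w, d)} [A ++ x :: v :: w :: [c], v :: y :: B] := by
  have hP' : EarV r Vis ((A ++ [x]) ++ y :: B) := by simpa using hP
  have hnd := hP.nodup hc
  have hnd' := hnd
  simp [List.nodup_append] at hnd'
  have hcA := hP'.notin_pre (by simp) hc (by simpa using hcA0)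
  have hj := hP.junction
  have hl : 1 ≤ B.length := by
    match B with
    | [] =>
      exfalso
      obtain ⟨s, M, t, hl, hst, hs, ht, hM, hV⟩ := hP.path_form hc
      have := congrArg List.getLast? hl
      simp at this
      grind
    | _ :: _ => simp
  refine ⟨⟨?_, ?_, ?_, ?_, trivial⟩, by simp; try omega, by simp, by simp, ?_, ?_⟩
  · have := hP'.pre (N := [v, w]) (p := c) (Vis' := Vis) (by simp) (by simp) hc (by simp) (by grind) hc
      hcA (by simp [hvw]) (by simp at hvP hwP ⊢; grind)
    simpa using this
  · rintro p hp hpV (rfl | rfl)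
    · refine ⟨y, (hS _).2 (by simp), ?_⟩
      simp [List.nodup_append] at hvP hwP hpV ⊢; grind
    · refine ⟨d, (hS _).2 (by simp), ?_⟩
      simp [List.nodup_append] at hvP hwP hpV ⊢; grind
  · exact hP'.suf' (N := ([] : List W)) (p := v) (by simp) (by simp) (by simp) hc (by intro; simp; try tauto)
      (by simp at hvP hwP hcA ⊢; grind) (by simp) (by simp at hvP hwP ⊢; grind) (by simp [hvw])
      (by simp; try (simp at hvP hwP hcA ⊢; grind))
  · rintro p hp hpV (rfl | rfl)
    · exfalso; simp [List.nodup_append] at hp hpV hvP hwP <;> grind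
    · exfalso; simp [List.nodup_append] at hp hpV hvP hwP <;> grind
  · intro p; simp; grind
  · intro e
    have hr := hrem e
    have hne0 : s(v, x) ≠ s(w, d) := by simp; grind
    have hne1 : s(v, y) ≠ s(w, d) := by simp; grind
    have hne2 : s(v, w) ≠ s(w, d) := by simp; grind
    have hne3 : s(w, c) ≠ s(w, d) := by simp; grind
    clear hP hP' hrem hnd hnd'
    simp only [ledges_A, ledges_R, RR_app, RR_cons, RR_nil, List.mem_append, List.mem_cons, hS, 
      Sym2.eq_swap (a := x) (b := v),
      Set.mem_singleton_iff, Set.mem_insert_iff, Set.mem_empty_iff_false, List.not_mem_nil, or_false,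
      exists_eq_or_imp, exists_eq_left] at hr hj ⊢
    grind [LL]

theorem blk_T6a {A B C K : List W} {x y : W}
    (hP : EarV r Vis (A ++ x :: (B ++ d :: C))) (hc : c ∈ Vis) (hcA : c ∈ A) (hx : x ∉ Vis)
    (hK : B ++ [d] = y :: K)
    (hv : v ∉ Vis) (hw : w ∉ Vis) (hvw : v ≠ w) (hvP : v ∉ A ++ x :: (B ++ d :: C)) (hwP : w ∉ A ++ x :: (B ++ d :: C))
    (hS : ∀ e, e ∈ S ↔ e = s(v, x) ∨ e = s(v, y) ∨ e = s(v, w) ∨ e = s(w, c) ∨ e = s(w, d))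
    (hrem : ∀ e ∈ ledges (A ++ x :: (B ++ d :: C)), e ∈ rem ↔ e = s(x, y)) :
    Blk r {v, w} Vis (A ++ x :: (B ++ d :: C)) {v, w} rem S ∅ [c :: w :: d :: C, w :: v :: (B ++ [d]), A ++ x :: [v]] := by
  have hP' : EarV r Vis ((A ++ x :: B) ++ d :: C) := by simpa using hP
  have hnd := hP.nodup hc
  have hnd' := hnd
  simp [List.nodup_append] at hnd'
  have hP2 : EarV r Vis ((A ++ [x]) ++ (B ++ d :: C)) := by simpa using hP
  obtain ⟨hn, hsub⟩ := hP.sub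
  have hj := hP.ledges_nodup
  have hlA : 1 ≤ A.length := List.length_pos_of_mem hcA
  refine ⟨⟨?_, ?_, ?_, ?_, ?_, ?_, trivial⟩, by simp; try omega, by simp, by simp, ?_, ?_⟩
  · have : EarV r Vis (c :: ([w] ++ d :: C)) := hP'.suf (by simp) (by simp) hc (by simp)
      (by simp) hc (by simp at hvP hwP ⊢; grind) (by simp) (by simp at hvP hwP ⊢; grind)
    simpa using this
  · rintro p hp hpV (rfl | rfl)
    · exfalso; simp [List.nodup_append] at hp hpV hvP hwP <;> grind
    · refine ⟨v, (hS _).2 (by simp [Sym2.eq_swap]), ?_⟩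
      simp [List.nodup_append] at hvP hwP hpV ⊢; grind
  · refine .path' w (v :: B) d (by simp) (by rintro rfl; simp at hwP) (by simp) (by simp) ?_ ?_
    · simp at hvP ⊢; grind
    · intro p hp
      have h1 := hsub p
      simp at hp hvP hwP h1 ⊢; grind
  · rintro p hp hpV (rfl | rfl)
    · refine ⟨x, (hS _).2 (by simp), ?_⟩
      simp [List.nodup_append] at hvP hwP hpV ⊢; grind
    · exfalso; simp [List.nodup_append] at hp hpV hvP hwP <;> grind
  · exact hP2.pre' (N := []) (p := v) (by simp) (by simp) (by simp) hc (by intro; simp; try tauto)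
      (by simp at hvP hwP hcA ⊢; grind) (by simp) (by simp at hvP hwP ⊢; grind) (by simp [hvw])
      (by simp; try (simp at hvP hwP hcA ⊢; grind))
  · rintro p hp hpV (rfl | rfl)
    · exfalso; simp [List.nodup_append] at hp hpV hvP hwP <;> grind
    · exfalso; simp [List.nodup_append] at hp hpV hvP hwP <;> grind
  · intro p; simp; grind
  · intro e
    have hr := hrem e
    clear hP hP' hP2 hn hsub hrem hnd hnd'
    simp only [ledges_A, ledges_R, RR_app, RR_cons, RR_nil, List.mem_append, List.mem_cons, hS, MM_head hK, List.nodup_append, List.nodup_cons, 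
      Sym2.eq_swap (a := x) (b := v),
      Sym2.eq_swap (a := w) (b := v),
      Sym2.eq_swap (a := c) (b := w),
      Set.mem_singleton_iff, Set.mem_insert_iff, Set.mem_empty_iff_false, List.not_mem_nil, or_false,
      exists_eq_or_imp, exists_eq_left] at hr hj ⊢
    grind [LL]

theorem blk_T6b {A B C : List W} {x y : W}
    (hP : EarV r Vis (A ++ x :: y :: (B ++ d :: C))) (hc : c ∈ Vis) (hcA : c ∈ A ++ [x])
    (hv : v ∉ Vis) (hw : w ∉ Vis) (hvw : v ≠ w) (hvP : v ∉ A ++ x :: y :: (B ++ d :: C)) (hwP : w ∉ A ++ x :: y :: (B ++ d :: C))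
    (hS : ∀ e, e ∈ S ↔ e = s(v, x) ∨ e = s(v, y) ∨ e = s(v, w) ∨ e = s(w, c) ∨ e = s(w, d))
    (hrem : ∀ e ∈ ledges (A ++ x :: y :: (B ++ d :: C)), e ∈ rem ↔ e = s(x, y)) :
    Blk r {v, w} Vis (A ++ x :: y :: (B ++ d :: C)) {v, w} rem S ∅ [c :: w :: d :: C, w :: v :: x :: A.reverse, v :: y :: (B ++ [d])] := by
  have hP' : EarV r Vis ((A ++ x :: y :: B) ++ d :: C) := by simpa using hP
  have hnd := hP.nodup hc
  have hnd' := hnd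
  simp [List.nodup_append] at hnd'
  have hP2 : EarV r Vis ((A ++ [x]) ++ (y :: B ++ d :: C)) := by simpa using hP
  have hP3 : EarV r Vis (A ++ x :: ((y :: B) ++ d :: C)) := by simpa using hP
  obtain ⟨hn, hsub⟩ := hP3.sub
  have hy := hsub y (by simp)
  have hj := hP.junction
  refine ⟨⟨?_, ?_, ?_, ?_, ?_, ?_, trivial⟩, by simp; try omega, by simp, by simp, ?_, ?_⟩
  · have : EarV r Vis (c :: ([w] ++ d :: C)) := hP'.suf (by simp) (by simp) hc (by simp)
      (by simp) hc (by simp at hvP hwP hcA ⊢; grind) (by simp) (by simp at hvP hwP ⊢; grind)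
    simpa using this
  · rintro p hp hpV (rfl | rfl)
    · exfalso; simp [List.nodup_append] at hp hpV hvP hwP <;> grind
    · refine ⟨v, (hS _).2 (by simp [Sym2.eq_swap]), ?_⟩
      simp [List.nodup_append] at hvP hwP hpV ⊢; grind
  · refine hP2.preR (N := [v]) (p := w) (by simp) (by simp) (by simp) hc (by intro; simp; try tauto)
      (by simp at hvP hwP hcA ⊢; grind) (by simp) (by simp at hvP hwP ⊢; grind) (by simp)
      (by simp at hvP hwP hcA ⊢; grind)
  · rintro p hp hpV (rfl | rfl)
    · refine ⟨y, (hS _).2 (by simp), ?_⟩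
      simp [List.nodup_append] at hvP hwP hpV ⊢; grind
    · exfalso; simp [List.nodup_append] at hp hpV hvP hwP <;> grind
  · refine .path' v (y :: B) d (by simp) (by rintro rfl; simp at hvP) (by simp) (by simp) hn ?_
    intro p hp
    have h1 := hsub p hp
    simp at hp hvP hwP h1 ⊢; grind
  · rintro p hp hpV (rfl | rfl)
    · exfalso; simp [List.nodup_append] at hp hpV hvP hwP <;> grind
    · exfalso; simp [List.nodup_append] at hp hpV hvP hwP <;> grind
  · intro p; simp; grind
  · intro e
    have hr := hrem e
    clear hP hP' hP2 hP3 hn hsub hrem hnd hnd'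
    simp only [ledges_A, ledges_R, RR_app, RR_cons, RR_nil, List.mem_append, List.mem_cons, hS, mem_RR_reverse, 
      Sym2.eq_swap (a := x) (b := v),
      Sym2.eq_swap (a := w) (b := v),
      Sym2.eq_swap (a := c) (b := w),
      Set.mem_singleton_iff, Set.mem_insert_iff, Set.mem_empty_iff_false, List.not_mem_nil, or_false,
      exists_eq_or_imp, exists_eq_left] at hr hj ⊢
    grind [LL]

theorem blk_T7 {P : List W}
    (hP : EarV r Vis P) (hlong : 3 ≤ P.length) (ha : a ∈ Vis) (hc : c ∈ Vis) (hac : a ≠ c)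
    (hb : b ∉ Vis) (hbP : b ∈ P) (hd : d ∉ Vis) (hdP : d ∈ P)
    (hv : v ∉ Vis) (hw : w ∉ Vis) (hvw : v ≠ w) (hvP : v ∉ P) (hwP : w ∉ P)
    (hS : ∀ e, e ∈ S ↔ e = s(v, a) ∨ e = s(v, b) ∨ e = s(v, w) ∨ e = s(w, c) ∨ e = s(w, d))
    (hrem : ∀ e ∈ ledges (P), e ∉ rem) :
    Blk r {v, w} Vis (P) {v, w} rem S {s(v, b), s(w, d)} [[a, v, w, c], P] := by
  refine ⟨⟨?_, ?_, ?_, ?_, trivial⟩, by simp; try omega, by simp, by simp, ?_, ?_⟩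
  · exact .path' a [v, w] c (by simp) hac ha hc (by simp [hvw]) (by simp [hv, hw])
  · rintro p hp hpV (rfl | rfl)
    · refine ⟨b, (hS _).2 (by simp), ?_⟩
      simp [List.nodup_append] at hvP hwP hpV ⊢; grind
    · refine ⟨d, (hS _).2 (by simp), ?_⟩
      simp [List.nodup_append] at hvP hwP hpV ⊢; grind
  · obtain ⟨s, M, t, rfl, hst, hs, ht, hM, hV⟩ := hP.path_form hc
    refine .path s M t hst (.inl hs) (.inl ht) hM ?_
    simp at hvP hwP ⊢; grind
  · rintro p hp hpV (rfl | rfl)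
    · exfalso; simp [List.nodup_append] at hp hpV hvP hwP <;> grind
    · exfalso; simp [List.nodup_append] at hp hpV hvP hwP <;> grind
  · intro p; simp; grind
  · intro e
    have hr := hrem e
    have hne0 : s(v, a) ≠ s(v, b) := by simp; grind
    have hne1 : s(v, a) ≠ s(w, d) := by simp; grind
    have hne2 : s(v, w) ≠ s(v, b) := by simp; grind
    have hne3 : s(v, w) ≠ s(w, d) := by simp; grind
    have hne4 : s(w, c) ≠ s(w, d) := by simp; grind
    have hne5 : s(w, c) ≠ s(v, b) := by simp; grind
    clear hP hrem
    simp only [ledges_A, ledges_R, RR_app, RR_cons, RR_nil, List.mem_append, List.mem_cons, hS, 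
      Sym2.eq_swap (a := a) (b := v),
      Set.mem_singleton_iff, Set.mem_insert_iff, Set.mem_empty_iff_false, List.not_mem_nil, or_false,
      exists_eq_or_imp, exists_eq_left] at hr  ⊢
    grind [LL]

theorem blk_T8 {A B : List W}
    (hP : EarV r Vis (A ++ b :: B)) (ha : a ∈ Vis) (hcA0 : (A ++ b :: B).head? ≠ some a)
    (hdB : d ∈ B) (hd : d ∉ Vis)
    (hv : v ∉ Vis) (hw : w ∉ Vis) (hvw : v ≠ w) (hvP : v ∉ A ++ b :: B) (hwP : w ∉ A ++ b :: B)
    (hS : ∀ e, e ∈ S ↔ e = s(v, a) ∨ e = s(v, b) ∨ e = s(v, w) ∨ e = s(w, a) ∨ e = s(w, d))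
    (hrem : ∀ e ∈ ledges (A ++ b :: B), e ∉ rem) :
    Blk r {v, w} Vis (A ++ b :: B) {v, w} rem S {s(w, d)} [A ++ b :: v :: [a], [v, w, a], b :: B] := by
  have hP' : EarV r Vis ((A ++ [b]) ++ B) := by simpa using hP
  have hnd := hP.nodup ha
  have hnd' := hnd
  simp [List.nodup_append] at hnd'
  have hB0 : B ≠ [] := by rintro rfl; simp at hdB
  have hcA := hP'.notin_pre (hB0) ha (by simpa using hcA0)
  have hl : 2 ≤ B.length := by
    match B, hdB with
    | [z], hdB =>
      exfalso
      obtain ⟨s, M, t, hl, hst, hs, ht, hM, hV⟩ := hP.path_form ha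
      have := congrArg List.getLast? hl
      simp at this hdB
      grind
    | _ :: _ :: _, _ => simp
  have hav : a ≠ v := by rintro rfl; exact hv ha
  have haw : a ≠ w := by rintro rfl; exact hw ha
  refine ⟨⟨?_, ?_, ?_, ?_, ?_, ?_, trivial⟩, by simp; try omega, by simp, by simp, ?_, ?_⟩
  · have := hP'.pre (N := [v]) (p := a) (Vis' := Vis) (by simp) (hB0) ha (by simp) (by grind) ha
      hcA (by simp [hvw]) (by simp at hvP hwP ⊢; grind)
    simpa using this
  · rintro p hp hpV (rfl | rfl)
    · refine ⟨w, (hS _).2 (by simp [Sym2.eq_swap]), ?_⟩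
      simp [List.nodup_append] at hvP hwP hpV ⊢; grind
    · exfalso; simp [List.nodup_append] at hp hpV hvP hwP <;> grind
  · refine .path' v [w] a (by simp) hav.symm (by simp) (by simp) (by simp) ?_
    simp at hvP hwP ⊢; grind
  · rintro p hp hpV (rfl | rfl)
    · exfalso; simp [List.nodup_append] at hp hpV hvP hwP <;> grind
    · refine ⟨d, (hS _).2 (by simp), ?_⟩
      simp [List.nodup_append] at hvP hwP hpV ⊢; grind
  · exact hP'.suf' (N := ([] : List W)) (p := b) (by simp) (by simp) (hB0) ha (by intro; simp; try tauto)
      (by simp at hvP hwP hcA ⊢; grind) (by simp) (by simp at hvP hwP ⊢; grind) (by simp [hvw])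
      (by simp; try (simp at hvP hwP hcA ⊢; grind))
  · rintro p hp hpV (rfl | rfl)
    · exfalso; simp [List.nodup_append] at hp hpV hvP hwP <;> grind
    · exfalso; simp [List.nodup_append] at hp hpV hvP hwP <;> grind
  · intro p; simp; grind
  · intro e
    have hr := hrem e
    have hne0 : s(v, a) ≠ s(w, d) := by simp; grind
    have hne1 : s(v, b) ≠ s(w, d) := by simp; grind
    have hne2 : s(v, w) ≠ s(w, d) := by simp; grind
    have hne3 : s(w, a) ≠ s(w, d) := by simp; grind
    clear hP hP' hrem hnd hnd'
    simp only [ledges_A, ledges_R, RR_app, RR_cons, RR_nil, List.mem_append, List.mem_cons, hS, 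
      Sym2.eq_swap (a := b) (b := v),
      Set.mem_singleton_iff, Set.mem_insert_iff, Set.mem_empty_iff_false, List.not_mem_nil, or_false,
      exists_eq_or_imp, exists_eq_left] at hr  ⊢
    grind [LL]

theorem blk_T9i {A B : List W} {x y : W}
    (hP : EarV r Vis (A ++ x :: B)) (hc : c ∈ Vis) (hcA0 : (A ++ x :: B).head? ≠ some c)
    (hdB : d ∈ B) (hd : d ∉ Vis) (hyB : y ∈ B) (hy : y ∉ Vis)
    (hv : v ∉ Vis) (hw : w ∉ Vis) (hvw : v ≠ w) (hvP : v ∉ A ++ x :: B) (hwP : w ∉ A ++ x :: B)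
    (hS : ∀ e, e ∈ S ↔ e = s(v, x) ∨ e = s(v, y) ∨ e = s(v, w) ∨ e = s(w, c) ∨ e = s(w, d))
    (hrem : ∀ e ∈ ledges (A ++ x :: B), e ∉ rem) :
    Blk r {v, w} Vis (A ++ x :: B) {v, w} rem S {s(v, y), s(w, d)} [A ++ x :: v :: w :: [c], x :: B] := by
  have hP' : EarV r Vis ((A ++ [x]) ++ B) := by simpa using hP
  have hnd := hP.nodup hc
  have hnd' := hnd
  simp [List.nodup_append] at hnd'
  have hB0 : B ≠ [] := by rintro rfl; simp at hdB
  have hcA := hP'.notin_pre (hB0) hc (by simpa using hcA0)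
  have hl : 2 ≤ B.length := by
    match B, hdB with
    | [z], hdB =>
      exfalso
      obtain ⟨s, M, t, hl, hst, hs, ht, hM, hV⟩ := hP.path_form hc
      have := congrArg List.getLast? hl
      simp at this hdB
      grind
    | _ :: _ :: _, _ => simp
  have hcv : c ≠ v := by rintro rfl; exact hv hc
  have hcw : c ≠ w := by rintro rfl; exact hw hc
  refine ⟨⟨?_, ?_, ?_, ?_, trivial⟩, by simp; try omega, by simp, by simp, ?_, ?_⟩
  · have := hP'.pre (N := [v, w]) (p := c) (Vis' := Vis) (by simp) (hB0) hc (by simp) (by grind) hc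
      hcA (by simp [hvw]) (by simp at hvP hwP ⊢; grind)
    simpa using this
  · rintro p hp hpV (rfl | rfl)
    · refine ⟨y, (hS _).2 (by simp), ?_⟩
      simp [List.nodup_append] at hvP hwP hpV ⊢; grind
    · refine ⟨d, (hS _).2 (by simp), ?_⟩
      simp [List.nodup_append] at hvP hwP hpV ⊢; grind
  · exact hP'.suf' (N := ([] : List W)) (p := x) (by simp) (by simp) (hB0) hc (by intro; simp; try tauto)
      (by simp at hvP hwP hcA ⊢; grind) (by simp) (by simp at hvP hwP ⊢; grind) (by simp [hvw])
      (by simp; try (simp at hvP hwP hcA ⊢; grind))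
  · rintro p hp hpV (rfl | rfl)
    · exfalso; simp [List.nodup_append] at hp hpV hvP hwP <;> grind
    · exfalso; simp [List.nodup_append] at hp hpV hvP hwP <;> grind
  · intro p; simp; grind
  · intro e
    have hr := hrem e
    have hne0 : s(v, x) ≠ s(v, y) := by simp; grind
    have hne1 : s(v, x) ≠ s(w, d) := by simp; grind
    have hne2 : s(v, w) ≠ s(v, y) := by simp; grind
    have hne3 : s(v, w) ≠ s(w, d) := by simp; grind
    have hne4 : s(w, c) ≠ s(v, y) := by simp; grind
    have hne5 : s(w, c) ≠ s(w, d) := by simp; grind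
    clear hP hP' hrem hnd hnd'
    simp only [ledges_A, ledges_R, RR_app, RR_cons, RR_nil, List.mem_append, List.mem_cons, hS, 
      Sym2.eq_swap (a := x) (b := v),
      Set.mem_singleton_iff, Set.mem_insert_iff, Set.mem_empty_iff_false, List.not_mem_nil, or_false,
      exists_eq_or_imp, exists_eq_left] at hr  ⊢
    grind [LL]

theorem blk_T9ii {A B1 B2 C : List W} {x y : W}
    (hP : EarV r Vis (A ++ d :: (B1 ++ x :: (B2 ++ y :: C)))) (hc : c ∈ Vis) (hcA0 : (A ++ d :: (B1 ++ x :: (B2 ++ y :: C))).head? ≠ some c)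
    (hv : v ∉ Vis) (hw : w ∉ Vis) (hvw : v ≠ w) (hvP : v ∉ A ++ d :: (B1 ++ x :: (B2 ++ y :: C))) (hwP : w ∉ A ++ d :: (B1 ++ x :: (B2 ++ y :: C)))
    (hS : ∀ e, e ∈ S ↔ e = s(v, x) ∨ e = s(v, y) ∨ e = s(v, w) ∨ e = s(w, c) ∨ e = s(w, d))
    (hrem : ∀ e ∈ ledges (A ++ d :: (B1 ++ x :: (B2 ++ y :: C))), e ∉ rem) :
    Blk r {v, w} Vis (A ++ d :: (B1 ++ x :: (B2 ++ y :: C))) {v, w} rem S {s(v, x)} [A ++ d :: w :: [c], w :: v :: y :: C, d :: (B1 ++ x :: (B2 ++ [y]))] := by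
  have hP' : EarV r Vis ((A ++ [d]) ++ (B1 ++ x :: (B2 ++ y :: C))) := by simpa using hP
  have hnd := hP.nodup hc
  have hnd' := hnd
  simp [List.nodup_append] at hnd'
  have hcA := hP'.notin_pre (by simp) hc (by simpa using hcA0)
  have hP2 : EarV r Vis ((A ++ d :: (B1 ++ x :: B2)) ++ (y :: C)) := by simpa using hP
  have hP3 : EarV r Vis (A ++ d :: ((B1 ++ x :: B2) ++ y :: C)) := by simpa using hP
  obtain ⟨hn, hsub⟩ := hP3.sub
  have hx := hsub x (by simp)
  have hcv : c ≠ v := by rintro rfl; exact hv hc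
  have hcw : c ≠ w := by rintro rfl; exact hw hc
  refine ⟨⟨?_, ?_, ?_, ?_, ?_, ?_, trivial⟩, by simp; try omega, by simp, by simp, ?_, ?_⟩
  · have := hP'.pre (N := [w]) (p := c) (Vis' := Vis) (by simp) (by simp) hc (by simp) (by grind) hc
      hcA (by simp [hvw]) (by simp at hvP hwP ⊢; grind)
    simpa using this
  · rintro p hp hpV (rfl | rfl)
    · exfalso; simp [List.nodup_append] at hp hpV hvP hwP <;> grind
    · refine ⟨v, (hS _).2 (by simp [Sym2.eq_swap]), ?_⟩
      simp [List.nodup_append] at hvP hwP hpV ⊢; grind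
  · exact hP2.suf' (N := [v]) (p := w) (by simp) (by simp) (by simp) hc (by intro; simp; try tauto)
      (by simp at hvP hwP hcA ⊢; clear hnd hP hP' hP2 hP3 hn hsub hS hrem hcA0; grind) (by simp) (by simp at hvP hwP ⊢; grind) (by simp [hvw])
      (by simp; try (simp at hvP hwP hcA ⊢; clear hnd hP hP' hP2 hP3 hn hsub hS hrem hcA0; grind))
  · rintro p hp hpV (rfl | rfl)
    · refine ⟨x, (hS _).2 (by simp), ?_⟩
      simp [List.nodup_append] at hvP hwP hpV ⊢; grind
    · exfalso; simp [List.nodup_append] at hp hpV hvP hwP <;> grind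
  · refine .path' d (B1 ++ x :: B2) y (by simp) (by grind) (by simp) (by simp) hn ?_
    intro p hp
    have h1 := hsub p hp
    simp at hp hvP hwP h1 ⊢; grind
  · rintro p hp hpV (rfl | rfl)
    · exfalso; simp [List.nodup_append] at hp hpV hvP hwP <;> grind
    · exfalso; simp [List.nodup_append] at hp hpV hvP hwP <;> grind
  · intro p; simp; grind
  · intro e
    have hr := hrem e
    have hne0 : s(v, y) ≠ s(v, x) := by simp; grind
    have hne1 : s(v, w) ≠ s(v, x) := by simp; grind
    have hne2 : s(w, c) ≠ s(v, x) := by simp; grind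
    have hne3 : s(w, d) ≠ s(v, x) := by simp; grind
    clear hP hP' hP2 hP3 hn hsub hrem hnd hnd'
    simp only [ledges_A, ledges_R, RR_app, RR_cons, RR_nil, List.mem_append, List.mem_cons, hS, 
      Sym2.eq_swap (a := w) (b := v),
      Sym2.eq_swap (a := d) (b := w),
      Set.mem_singleton_iff, Set.mem_insert_iff, Set.mem_empty_iff_false, List.not_mem_nil, or_false,
      exists_eq_or_imp, exists_eq_left] at hr  ⊢
    grind [LL]

theorem blk_T9iii {A B : List W} {x y : W}
    (hP : EarV r Vis (A ++ x :: B)) (hc : c ∈ Vis) (hcA0 : (A ++ x :: B).head? ≠ some c)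
    (hyB : y ∈ B) (hy : y ∉ Vis)
    (hv : v ∉ Vis) (hw : w ∉ Vis) (hvw : v ≠ w) (hvP : v ∉ A ++ x :: B) (hwP : w ∉ A ++ x :: B)
    (hS : ∀ e, e ∈ S ↔ e = s(v, x) ∨ e = s(v, y) ∨ e = s(v, w) ∨ e = s(w, c) ∨ e = s(w, x))
    (hrem : ∀ e ∈ ledges (A ++ x :: B), e ∉ rem) :
    Blk r {v, w} Vis (A ++ x :: B) {v, w} rem S {s(v, y)} [A ++ x :: w :: [c], [w, v, x], x :: B] := by
  have hP' : EarV r Vis ((A ++ [x]) ++ B) := by simpa using hP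
  have hnd := hP.nodup hc
  have hnd' := hnd
  simp [List.nodup_append] at hnd'
  have hB0 : B ≠ [] := by rintro rfl; simp at hyB
  have hcA := hP'.notin_pre (hB0) hc (by simpa using hcA0)
  have hl : 2 ≤ B.length := by
    match B, hyB with
    | [z], hyB =>
      exfalso
      obtain ⟨s, M, t, hl, hst, hs, ht, hM, hV⟩ := hP.path_form hc
      have := congrArg List.getLast? hl
      simp at this hyB
      grind
    | _ :: _ :: _, _ => simp
  have hcv : c ≠ v := by rintro rfl; exact hv hc
  have hcw : c ≠ w := by rintro rfl; exact hw hc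
  refine ⟨⟨?_, ?_, ?_, ?_, ?_, ?_, trivial⟩, by simp; try omega, by simp, by simp, ?_, ?_⟩
  · have := hP'.pre (N := [w]) (p := c) (Vis' := Vis) (by simp) (hB0) hc (by simp) (by grind) hc
      hcA (by simp [hvw]) (by simp at hvP hwP ⊢; grind)
    simpa using this
  · rintro p hp hpV (rfl | rfl)
    · exfalso; simp [List.nodup_append] at hp hpV hvP hwP <;> grind
    · refine ⟨v, (hS _).2 (by simp [Sym2.eq_swap]), ?_⟩
      simp [List.nodup_append] at hvP hwP hpV ⊢; grind
  · refine .path' w [v] x (by simp) (by rintro rfl; simp at hwP) (by simp) (by simp) (by simp) ?_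
    simp at hvP hwP ⊢; grind
  · rintro p hp hpV (rfl | rfl)
    · refine ⟨y, (hS _).2 (by simp), ?_⟩
      simp [List.nodup_append] at hvP hwP hpV ⊢; grind
    · exfalso; simp [List.nodup_append] at hp hpV hvP hwP <;> grind
  · exact hP'.suf' (N := ([] : List W)) (p := x) (by simp) (by simp) (hB0) hc (by intro; simp; try tauto)
      (by simp at hvP hwP hcA ⊢; grind) (by simp) (by simp at hvP hwP ⊢; grind) (by simp [hvw])
      (by simp; try (simp at hvP hwP hcA ⊢; grind))
  · rintro p hp hpV (rfl | rfl)
    · exfalso; simp [List.nodup_append] at hp hpV hvP hwP <;> grind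
    · exfalso; simp [List.nodup_append] at hp hpV hvP hwP <;> grind
  · intro p; simp; grind
  · intro e
    have hr := hrem e
    have hne0 : s(v, x) ≠ s(v, y) := by simp; grind
    have hne1 : s(v, w) ≠ s(v, y) := by simp; grind
    have hne2 : s(w, c) ≠ s(v, y) := by simp; grind
    have hne3 : s(w, x) ≠ s(v, y) := by simp; grind
    clear hP hP' hrem hnd hnd'
    simp only [ledges_A, ledges_R, RR_app, RR_cons, RR_nil, List.mem_append, List.mem_cons, hS, 
      Sym2.eq_swap (a := w) (b := v),
      Sym2.eq_swap (a := x) (b := w),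
      Set.mem_singleton_iff, Set.mem_insert_iff, Set.mem_empty_iff_false, List.not_mem_nil, or_false,
      exists_eq_or_imp, exists_eq_left] at hr  ⊢
    grind [LL]

end BlocksEET

section OutEV
variable {W : Type u} {r v w q a b c d : W} {Vis : Set W} {rem S : Set (Sym2 W)} {P : List W}

theorem order2 {l : List W} {x y : W} (hx : x ∈ l) (hy : y ∈ l) (hxy : x ≠ y) :
    (∃ A B C, l = A ++ x :: (B ++ y :: C)) ∨ (∃ A B C, l = A ++ y :: (B ++ x :: C)) := by
  obtain ⟨A, z, B, rfl, hz, hA⟩ := first_terminal (fun z => z = x ∨ z = y) ⟨x, hx, by simp⟩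
  rcases hz with rfl | rfl
  · left
    have : y ∈ B := by
      simp at hy; rcases hy with h | rfl | h
      · exact absurd (Or.inr rfl) (hA y h)
      · exact absurd rfl hxy
      · exact h
    obtain ⟨B1, C, rfl⟩ := List.append_of_mem this
    exact ⟨A, B1, C, rfl⟩
  · right
    have : x ∈ B := by
      simp at hx; rcases hx with h | rfl | h
      · exact absurd (Or.inl rfl) (hA x h)
      · exact absurd rfl hxy
      · exact h
    obtain ⟨B1, C, rfl⟩ := List.append_of_mem this
    exact ⟨A, B1, C, rfl⟩

theorem T2_half {x y : W} (hP : EarV r Vis P) (hq : q ∈ Vis) (hqA : P.head? ≠ some q)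
    (hx : x ∈ P) (hy : y ∈ P) (hxV : x ∉ Vis) (hyV : y ∉ Vis) (hxy : x ≠ y)
    (hv : v ∉ Vis) (hvP : v ∉ P)
    (hS : ∀ e, e ∈ S ↔ e = s(v, x) ∨ e = s(v, y) ∨ e = s(v, q))
    (hrem : ∀ e ∈ ledges P, e ∉ rem) :
    ∃ Qs Left, (Blk r {v} Vis P {v} rem S Left Qs ∧ Qs.length ≤ 2) ∧ (Left = {s(v, x)} ∨ Left = {s(v, y)}) := by
  rcases order2 hx hy hxy with ⟨A, B, C, rfl⟩ | ⟨A, B, C, rfl⟩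
  · exact ⟨_, _, ⟨blk_T2 hP hq hqA (by simp) hyV hxy hv hvP hS hrem, by simp⟩, .inr rfl⟩
  · exact ⟨_, _, ⟨blk_T2 hP hq hqA (by simp) hxV hxy.symm hv hvP
      (by intro e; rw [hS]; tauto) hrem, by simp⟩, .inl rfl⟩

theorem T2_full {x y : W} (hP : EarV r Vis P) (hq : q ∈ Vis)
    (hx : x ∈ P) (hy : y ∈ P) (hxV : x ∉ Vis) (hyV : y ∉ Vis) (hxy : x ≠ y)
    (hv : v ∉ Vis) (hvP : v ∉ P)
    (hS : ∀ e, e ∈ S ↔ e = s(v, x) ∨ e = s(v, y) ∨ e = s(v, q))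
    (hrem : ∀ e ∈ ledges P, e ∉ rem) :
    ∃ Qs Left, (Blk r {v} Vis P {v} rem S Left Qs ∧ Qs.length ≤ 2) ∧ (Left = {s(v, x)} ∨ Left = {s(v, y)}) := by
  rcases hP.pre_or hq with h | h
  · exact T2_half hP hq h hx hy hxV hyV hxy hv hvP hS hrem
  · obtain ⟨Qs, L, h1, h2⟩ := T2_half hP.reverse hq h (by simpa using hx) (by simpa using hy) hxV hyV
      hxy hv (by simpa using hvP) hS (by simpa [mem_ledges_reverse] using hrem)
    exact ⟨Qs, L, ⟨h1.1.reverse, h1.2⟩, h2⟩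

/-- a visited vertex in a suffix is the last one -/
theorem EarV.last_eq {r q : W} {Vis : Set W} {A B : List W} (h : EarV r Vis (A ++ B))
    (hA : A ≠ []) (hq : q ∈ Vis) (hqB : q ∈ B) : (A ++ B).reverse.head? = some q := by
  by_contra hne
  have h1 := h.reverse
  rw [List.reverse_append] at h1 hne
  exact h1.notin_pre (by simpa using hA) hq hne (by simpa using hqB)

theorem T3_full {x y : W} {A B : List W} (hP : EarV r Vis (A ++ x :: y :: B)) (hq : q ∈ Vis)
    (hxV : x ∉ Vis ∨ y ∉ Vis) (hqx : q ≠ x) (hqy : q ≠ y)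
    (hv : v ∉ Vis) (hvP : v ∉ A ++ x :: y :: B)
    (hS : ∀ e, e ∈ S ↔ e = s(v, x) ∨ e = s(v, y) ∨ e = s(v, q))
    (hrem : ∀ e ∈ ledges (A ++ x :: y :: B), e ∈ rem ↔ e = s(x, y)) :
    ∃ Qs, Blk r {v} Vis (A ++ x :: y :: B) {v} rem S ∅ Qs ∧ Qs.length ≤ 2 := by
  have hqv : q ≠ v := by rintro rfl; exact hv hq
  by_cases h : y ∉ Vis ∧ (A ++ x :: y :: B).head? ≠ some q
  · exact ⟨_, blk_T3 hP hq h.2 h.1 hqv hv hvP hS hrem, by simp⟩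
  · have key : x ∉ Vis ∧ (A ++ x :: y :: B).reverse.head? ≠ some q := by
      by_cases hy : y ∈ Vis
      · refine ⟨by tauto, ?_⟩
        have h1 : EarV r Vis ((A ++ [x]) ++ (y :: B)) := by simpa using hP
        have := h1.last_eq (by simp) hy (by simp)
        simp at this ⊢
        rw [this]; simpa using hqy.symm
      · have hh : (A ++ x :: y :: B).head? = some q := by
          by_contra hh; exact h ⟨hy, hh⟩
        constructor
        · intro hx
          have hr2 : EarV r Vis ((y :: B).reverse ++ (A ++ [x]).reverse) := by
            simpa using hP.reverse
          have h1 := hr2.last_eq (by simp) hx (by simp)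
          have h2 : (A ++ x :: y :: B).head? = some x := by
            rw [← h1]; simp
          rw [hh] at h2
          exact hqx (Option.some.inj h2)
        · exact (hP.pre_or hq).resolve_left (by simp [hh])
    have e : (A ++ x :: y :: B).reverse = B.reverse ++ y :: x :: A.reverse := by simp
    have hr := hP.reverse
    rw [e] at hr key
    refine ⟨_, Blk.reverse (e ▸ blk_T3 hr hq key.2 key.1 hqv hv ?_ ?_ ?_), by simp⟩
    · simp at hvP ⊢; tauto
    · intro e; rw [hS]; tauto
    · rw [← e]; intro e; rw [mem_ledges_reverse, Sym2.eq_swap (a := y)]; exact hrem e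

theorem S4_full {x y : W} {A B : List W} (hP : EarV r Vis (A ++ x :: y :: B))
    (hqP : q ∈ A ++ x :: y :: B) (hqx : q ≠ x) (hqy : q ≠ y)
    (hv : v ∉ Vis) (hvP : v ∉ A ++ x :: y :: B)
    (hS : ∀ e, e ∈ S ↔ e = s(v, x) ∨ e = s(v, y) ∨ e = s(v, q))
    (hrem : ∀ e ∈ ledges (A ++ x :: y :: B), e ∈ rem ↔ e = s(x, y)) :
    ∃ Qs, Blk r {v} Vis (A ++ x :: y :: B) {v} rem S ∅ Qs ∧ Qs.length ≤ 2 := by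
  have : q ∈ A ∨ q ∈ B := by simp at hqP; tauto
  rcases this with h | h
  · obtain ⟨A1, A2, rfl⟩ := List.append_of_mem h
    have e : (A1 ++ q :: A2 ++ x :: y :: B).reverse =
      B.reverse ++ y :: x :: (A2.reverse ++ q :: A1.reverse) := by simp
    have hr := hP.reverse
    rw [e] at hr
    refine ⟨_, Blk.reverse (e ▸ blk_S4 hr hqy.symm hv ?_ ?_ ?_), by simp⟩
    · simp at hvP ⊢; tauto
    · intro e; rw [hS]; tauto
    · rw [← e]; intro e; rw [mem_ledges_reverse, Sym2.eq_swap (a := y)]; exact hrem e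
  · obtain ⟨A1, A2, rfl⟩ := List.append_of_mem h
    exact ⟨_, blk_S4 hP hqx.symm hv hvP hS hrem, by simp⟩

theorem S3_full {x y z : W} (hP : EarV r Vis P) (hx : x ∈ P) (hy : y ∈ P) (hz : z ∈ P)
    (hxy : x ≠ y) (hxz : x ≠ z) (hyz : y ≠ z)
    (hv : v ∉ Vis) (hvP : v ∉ P)
    (hS : ∀ e, e ∈ S ↔ e = s(v, x) ∨ e = s(v, y) ∨ e = s(v, z))
    (hrem : ∀ e ∈ ledges P, e ∉ rem) :
    ∃ Qs Left, (Blk r {v} Vis P {v} rem S Left Qs ∧ Qs.length ≤ 2) ∧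
      (Left = {s(v, x)} ∨ Left = {s(v, y)} ∨ Left = {s(v, z)}) := by
  obtain ⟨A, p, B, rfl, hp, hA⟩ :=
    first_terminal (fun p => p = x ∨ p = y ∨ p = z) ⟨x, hx, by simp⟩
  have h1 : ∀ p, p = x ∨ p = y ∨ p = z → p ∉ A := fun p h h' => hA p h' h
  rcases hp with rfl | rfl | rfl
  · rcases order2 (l := B) (x := y) (y := z) (by grind) (by grind) hyz with
      ⟨B1, B2, C, rfl⟩ | ⟨B1, B2, C, rfl⟩
    · exact ⟨_, _, ⟨blk_S3 hP hxz hv hvP hS hrem, by simp⟩, by simp⟩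
    · exact ⟨_, _, ⟨blk_S3 hP hxy hv hvP (by intro e; rw [hS]; tauto) hrem, by simp⟩, by simp⟩
  · rcases order2 (l := B) (x := x) (y := z) (by grind) (by grind) hxz with
      ⟨B1, B2, C, rfl⟩ | ⟨B1, B2, C, rfl⟩
    · exact ⟨_, _, ⟨blk_S3 hP hyz hv hvP (by intro e; rw [hS]; tauto) hrem, by simp⟩, by simp⟩
    · exact ⟨_, _, ⟨blk_S3 hP hxy.symm hv hvP (by intro e; rw [hS]; tauto) hrem, by simp⟩, by simp⟩
  · rcases order2 (l := B) (x := x) (y := y) (by grind) (by grind) hxy with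
      ⟨B1, B2, C, rfl⟩ | ⟨B1, B2, C, rfl⟩
    · exact ⟨_, _, ⟨blk_S3 hP hyz.symm hv hvP (by intro e; rw [hS]; tauto) hrem, by simp⟩, by simp⟩
    · exact ⟨_, _, ⟨blk_S3 hP hxz.symm hv hvP (by intro e; rw [hS]; tauto) hrem, by simp⟩, by simp⟩

theorem ev_out (hP : EarV r Vis P) (hlong : 3 ≤ P.length) (hab : a ≠ b) (hqa : q ≠ a) (hqb : q ≠ b)
    (ha : a ∈ Vis ∨ a ∈ P) (hb : b ∉ Vis) (hbP : b ∈ P)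
    (hv : v ∉ Vis) (hvP : v ∉ P) (hq : q ∈ Vis ∨ q ∈ P)
    (hS : ∀ e, e ∈ S ↔ e = s(v, a) ∨ e = s(v, b) ∨ e = s(v, q))
    (hrem : ∀ e ∈ ledges P, e ∈ rem ↔ e = s(a, b)) :
    ∃ Qs Left, (Blk r {v} Vis P {v} rem S Left Qs ∧ Qs.length ≤ 2) ∧
      ((s(a, b) ∈ ledges P ∧ Left = ∅) ∨ (s(a, b) ∉ ledges P ∧
        (Left = {s(v, a)} ∨ Left = {s(v, b)} ∨ Left = {s(v, q)}))) := by
  by_cases hl : s(a, b) ∈ ledges P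
  · obtain ⟨A, x, y, B, rfl, he⟩ := exists_split_of_mem_ledges hl
    rw [he] at hrem
    have hxy : (a = x ∧ b = y) ∨ (a = y ∧ b = x) := by simpa using he
    have hS' : ∀ e, e ∈ S ↔ e = s(v, x) ∨ e = s(v, y) ∨ e = s(v, q) := by
      intro e; rw [hS]
      rcases hxy with ⟨rfl, rfl⟩ | ⟨rfl, rfl⟩ <;> tauto
    by_cases hqV : q ∈ Vis
    · obtain ⟨Qs, h⟩ := T3_full hP hqV (by grind) (by grind) (by grind) hv hvP hS' hrem
      exact ⟨Qs, ∅, h, .inl ⟨hl, rfl⟩⟩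
    · obtain ⟨Qs, h⟩ := S4_full hP (hq.resolve_left hqV) (by grind) (by grind) hv hvP hS' hrem
      exact ⟨Qs, ∅, h, .inl ⟨hl, rfl⟩⟩
  · have hrem' : ∀ e ∈ ledges P, e ∉ rem := by
      intro e he h; exact hl ((hrem e he).1 h ▸ he)
    by_cases hqV : q ∈ Vis
    · by_cases haV : a ∈ Vis
      · exact ⟨_, _, ⟨blk_T1 hP hlong haV hb hbP hqV hqa.symm hv hvP hS hrem', by simp⟩, .inr ⟨hl, by simp⟩⟩
      · obtain ⟨Qs, L, h, h'⟩ := T2_full hP hqV (ha.resolve_left haV) hbP haV hb hab hv hvP hS hrem'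
        exact ⟨Qs, L, h, .inr ⟨hl, by tauto⟩⟩
    · by_cases haV : a ∈ Vis
      · obtain ⟨Qs, L, h, h'⟩ := T2_full hP haV (hq.resolve_left hqV) hbP hqV hb hqb hv hvP
          (by intro e; rw [hS]; tauto) hrem'
        exact ⟨Qs, L, h, .inr ⟨hl, by tauto⟩⟩
      · obtain ⟨Qs, L, h, h'⟩ := S3_full hP (ha.resolve_left haV) hbP (hq.resolve_left hqV)
          hab hqa.symm hqb.symm hv hvP hS hrem'
        exact ⟨Qs, L, h, .inr ⟨hl, by tauto⟩⟩

theorem ev_out_later (hP : EarV r Vis P) (hlong : 3 ≤ P.length) (hab : a ≠ b)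
    (ha : a ∈ Vis ∨ a ∈ P) (hbP : b ∈ P)
    (hv : v ∉ Vis) (hvP : v ∉ P) (hq : q ∉ Vis) (hqP : q ∉ P) (hqv : q ≠ v)
    (hS : ∀ e, e ∈ S ↔ e = s(v, a) ∨ e = s(v, b) ∨ e = s(v, q))
    (hrem : ∀ e ∈ ledges P, e ∈ rem ↔ e = s(a, b)) :
    ∃ Qs, Blk r {v} Vis P {v} rem S {s(v, q)} Qs := by
  by_cases hl : s(a, b) ∈ ledges P
  · obtain ⟨A, x, y, B, rfl, he⟩ := exists_split_of_mem_ledges hl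
    rw [he] at hrem
    have hxy : (a = x ∧ b = y) ∨ (a = y ∧ b = x) := by simpa using he
    have hS' : ∀ e, e ∈ S ↔ e = s(v, x) ∨ e = s(v, y) ∨ e = s(v, q) := by
      intro e; rw [hS]
      rcases hxy with ⟨rfl, rfl⟩ | ⟨rfl, rfl⟩ <;> tauto
    exact ⟨_, blk_S1 hP (by grind) hv hvP hq hqP hqv hS' hrem⟩
  · have hrem' : ∀ e ∈ ledges P, e ∉ rem := by
      intro e he h; exact hl ((hrem e he).1 h ▸ he)
    exact ⟨_, blk_S2 hP hlong hab ha (.inr hbP) hv hvP hq hqP hqv hS hrem'⟩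

end OutEV

section OutEE
variable {W : Type u} {r v w a b c d : W} {Vis : Set W} {rem S : Set (Sym2 W)} {P : List W}

/-- the hypotheses of the edge-edge case, all new vertices in the same ear -/
structure EEH (r v w a b c d : W) (Vis : Set W) (P : List W) (rem S : Set (Sym2 W)) : Prop where
  ear : EarV r Vis P
  long : 3 ≤ P.length
  ab : a ≠ b
  cd : c ≠ d
  ne : s(a, b) ≠ s(c, d)
  ha : a ∈ Vis ∨ a ∈ P
  hb : b ∈ Vis ∨ b ∈ P
  hc : c ∈ Vis ∨ c ∈ P
  hd : d ∈ Vis ∨ d ∈ P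
  hab : a ∉ Vis ∨ b ∉ Vis
  hcd : c ∉ Vis ∨ d ∉ Vis
  hv : v ∉ Vis
  hw : w ∉ Vis
  hvw : v ≠ w
  hvP : v ∉ P
  hwP : w ∉ P
  hS : ∀ e, e ∈ S ↔ e = s(v, a) ∨ e = s(v, b) ∨ e = s(v, w) ∨ e = s(w, c) ∨ e = s(w, d)
  hrem : ∀ e ∈ ledges P, e ∈ rem ↔ e = s(a, b) ∨ e = s(c, d)

theorem EEH.rev (h : EEH r v w a b c d Vis P rem S) : EEH r v w a b c d Vis P.reverse rem S where
  ear := h.ear.reverse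
  long := by simpa using h.long
  ab := h.ab
  cd := h.cd
  ne := h.ne
  ha := by simpa using h.ha
  hb := by simpa using h.hb
  hc := by simpa using h.hc
  hd := by simpa using h.hd
  hab := h.hab
  hcd := h.hcd
  hv := h.hv
  hw := h.hw
  hvw := h.hvw
  hvP := by simpa using h.hvP
  hwP := by simpa using h.hwP
  hS := h.hS
  hrem := by simpa [mem_ledges_reverse] using h.hrem

theorem EEH.sab (h : EEH r v w a b c d Vis P rem S) : EEH r v w b a c d Vis P rem S :=
  { h with
    ab := h.ab.symm
    ne := by rw [Sym2.eq_swap]; exact h.ne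
    ha := h.hb
    hb := h.ha
    hab := h.hab.symm
    hS := by intro e; rw [h.hS]; tauto
    hrem := by rw [Sym2.eq_swap]; exact h.hrem }

theorem EEH.scd (h : EEH r v w a b c d Vis P rem S) : EEH r v w a b d c Vis P rem S :=
  { h with
    cd := h.cd.symm
    ne := by rw [Sym2.eq_swap (a := d)]; exact h.ne
    hc := h.hd
    hd := h.hc
    hcd := h.hcd.symm
    hS := by intro e; rw [h.hS]; tauto
    hrem := by rw [Sym2.eq_swap (a := d)]; exact h.hrem }

theorem EEH.swap (h : EEH r v w a b c d Vis P rem S) : EEH r w v c d a b Vis P rem S :=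
  { h with
    ab := h.cd
    cd := h.ab
    ne := h.ne.symm
    ha := h.hc
    hb := h.hd
    hc := h.ha
    hd := h.hb
    hab := h.hcd
    hcd := h.hab
    hv := h.hw
    hw := h.hv
    hvw := h.hvw.symm
    hvP := h.hwP
    hwP := h.hvP
    hS := by intro e; rw [h.hS, Sym2.eq_swap (a := w) (b := v)]; tauto
    hrem := by intro e he; rw [h.hrem e he]; tauto }

/-- the outcome of the edge-edge case -/
def EEOut (r v w a b c d : W) (Vis : Set W) (P : List W) (rem S : Set (Sym2 W)) : Prop :=
  ∃ Qs L La Lc, Blk r {v, w} Vis P {v, w} rem S L Qs ∧ L = La ∪ Lc ∧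
    (La = ∅ ∨ s(a, b) ∉ ledges P ∧ (La = {s(v, a)} ∨ La = {s(v, b)})) ∧
    (Lc = ∅ ∨ s(c, d) ∉ ledges P ∧ (Lc = {s(w, c)} ∨ Lc = {s(w, d)}))

theorem EEOut.rev (h : EEOut r v w a b c d Vis P.reverse rem S) :
    EEOut r v w a b c d Vis P rem S := by
  obtain ⟨Qs, L, La, Lc, h1, h2, h3, h4⟩ := h
  rw [mem_ledges_reverse] at h3 h4
  exact ⟨Qs, L, La, Lc, h1.reverse, h2, h3, h4⟩

theorem EEOut.sab (h : EEOut r v w b a c d Vis P rem S) : EEOut r v w a b c d Vis P rem S := by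
  obtain ⟨Qs, L, La, Lc, h1, h2, h3, h4⟩ := h
  rw [Sym2.eq_swap] at h3
  exact ⟨Qs, L, La, Lc, h1, h2, by tauto, h4⟩

theorem EEOut.scd (h : EEOut r v w a b d c Vis P rem S) : EEOut r v w a b c d Vis P rem S := by
  obtain ⟨Qs, L, La, Lc, h1, h2, h3, h4⟩ := h
  rw [Sym2.eq_swap] at h4
  exact ⟨Qs, L, La, Lc, h1, h2, h3, by tauto⟩

theorem EEOut.swap (h : EEOut r w v c d a b Vis P rem S) : EEOut r v w a b c d Vis P rem S := by
  obtain ⟨Qs, L, La, Lc, h1, h2, h3, h4⟩ := h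
  rw [Set.pair_comm] at h1
  exact ⟨Qs, L, Lc, La, h1, by rw [h2, Set.union_comm], h4, h3⟩

theorem EEOut.mk0 {Qs : List (List W)} (h : Blk r {v, w} Vis P {v, w} rem S ∅ Qs) :
    EEOut r v w a b c d Vis P rem S :=
  ⟨Qs, ∅, ∅, ∅, h, by simp, by simp, by simp⟩
theorem EEOut.mkc {Qs : List (List W)} {e : Sym2 W} (h : Blk r {v, w} Vis P {v, w} rem S {e} Qs)
    (hl : s(c, d) ∉ ledges P) (he : e = s(w, c) ∨ e = s(w, d)) :
    EEOut r v w a b c d Vis P rem S :=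
  ⟨Qs, {e}, ∅, {e}, h, by simp, by simp, .inr ⟨hl, by simpa using he⟩⟩
theorem EEOut.mka {Qs : List (List W)} {e : Sym2 W} (h : Blk r {v, w} Vis P {v, w} rem S {e} Qs)
    (hl : s(a, b) ∉ ledges P) (he : e = s(v, a) ∨ e = s(v, b)) :
    EEOut r v w a b c d Vis P rem S :=
  ⟨Qs, {e}, {e}, ∅, h, by simp, .inr ⟨hl, by simpa using he⟩, by simp⟩
theorem EEOut.mkac {Qs : List (List W)} {e e' : Sym2 W}
    (h : Blk r {v, w} Vis P {v, w} rem S {e, e'} Qs)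
    (hl : s(a, b) ∉ ledges P) (he : e = s(v, a) ∨ e = s(v, b))
    (hl' : s(c, d) ∉ ledges P) (he' : e' = s(w, c) ∨ e' = s(w, d)) :
    EEOut r v w a b c d Vis P rem S :=
  ⟨Qs, {e, e'}, {e}, {e'}, h, by rw [Set.insert_eq], .inr ⟨hl, by simpa using he⟩,
    .inr ⟨hl', by simpa using he'⟩⟩

theorem head_form {A' : List W} {b c : W} {B C : List W} (e : b :: B = A' ++ c :: C) :
    ∃ K, A' ++ [c] = b :: K := by
  cases A' with
  | nil => simp at e; exact ⟨[], by simp [e.1]⟩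
  | cons x A' => simp at e; exact ⟨A' ++ [c], by simp [e.1]⟩

theorem ee_LL0 {A B A' C : List W} (h : EEH r v w a b c d Vis P rem S)
    (hPe : P = A ++ a :: b :: B) (e : b :: B = A' ++ c :: d :: C) :
    EEOut r v w a b c d Vis P rem S := by
  obtain ⟨K, hK⟩ := head_form e
  obtain rfl : P = A ++ a :: ((A' ++ [c]) ++ d :: C) := by rw [hPe, e]; simp
  exact .mk0 (blk_S5 h.ear hK rfl h.hv h.hw h.hvw h.hvP h.hwP h.hS h.hrem)

theorem ee_LL1 {A B : List W} (h : EEH r v w a b c d Vis P rem S)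
    (hPe : P = A ++ a :: b :: B) (e : s(c, d) ∈ ledges (b :: B)) :
    EEOut r v w a b c d Vis P rem S := by
  obtain ⟨A', x, y, C, e1, e2⟩ := exists_split_of_mem_ledges e
  have : (c = x ∧ d = y) ∨ (c = y ∧ d = x) := by simpa using e2
  rcases this with ⟨rfl, rfl⟩ | ⟨rfl, rfl⟩
  · exact ee_LL0 h hPe e1
  · exact (ee_LL0 h.scd hPe e1).scd

theorem ee_LL2 {A B : List W} (h : EEH r v w a b c d Vis P rem S)
    (hPe : P = A ++ a :: b :: B) (e : s(c, d) ∈ ledges P) :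
    EEOut r v w a b c d Vis P rem S := by
  rw [hPe, ledges_split2] at e
  simp only [List.mem_append, List.mem_cons, h.ne.symm, false_or] at e
  rcases e with e | e
  · have hr : P.reverse = B.reverse ++ b :: a :: A.reverse := by simp [hPe]
    refine (ee_LL1 h.sab.rev hr ?_).rev.sab
    rw [← mem_ledges_reverse]; simpa using e
  · exact ee_LL1 h hPe e

theorem ee_LSv {A B : List W} (h : EEH r v w a b c d Vis P rem S)
    (hPe : P = A ++ a :: b :: B) (hl : s(c, d) ∉ ledges P) (hc : c ∈ Vis) (hdB : d ∈ b :: B) :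
    EEOut r v w a b c d Vis P rem S := by
  have hd : d ∉ Vis := h.hcd.resolve_left (by simpa using hc)
  have hear := h.ear
  have hb : b ∉ Vis := by
    rcases List.eq_nil_or_concat' B with rfl | ⟨B0, t, rfl⟩
    · simp at hdB; exact hdB ▸ hd
    · rw [hPe] at hear
      exact ((EarV.sub (A := A) (x := a) (B := b :: B0) (y := t) (C := []) (by simpa using hear)).2
        b (by simp)).1
  have hrem : ∀ e ∈ ledges P, e ∈ rem ↔ e = s(a, b) := by
    intro e he; rw [h.hrem e he]
    constructor
    · rintro (h | rfl); exacts [h, absurd he hl]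
    · exact .inl
  by_cases hh : P.head? = some c
  · by_cases hac : a = c
    · have hbd : d ≠ b := by
        intro hbd; apply h.ne; rw [hac, hbd]
      have : d ∈ B := by simpa [hbd] using hdB
      obtain ⟨B1, C, rfl⟩ := List.append_of_mem this
      subst hPe
      exact .mk0 (blk_T6b h.ear hc (by simp [hac]) h.hv h.hw h.hvw h.hvP h.hwP h.hS hrem)
    · obtain ⟨A', rfl⟩ : ∃ A', A = c :: A' := by
        cases A with
        | nil => simp [hPe] at hh; exact absurd hh hac
        | cons x A => simp [hPe] at hh; exact ⟨A, by rw [hh]⟩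
      have ha : a ∉ Vis := by
        rw [hPe] at hear
        exact ((EarV.sub (A := []) (x := c) (B := A' ++ [a]) (y := b) (C := B)
          (by simpa using hear)).2 a (by simp)).1
      obtain ⟨B1, C, e⟩ := List.append_of_mem hdB
      obtain ⟨K, hK⟩ := head_form e
      rw [e] at hPe
      subst hPe
      exact .mk0 (blk_T6a h.ear hc (by simp) ha hK h.hv h.hw h.hvw h.hvP h.hwP h.hS hrem)
  · subst hPe
    exact .mkc (blk_T5 h.ear hc hh hb hd hdB h.hv h.hw h.hvw h.hvP h.hwP h.hS hrem) hl (by simp)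

theorem ee_LSv' {A B : List W} (h : EEH r v w a b c d Vis P rem S)
    (hPe : P = A ++ a :: b :: B) (hl : s(c, d) ∉ ledges P) (hc : c ∈ Vis) :
    EEOut r v w a b c d Vis P rem S := by
  have hd : d ∉ Vis := h.hcd.resolve_left (by simpa using hc)
  have hdP := h.hd.resolve_left hd
  have : d ∈ b :: B ∨ d ∈ a :: A.reverse := by simp [hPe] at hdP ⊢; tauto
  rcases this with hdB | hdB
  · exact ee_LSv h hPe hl hc hdB
  · have hr : P.reverse = B.reverse ++ b :: a :: A.reverse := by simp [hPe]
    exact (ee_LSv h.sab.rev hr (by rwa [mem_ledges_reverse]) hc hdB).rev.sab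

theorem ee_LSR0 {A B A' B' C : List W} (h : EEH r v w a b c d Vis P rem S)
    (hPe : P = A ++ a :: b :: B) (hl : s(c, d) ∉ ledges P)
    (e : b :: B = A' ++ c :: (B' ++ d :: C)) :
    EEOut r v w a b c d Vis P rem S := by
  have hrem : ∀ e ∈ ledges P, e ∈ rem ↔ e = s(a, b) := by
    intro e he; rw [h.hrem e he]
    constructor
    · rintro (h | rfl); exacts [h, absurd he hl]
    · exact .inl
  obtain ⟨K, hK⟩ := head_form e
  have hPe' : P = A ++ a :: b :: (K ++ B' ++ d :: C) := by
    have : b :: B = b :: (K ++ B' ++ d :: C) := by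
      rw [e]
      have : A' ++ c :: (B' ++ d :: C) = (A' ++ [c]) ++ (B' ++ d :: C) := by simp
      rw [this, hK]; simp
    rw [hPe, this]
  have hcK : c ∈ b :: (K ++ B') := by
    have : c ∈ A' ++ [c] := by simp
    rw [hK] at this; simp at this ⊢; tauto
  subst hPe'
  exact .mkc (blk_S6 h.ear hcK h.hv h.hw h.hvw h.hvP h.hwP h.hS hrem) hl (by simp)

theorem ee_LSR {A B : List W} (h : EEH r v w a b c d Vis P rem S)
    (hPe : P = A ++ a :: b :: B) (hl : s(c, d) ∉ ledges P)
    (hc : c ∈ b :: B) (hd : d ∈ b :: B) :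
    EEOut r v w a b c d Vis P rem S := by
  rcases order2 hc hd h.cd with ⟨A', B', C, e⟩ | ⟨A', B', C, e⟩
  · exact ee_LSR0 h hPe hl e
  · exact (ee_LSR0 h.scd hPe (by rwa [Sym2.eq_swap]) e).scd

theorem ee_LSM0 {A B : List W} (h : EEH r v w a b c d Vis P rem S)
    (hPe : P = A ++ a :: b :: B) (hl : s(c, d) ∉ ledges P)
    (hc : c ∈ A) (hd : d ∈ b :: B) :
    EEOut r v w a b c d Vis P rem S := by
  have hrem : ∀ e ∈ ledges P, e ∈ rem ↔ e = s(a, b) := by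
    intro e he; rw [h.hrem e he]
    constructor
    · rintro (h | rfl); exacts [h, absurd he hl]
    · exact .inl
  obtain ⟨A', B1, rfl⟩ := List.append_of_mem hc
  obtain ⟨B2, C, e⟩ := List.append_of_mem hd
  obtain ⟨K, hK⟩ := head_form e
  rw [e] at hPe
  have hPe' : P = A' ++ c :: (B1 ++ a :: (B2 ++ d :: C)) := by rw [hPe]; simp
  subst hPe'
  exact .mk0 (blk_S7 h.ear hK h.cd h.hv h.hw h.hvw h.hvP h.hwP h.hS hrem)

theorem ee_LSM {A B : List W} (h : EEH r v w a b c d Vis P rem S)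
    (hPe : P = A ++ a :: b :: B) (hl : s(c, d) ∉ ledges P)
    (hc : c ∈ A ++ [a]) (hd : d ∈ b :: B) :
    EEOut r v w a b c d Vis P rem S := by
  by_cases hcA : c ∈ A
  · exact ee_LSM0 h hPe hl hcA hd
  · have hca : c = a := by simpa [hcA] using hc
    have hdb : d ≠ b := by
      intro hbd; apply h.ne; rw [hca, hbd]
    have hdB : d ∈ B.reverse := by simpa [hdb] using hd
    have hr : P.reverse = B.reverse ++ b :: a :: A.reverse := by simp [hPe]
    exact (ee_LSM0 h.sab.scd.rev hr (by rwa [mem_ledges_reverse, Sym2.eq_swap]) hdB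
      (by simp [hca])).rev.scd.sab

theorem ee_LS {A B : List W} (h : EEH r v w a b c d Vis P rem S)
    (hPe : P = A ++ a :: b :: B) (hl : s(c, d) ∉ ledges P) :
    EEOut r v w a b c d Vis P rem S := by
  have hl' : s(d, c) ∉ ledges P := by rwa [Sym2.eq_swap]
  by_cases hcV : c ∈ Vis
  · exact ee_LSv' h hPe hl hcV
  by_cases hdV : d ∈ Vis
  · exact (ee_LSv' h.scd hPe hl' hdV).scd
  have hr : P.reverse = B.reverse ++ b :: a :: A.reverse := by simp [hPe]
  have hcP := h.hc.resolve_left hcV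
  have hdP := h.hd.resolve_left hdV
  have hc' : c ∈ A ++ [a] ∨ c ∈ b :: B := by simp [hPe] at hcP ⊢; tauto
  have hd' : d ∈ A ++ [a] ∨ d ∈ b :: B := by simp [hPe] at hdP ⊢; tauto
  rcases hc' with hc' | hc' <;> rcases hd' with hd' | hd'
  · refine (ee_LSR h.sab.rev hr (by rwa [mem_ledges_reverse]) ?_ ?_).rev.sab
    · simp at hc' ⊢; tauto
    · simp at hd' ⊢; tauto
  · exact ee_LSM h hPe hl hc' hd'
  · exact (ee_LSM h.scd hPe hl' hd' hc').scd
  · exact ee_LSR h hPe hl hc' hd'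

theorem ee_LS' (h : EEH r v w a b c d Vis P rem S)
    (hl1 : s(a, b) ∈ ledges P) (hl : s(c, d) ∉ ledges P) :
    EEOut r v w a b c d Vis P rem S := by
  obtain ⟨A', x, y, C, e1, e2⟩ := exists_split_of_mem_ledges hl1
  have : (a = x ∧ b = y) ∨ (a = y ∧ b = x) := by simpa using e2
  rcases this with ⟨rfl, rfl⟩ | ⟨rfl, rfl⟩
  · exact ee_LS h e1 hl
  · exact (ee_LS h.sab e1 hl).sab

theorem ee_LL' (h : EEH r v w a b c d Vis P rem S)
    (hl1 : s(a, b) ∈ ledges P) (hl : s(c, d) ∈ ledges P) :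
    EEOut r v w a b c d Vis P rem S := by
  obtain ⟨A', x, y, C, e1, e2⟩ := exists_split_of_mem_ledges hl1
  have : (a = x ∧ b = y) ∨ (a = y ∧ b = x) := by simpa using e2
  rcases this with ⟨rfl, rfl⟩ | ⟨rfl, rfl⟩
  · exact ee_LL2 h e1 hl
  · exact (ee_LL2 h.sab e1 hl).sab

/-- both edges short -/
structure EES (r v w a b c d : W) (Vis : Set W) (P : List W) (rem S : Set (Sym2 W)) : Prop
    extends EEH r v w a b c d Vis P rem S where
  l1 : s(a, b) ∉ ledges P
  l2 : s(c, d) ∉ ledges P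

theorem EES.rev (h : EES r v w a b c d Vis P rem S) : EES r v w a b c d Vis P.reverse rem S :=
  ⟨h.toEEH.rev, by rw [mem_ledges_reverse]; exact h.l1, by rw [mem_ledges_reverse]; exact h.l2⟩
theorem EES.sab (h : EES r v w a b c d Vis P rem S) : EES r v w b a c d Vis P rem S :=
  ⟨h.toEEH.sab, by rw [Sym2.eq_swap]; exact h.l1, h.l2⟩
theorem EES.scd (h : EES r v w a b c d Vis P rem S) : EES r v w a b d c Vis P rem S :=
  ⟨h.toEEH.scd, h.l1, by rw [Sym2.eq_swap]; exact h.l2⟩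
theorem EES.swap (h : EES r v w a b c d Vis P rem S) : EES r w v c d a b Vis P rem S :=
  ⟨h.toEEH.swap, h.l2, h.l1⟩
theorem EES.hrem' (h : EES r v w a b c d Vis P rem S) : ∀ e ∈ ledges P, e ∉ rem := by
  intro e he hr
  rcases (h.hrem e he).1 hr with rfl | rfl
  exacts [h.l1 he, h.l2 he]

theorem ee_T8a {A B C : List W} (h : EES r v w a b a d Vis P rem S) (ha : a ∈ Vis)
    (hh : P.head? ≠ some a) (hPe : P = A ++ b :: (B ++ d :: C)) :
    EEOut r v w a b a d Vis P rem S := by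
  have hd : d ∉ Vis := h.hcd.resolve_left (by simpa using ha)
  have hr := h.hrem'
  subst hPe
  exact .mkc (blk_T8 h.ear ha hh (by simp) hd h.hv h.hw h.hvw h.hvP h.hwP h.hS hr) h.l2 (by simp)

theorem ee_T8b (h : EES r v w a b a d Vis P rem S) (ha : a ∈ Vis)
    (hh : P.head? ≠ some a) : EEOut r v w a b a d Vis P rem S := by
  have hd : d ∉ Vis := h.hcd.resolve_left (by simpa using ha)
  have hb : b ∉ Vis := h.hab.resolve_left (by simpa using ha)
  have hbd : b ≠ d := fun e => h.ne (by rw [e])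
  rcases order2 (h.hb.resolve_left hb) (h.hd.resolve_left hd) hbd with ⟨A', B', C, e⟩ | ⟨A', B', C, e⟩
  · exact ee_T8a h ha hh e
  · exact (ee_T8a h.swap ha hh e).swap

theorem ee_TT (h : EES r v w a b c d Vis P rem S) (ha : a ∈ Vis) (hc : c ∈ Vis) :
    EEOut r v w a b c d Vis P rem S := by
  have hd : d ∉ Vis := h.hcd.resolve_left (by simpa using hc)
  have hb : b ∉ Vis := h.hab.resolve_left (by simpa using ha)
  by_cases hac : a = c
  · subst hac
    rcases h.ear.pre_or ha with hh | hh
    · exact ee_T8b h ha hh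
    · exact (ee_T8b h.rev ha hh).rev
  · exact .mkac (blk_T7 h.ear h.long ha hc hac hb (h.hb.resolve_left hb) hd
      (h.hd.resolve_left hd) h.hv h.hw h.hvw h.hvP h.hwP h.hS h.hrem') h.l1 (by simp) h.l2 (by simp)

theorem ee_T9a {A B : List W} (h : EES r v w a b c d Vis P rem S) (hc : c ∈ Vis)
    (hb : b ∉ Vis)
    (hh : P.head? ≠ some c) (hPe : P = A ++ a :: B) (hbA : b ∉ A) (hdA : d ∉ A) :
    EEOut r v w a b c d Vis P rem S := by
  have hd : d ∉ Vis := h.hcd.resolve_left (by simpa using hc)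
  have hr := h.hrem'
  have hbP := h.hb.resolve_left hb
  have hdP := h.hd.resolve_left hd
  have hbB : b ∈ B := by simpa [hPe, hbA, h.ab.symm] using hbP
  by_cases had : d = a
  · subst had; subst hPe
    exact .mka (blk_T9iii h.ear hc hh hbB hb h.hv h.hw h.hvw h.hvP h.hwP h.hS hr) h.l1 (by simp)
  · have hdB : d ∈ B := by simpa [hPe, hdA, had] using hdP
    subst hPe
    exact .mkac (blk_T9i h.ear hc hh hdB hd hbB hb h.hv h.hw h.hvw h.hvP h.hwP h.hS hr) h.l1 (by simp) h.l2 (by simp)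

theorem ee_T9b {A B B' C : List W} (h : EES r v w a b c d Vis P rem S) (hc : c ∈ Vis)
    (hh : P.head? ≠ some c) (hPe : P = A ++ d :: (B ++ a :: (B' ++ b :: C))) :
    EEOut r v w a b c d Vis P rem S := by
  have hr := h.hrem'
  subst hPe
  exact .mka (blk_T9ii h.ear hc hh h.hv h.hw h.hvw h.hvP h.hwP h.hS hr) h.l1 (by simp)

theorem ee_T9h (h : EES r v w a b c d Vis P rem S) (hc : c ∈ Vis) (ha : a ∉ Vis)
    (hb : b ∉ Vis) (hh : P.head? ≠ some c) :
    EEOut r v w a b c d Vis P rem S := by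
  have hd : d ∉ Vis := h.hcd.resolve_left (by simpa using hc)
  have haP := h.ha.resolve_left ha
  have hbP := h.hb.resolve_left hb
  obtain ⟨A, p, B, e, hp, hA⟩ :=
    first_terminal (fun p => p = a ∨ p = b ∨ p = d) ⟨a, haP, by simp⟩
  have h1 : ∀ p, p = a ∨ p = b ∨ p = d → p ∉ A := fun p h h' => hA p h' h
  by_cases hpa : p = a
  · subst hpa; exact ee_T9a h hc hb hh e (h1 _ (by simp)) (h1 _ (by simp))
  by_cases hpb : p = b
  · subst hpb; exact (ee_T9a h.sab hc ha hh e (h1 _ (by simp)) (h1 _ (by simp))).sab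
  obtain rfl : p = d := by tauto
  have haB : a ∈ B := by simpa [e, h1 a, Ne.symm hpa] using haP
  have hbB : b ∈ B := by simpa [e, h1 b, Ne.symm hpb] using hbP
  rcases order2 haB hbB h.ab with ⟨A', B', C, rfl⟩ | ⟨A', B', C, rfl⟩
  · exact ee_T9b h hc hh e
  · exact (ee_T9b h.sab hc hh e).sab

theorem ee_T9 (h : EES r v w a b c d Vis P rem S) (hc : c ∈ Vis) (ha : a ∉ Vis)
    (hb : b ∉ Vis) : EEOut r v w a b c d Vis P rem S := by
  rcases h.ear.pre_or hc with hh | hh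
  · exact ee_T9h h hc ha hb hh
  · exact (ee_T9h h.rev hc ha hb hh).rev

theorem ee_S9s {A B B' C : List W} (h : EES r v w a b c b Vis P rem S)
    (hPe : P = A ++ a :: (B ++ c :: (B' ++ b :: C))) :
    EEOut r v w a b c b Vis P rem S := by
  have hr := h.hrem'
  obtain rfl : P = A ++ a :: ((B ++ c :: B') ++ b :: C) := by simp [hPe]
  exact .mkc (blk_S9' h.ear h.ab (by simp) h.hv h.hw h.hvw h.hvP h.hwP h.hS hr) h.l2 (by simp)

theorem ee_S8g {A B C : List W} (h : EES r v w a b c d Vis P rem S)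
    (hPe : P = A ++ a :: (B ++ d :: C)) (hb : b ∈ B) (hc : c ∈ B) (had : a ≠ d) :
    EEOut r v w a b c d Vis P rem S := by
  have hr := h.hrem'
  subst hPe
  exact .mkac (blk_S8 h.ear hb hc had h.hv h.hw h.hvw h.hvP h.hwP h.hS hr) h.l1 (by simp) h.l2 (by simp)

/-- shared vertex, `a` first -/
theorem ee_sh1 {A B : List W} (h : EES r v w a b c b Vis P rem S)
    (hPe : P = A ++ a :: B) (hb : b ∈ B) (hc : c ∈ B) :
    EEOut r v w a b c b Vis P rem S := by
  have hac : a ≠ c := fun e => h.ne (by rw [e])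
  rcases order2 hb hc h.cd.symm with ⟨A', B', C, rfl⟩ | ⟨A', B', C, rfl⟩
  · exact (ee_S8g (A := A) (B := A' ++ b :: B') (C := C) h.scd (by simp [hPe]) (by simp) (by simp)
      hac).scd
  · exact ee_S9s h hPe

theorem ee_sh (h : EES r v w a b c b Vis P rem S) (ha : a ∈ P) (hb : b ∈ P) (hc : c ∈ P) :
    EEOut r v w a b c b Vis P rem S := by
  have hac : a ≠ c := fun e => h.ne (by rw [e])
  obtain ⟨A, p, B, e, hp, hA⟩ :=
    first_terminal (fun p => p = a ∨ p = b ∨ p = c) ⟨a, ha, by simp⟩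
  have h1 : ∀ p, p = a ∨ p = b ∨ p = c → p ∉ A := fun p h h' => hA p h' h
  by_cases hpa : p = a
  · subst hpa
    exact ee_sh1 h e (by simpa [e, h1 b, h.ab.symm] using hb) (by simpa [e, h1 c, hac.symm] using hc)
  by_cases hpc : p = c
  · subst hpc
    exact (ee_sh1 h.swap e (by simpa [e, h1 b, h.cd.symm] using hb)
      (by simpa [e, h1 a, hac] using ha)).swap
  obtain rfl : p = b := by tauto
  have haB : a ∈ B := by simpa [e, h1 a, Ne.symm hpa] using ha
  have hcB : c ∈ B := by simpa [e, h1 c, Ne.symm hpc] using hc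
  rcases order2 haB hcB hac with ⟨A', B', C, rfl⟩ | ⟨A', B', C, rfl⟩
  · exact (ee_S9s (A := C.reverse) (B := B'.reverse) (B' := A'.reverse) (C := A.reverse)
      h.swap.rev (by simp [e])).rev.swap
  · exact (ee_S9s (A := C.reverse) (B := B'.reverse) (B' := A'.reverse) (C := A.reverse)
      h.rev (by simp [e])).rev

theorem ee_S9g {A B B' B'' C : List W} (h : EES r v w a b c d Vis P rem S)
    (hPe : P = A ++ a :: (B ++ c :: (B' ++ d :: (B'' ++ b :: C)))) :
    EEOut r v w a b c d Vis P rem S := by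
  have hr := h.hrem'
  subst hPe
  exact .mkc (blk_S9 h.ear h.ab h.hv h.hw h.hvw h.hvP h.hwP h.hS hr) h.l2 (by simp)

theorem ee_di1 {A B : List W} (h : EES r v w a b c d Vis P rem S)
    (hPe : P = A ++ a :: B) (hb : b ∈ B) (hc : c ∈ B) (hd : d ∈ B)
    (hac : a ≠ c) (had : a ≠ d) (hbc : b ≠ c) (hbd : b ≠ d) :
    EEOut r v w a b c d Vis P rem S := by
  obtain ⟨C, p, B0, e, hp, hA⟩ :=
    first_terminal (fun p => p = b ∨ p = c ∨ p = d) (l := B.reverse) ⟨b, by simpa using hb, by simp⟩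
  have h1 : ∀ p, p = b ∨ p = c ∨ p = d → p ∉ C := fun p h h' => hA p h' h
  have e' : B = B0.reverse ++ p :: C.reverse := by
    rw [← List.reverse_reverse B, e]; simp
  have h2 : ∀ p, p = b ∨ p = c ∨ p = d → p ∉ C.reverse := by simpa using h1
  clear e h1 hA
  generalize C.reverse = C1 at *
  generalize B0.reverse = B1 at *
  subst e'
  simp only [List.mem_append, List.mem_cons, h2 _ (.inl rfl), h2 _ (.inr (.inl rfl)),
    h2 _ (.inr (.inr rfl)), or_false] at hb hc hd
  rcases hp with rfl | rfl | rfl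
  · have hc := hc.resolve_right hbc.symm
    have hd := hd.resolve_right hbd.symm
    rcases order2 hc hd h.cd with ⟨A', B', C, rfl⟩ | ⟨A', B', C, rfl⟩
    · exact ee_S9g (A := A) (B := A') (B' := B') (B'' := C) (C := C1) h (by simp [hPe])
    · exact (ee_S9g (A := A) (B := A') (B' := B') (B'' := C) (C := C1) h.scd (by simp [hPe])).scd
  · exact (ee_S8g h.scd hPe (hb.resolve_right hbc) (hd.resolve_right h.cd.symm) hac).scd
  · exact ee_S8g h hPe (hb.resolve_right hbd) (hc.resolve_right h.cd) had

theorem ee_di (h : EES r v w a b c d Vis P rem S)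
    (ha : a ∈ P) (hb : b ∈ P) (hc : c ∈ P) (hd : d ∈ P)
    (hac : a ≠ c) (had : a ≠ d) (hbc : b ≠ c) (hbd : b ≠ d) :
    EEOut r v w a b c d Vis P rem S := by
  obtain ⟨A, p, B, e, hp, hA⟩ :=
    first_terminal (fun p => p = a ∨ p = b ∨ p = c ∨ p = d) ⟨a, ha, by simp⟩
  have h1 : ∀ p, p = a ∨ p = b ∨ p = c ∨ p = d → p ∉ A := fun p h h' => hA p h' h
  have h3 : ∀ q, q = a ∨ q = b ∨ q = c ∨ q = d → q ∈ P → q ≠ p → q ∈ B := by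
    intro q hq hqP hqp
    simpa [e, h1 q hq, hqp] using hqP
  have a1 := h3 a (by simp) ha
  have a2 := h3 b (by simp) hb
  have a3 := h3 c (by simp) hc
  have a4 := h3 d (by simp) hd
  have := h.ab
  have := h.cd
  clear h1 h3 hA
  rcases hp with rfl | rfl | rfl | rfl
  · exact ee_di1 h e (a2 (by grind)) (a3 (by grind)) (a4 (by grind)) hac had hbc hbd
  · exact (ee_di1 h.sab e (a1 (by grind)) (a3 (by grind)) (a4 (by grind)) hbc hbd hac had).sab
  · exact (ee_di1 h.swap e (a4 (by grind)) (a1 (by grind)) (a2 (by grind)) hac.symm hbc.symm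
      had.symm hbd.symm).swap
  · exact (ee_di1 h.swap.sab e (a3 (by grind)) (a1 (by grind)) (a2 (by grind)) had.symm hbd.symm
      hac.symm hbc.symm).sab.swap

theorem ee_out (h : EEH r v w a b c d Vis P rem S) : EEOut r v w a b c d Vis P rem S := by
  by_cases l1 : s(a, b) ∈ ledges P <;> by_cases l2 : s(c, d) ∈ ledges P
  · exact ee_LL' h l1 l2
  · exact ee_LS' h l1 l2
  · exact (ee_LS' h.swap l2 l1).swap
  have hs : EES r v w a b c d Vis P rem S := ⟨h, l1, l2⟩
  have k1 := h.hab
  have k2 := h.hcd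
  by_cases ha : a ∈ Vis
  · by_cases hc : c ∈ Vis
    · exact ee_TT hs ha hc
    by_cases hd : d ∈ Vis
    · exact (ee_TT hs.scd ha hd).scd
    · exact (ee_T9 hs.swap ha hc hd).swap
  by_cases hb : b ∈ Vis
  · by_cases hc : c ∈ Vis
    · exact (ee_TT hs.sab hb hc).sab
    by_cases hd : d ∈ Vis
    · exact (ee_TT hs.sab.scd hb hd).scd.sab
    · exact (ee_T9 hs.swap.scd hb hc hd).scd.swap
  by_cases hc : c ∈ Vis
  · exact ee_T9 hs hc ha hb
  by_cases hd : d ∈ Vis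
  · exact (ee_T9 hs.scd hd ha hb).scd
  have ha := h.ha.resolve_left ha
  have hb := h.hb.resolve_left hb
  have hc := h.hc.resolve_left hc
  have hd := h.hd.resolve_left hd
  by_cases hbd : b = d
  · subst hbd; exact ee_sh hs ha hb hc
  by_cases had : a = d
  · subst had; exact (ee_sh hs.sab hb ha hc).sab
  by_cases hbc : b = c
  · subst hbc; exact (ee_sh hs.scd ha hb hd).scd
  by_cases hac : a = c
  · subst hac; exact (ee_sh hs.sab.scd hb ha hd).scd.sab
  exact ee_di hs ha hb hc hd hac had hbc hbd

end OutEE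

section Extra
variable {W : Type u} {r v w a b c d : W} {Vis : Set W} {rem S : Set (Sym2 W)} {P : List W}

theorem BSeq.mono {r : W} {Z Z' : Set W} {S S' : Set (Sym2 W)} {Vis Vis' : Set W}
    {Qs : List (List W)} (h : BSeq r Z S Vis Qs) (hV : Vis' = Vis)
    (hZ : ∀ x, x ∉ Vis → x ∈ Z' → x ∈ Z) (hS : S ⊆ S') : BSeq r Z' S' Vis' Qs := by
  subst hV
  induction Qs generalizing Vis' with
  | nil => trivial
  | cons Q Qs ih =>
    obtain ⟨h1, h2, h3⟩ := h
    refine ⟨h1, ?_, ih h3 fun x hx => hZ x fun h => hx (.inl h)⟩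
    intro x hx hxV hxZ
    obtain ⟨y, hy, hyv⟩ := h2 x hx hxV (hZ x hxV hxZ)
    exact ⟨y, hS hy, hyv⟩

/-- first insert `w` on a short edge `cd` between visited vertices -/
theorem Blk.pre {Z N : Set W} {S' Left : Set (Sym2 W)} {Qs : List (List W)}
    (h : Blk r Z (Vis ∪ {w}) P N rem S Left Qs) (hlen : Qs.length ≤ 2)
    (hc : c ∈ Vis) (hd : d ∈ Vis) (hcd : c ≠ d) (hw : w ∉ Vis) (hv : v ∉ Vis) (hvw : v ≠ w)
    (hvS : s(w, v) ∈ S) (hL1 : s(w, c) ∉ Left) (hL2 : s(w, d) ∉ Left)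
    (hS' : ∀ e, e ∈ S' ↔ e ∈ S ∨ e = s(w, c) ∨ e = s(w, d)) :
    Blk r (Z ∪ {w}) Vis P (N ∪ {w}) rem S' Left ([c, w, d] :: Qs) := by
  have hvc : v ≠ c := by rintro rfl; exact hv hc
  have hvd : v ≠ d := by rintro rfl; exact hv hd
  have hvis : Vis ∪ {x | x ∈ [c, w, d]} = Vis ∪ {w} := by
    ext x; simp; grind
  refine ⟨⟨.path' c [w] d rfl hcd hc hd (by simp) (by simpa using hw), ?_, ?_⟩, ?_, by simp,
    by simp; omega, ?_, ?_⟩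
  · intro x hx hxV _
    have : x = w := by simp at hx; grind
    subst this
    exact ⟨v, (hS' _).2 (.inl hvS), hv, by simp [hvc, hvd, hvw]⟩
  · refine h.seq.mono hvis ?_ (fun e he => (hS' e).2 (.inl he))
    intro x hx hxZ
    rcases hxZ with h | h
    · exact h
    · exact absurd (Or.inr h) hx
  · intro Q hQ
    rcases List.mem_cons.1 hQ with rfl | hQ
    · simp
    · exact h.long Q hQ
  · intro x
    have := h.verts x
    simp only [List.mem_cons, exists_eq_or_imp, List.not_mem_nil, or_false, Set.mem_union,
      Set.mem_singleton_iff] at this ⊢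
    grind
  · intro e
    have := h.edges e
    simp only [List.mem_cons, exists_eq_or_imp, ledges_cons2, ledges_single, List.not_mem_nil,
      or_false, this, hS', Sym2.eq_swap (a := c) (b := w)]
    grind

theorem blk_ruL {t : W} (hc : c ∈ Vis) (ht : t ∈ Vis) (hct : c ≠ t) (hb : b ∉ Vis)
    (ha : a ∈ Vis)
    (hv : v ∉ Vis) (hw : w ∉ Vis) (hvw : v ≠ w) (hvb : v ≠ b) (hwb : w ≠ b)
    (hS : ∀ e, e ∈ S ↔ e = s(v, a) ∨ e = s(v, b) ∨ e = s(v, w) ∨ e = s(w, c) ∨ e = s(w, b))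
    (hrem : ∀ e ∈ ledges [c, b, t], e ∈ rem ↔ e = s(c, b)) :
    Blk r {w, b} Vis [c, b, t] {v, w} rem S {s(v, a)} [[c, w, b, t], [b, v, w]] := by
  have hab : a ≠ b := by rintro rfl; exact hb ha
  have haw : a ≠ w := by rintro rfl; exact hw ha
  have hcb : c ≠ b := by rintro rfl; exact hb hc
  have htb : t ≠ b := by rintro rfl; exact hb ht
  have hvc : v ≠ c := by rintro rfl; exact hv hc
  have hvt : v ≠ t := by rintro rfl; exact hv ht
  have hav : a ≠ v := by rintro rfl; exact hv ha
  refine ⟨⟨.path' c [w, b] t rfl hct hc ht (by simp [hwb]) (by simp [hw, hb]), ?_,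
    .path' b [v] w rfl hwb.symm (by simp) (by simp) (by simp)
      (by simp [hv, hvw, hvb, hvc, hvt]), ?_, trivial⟩, by simp, by simp, by simp, ?_, ?_⟩
  · rintro x hx hxV (rfl | rfl)
    · exact ⟨v, (hS _).2 (by simp), hv, by simp [hvc, hvw, hvb, hvt]⟩
    · exact ⟨v, (hS _).2 (by simp), hv, by simp [hvc, hvw, hvb, hvt]⟩
  · rintro x hx hxV (rfl | rfl) <;> simp at hxV
  · intro x; simp; tauto
  · intro e
    have hr := hrem e
    have h1 : s(v, b) ≠ s(v, a) := by simp; grind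
    have h2 : s(v, w) ≠ s(v, a) := by simp; grind
    have h3 : s(w, c) ≠ s(v, a) := by simp; grind
    have h4 : s(w, b) ≠ s(v, a) := by simp; grind
    have h5 : s(b, t) ≠ s(c, b) := by simp; grind
    simp only [ledges_cons2, ledges_single, List.mem_cons, hS,
      Sym2.eq_swap (a := c) (b := w), Sym2.eq_swap (a := b) (b := v), Set.mem_singleton_iff,
      List.not_mem_nil, or_false, exists_eq_or_imp, exists_eq_left] at hr ⊢
    grind

theorem blk_ruS (hP : EarV r Vis P) (hlong : 3 ≤ P.length) (hc : c ∈ Vis) (hb : b ∉ Vis)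
    (hbP : b ∈ P) (ha : a ∈ Vis)
    (hv : v ∉ Vis) (hw : w ∉ Vis) (hvw : v ≠ w) (hvP : v ∉ P) (hwP : w ∉ P)
    (hS : ∀ e, e ∈ S ↔ e = s(v, a) ∨ e = s(v, b) ∨ e = s(v, w) ∨ e = s(w, c) ∨ e = s(w, b))
    (hrem : ∀ e ∈ ledges P, e ∉ rem) :
    Blk r {w, b} Vis P {v, w} rem S {s(v, a)} [P, [c, w, b], [b, v, w]] := by
  have hab : a ≠ b := by rintro rfl; exact hb ha
  have haw : a ≠ w := by rintro rfl; exact hw ha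
  have hcb : c ≠ b := by rintro rfl; exact hb hc
  have hvc : v ≠ c := by rintro rfl; exact hv hc
  have hav : a ≠ v := by rintro rfl; exact hv ha
  have hvb : v ≠ b := by rintro rfl; exact hvP hbP
  have hwb : w ≠ b := by rintro rfl; exact hwP hbP
  refine ⟨⟨hP, ?_, .path' c [w] b rfl hcb (by simp [hc]) (by simp [hbP]) (by simp)
      (by simp [hw, hwP]), ?_,
    .path' b [v] w rfl hwb.symm (by simp) (by simp) (by simp)
      (by simp [hv, hvw, hvb, hvc, hvP]), ?_, trivial⟩, by simpa using hlong, by simp, by simp, ?_, ?_⟩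
  · rintro x hx hxV (rfl | rfl)
    · exact absurd hx hwP
    · exact ⟨v, (hS _).2 (by simp), hv, hvP⟩
  · rintro x hx hxV (rfl | rfl)
    · exact ⟨v, (hS _).2 (by simp), by simp [hv, hvP], by simp [hvc, hvw, hvb]⟩
    · simp [hbP] at hxV
  · rintro x hx hxV (rfl | rfl) <;> simp at hxV
  · intro x; simp; grind
  · intro e
    have hr := hrem e
    have h1 : s(v, b) ≠ s(v, a) := by simp; grind
    have h2 : s(v, w) ≠ s(v, a) := by simp; grind
    have h3 : s(w, c) ≠ s(v, a) := by simp; grind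
    have h4 : s(w, b) ≠ s(v, a) := by simp; grind
    simp only [ledges_cons2, ledges_single, List.mem_cons, hS,
      Sym2.eq_swap (a := c) (b := w), Sym2.eq_swap (a := b) (b := v), Set.mem_singleton_iff,
      List.not_mem_nil, or_false, exists_eq_or_imp, exists_eq_left] at hr ⊢
    grind

end Extra

section Build
variable {W : Type u} {H : SimpleGraph W}

theorem walk_edges {x y : W} (p : H.Walk x y) : p.edges = ledges p.support := by
  induction p with
  | nil => rfl
  | cons h p ih =>
    cases p with
    | nil => rfl
    | cons h' p => 
      rw [Walk.edges_cons, ih]; rfl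

theorem exists_walk {l : List W} (hne : l ≠ []) (h : ∀ e ∈ ledges l, e ∈ H.edgeSet) :
    ∃ (s t : W) (p : H.Walk s t), p.support = l := by
  induction l with
  | nil => simp at hne
  | cons a l ih =>
    cases l with
    | nil => exact ⟨a, a, .nil, rfl⟩
    | cons b l =>
      obtain ⟨s, t, p, hp⟩ := ih (by simp) (fun e he => h e (by rw [ledges_cons2]; simp [he]))
      have hs : s = b := by
        have := p.head_support
        simp [hp] at this; exact this.symm
      subst hs
      have had : H.Adj a s := h s(a, s) (by rw [ledges_cons2]; simp)
      exact ⟨a, t, .cons had p, by simp [hp]⟩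

namespace EarDecomposition
variable (D : EarDecomposition H)

/-- vertex list of the `j`-th ear -/
def lst (j : ℕ) : List W :=
  if j = 0 then D.cycle.support
  else if h : j - 1 < D.k then (D.path ⟨j - 1, h⟩).support else []

theorem lst_zero : D.lst 0 = D.cycle.support := rfl
theorem lst_succ {j : ℕ} (h : j < D.k) : D.lst (j + 1) = (D.path ⟨j, h⟩).support := by
  simp [lst, h]
theorem lst_big {j : ℕ} (h : D.k < j) : D.lst j = [] := by
  have : j ≠ 0 := by omega
  have : ¬ j - 1 < D.k := by omega
  simp [lst, *]

theorem earSupport_eq (j : ℕ) : D.earSupport j = {x | x ∈ D.lst j} := by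
  unfold earSupport ear lst
  split_ifs <;> ext x <;> simp [Walk.verts_toSubgraph]

theorem earEdges_eq (j : ℕ) : D.earEdges j = {e | e ∈ ledges (D.lst j)} := by
  unfold earEdges ear lst
  split_ifs <;> ext x <;> simp [Walk.edgeSet_toSubgraph, ← walk_edges, ledges]

theorem mem_Vbar (i : ℕ) (x : W) : x ∈ D.Vbar i ↔ ∀ j ≤ i, x ∉ D.lst j := by
  have : ∀ j, (D.ear j).verts = {x | x ∈ D.lst j} := D.earSupport_eq
  simp [Vbar, partialGraph, Subgraph.verts_iSup, this, Nat.lt_succ_iff]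

theorem birth_eq {x : W} {i : ℕ} (h : x ∈ D.lst i) (h' : ∀ j < i, x ∉ D.lst j) : D.birth x = i := by
  unfold birth
  simp only [earSupport_eq]
  apply le_antisymm
  · exact Nat.sInf_le h
  · by_contra hlt
    push Not at hlt
    exact h' _ hlt (Nat.sInf_mem (s := {i | x ∈ D.lst i}) ⟨i, h⟩)

theorem birthEdge_eq {x : Sym2 W} {i : ℕ} (h : x ∈ ledges (D.lst i))
    (h' : ∀ j < i, x ∉ ledges (D.lst j)) : D.birthEdge x = i := by
  unfold birthEdge
  simp only [earEdges_eq]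
  apply le_antisymm
  · exact Nat.sInf_le h
  · by_contra hlt
    push Not at hlt
    exact h' _ hlt (Nat.sInf_mem (s := {i | x ∈ ledges (D.lst i)}) ⟨i, h⟩)

theorem isLong_iff {j : ℕ} (hj : j ≤ D.k) : D.IsLong j ↔ 3 ≤ (D.lst j).length := by
  cases j with
  | zero =>
    simp [IsLong, lst_zero]
    have := D.cycle_isCycle.three_le_length; omega
  | succ j =>
    rw [lst_succ D (by omega), Walk.length_support]
    have : j < D.k := by omega
    simp [IsLong, this]

theorem cycle_len : 3 ≤ (D.lst 0).length := by
  simp [lst_zero]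
  have := D.cycle_isCycle.three_le_length; omega

end EarDecomposition

theorem EarV.exists_new {r : W} {Vis : Set W} {l : List W} (h : EarV r Vis l) (hl : 3 ≤ l.length) :
    ∃ x ∈ l, x ∉ Vis := by
  cases h with
  | path s M t hst hs ht hM hV =>
    cases M with
    | nil => simp at hl
    | cons m M => exact ⟨m, by simp, hV m (by simp)⟩
  | cyc M h0 hM hl => exact ⟨r, by simp, by simp [h0]⟩

theorem EarV.len_of_new {r x : W} {Vis : Set W} {l : List W} (h : EarV r Vis l) (hx : x ∈ l)
    (hxV : x ∉ Vis) : 3 ≤ l.length := by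
  cases h with
  | path s M t hst hs ht hM hV =>
    cases M with
    | nil => simp at hx; rcases hx with rfl | rfl <;> contradiction
    | cons m M => simp
  | cyc M h0 hM hl => simp; omega

theorem build (H : SimpleGraph W) (r u' : W) (K : ℕ) (Q : ℕ → List W)
    (hear : ∀ n < K, EarV r {x | ∃ m < n, x ∈ Q m} (Q n))
    (hns : ∀ n < K, ∀ x ∈ Q n, (∀ m < n, x ∉ Q m) → x ≠ u' →
      ∃ y, H.Adj x y ∧ ∀ m ≤ n, y ∉ Q m)
    (hdis : ∀ m n, m < n → n < K → ∀ e ∈ ledges (Q m), e ∉ ledges (Q n))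
    (hH : ∀ e, e ∈ H.edgeSet ↔ ∃ n < K, e ∈ ledges (Q n))
    (hcov : ∀ x, ∃ n < K, x ∈ Q n)
    (hu : ∃ n < K, (Q n).length = 2 ∧ s(r, u') ∈ ledges (Q n)) :
    ∃ D' : EarDecomposition H, IsMondshein D' r u' ∧
      D'.earList = (List.range K).map (fun n => {e | e ∈ ledges (Q n)}) := by
  obtain ⟨n0, hn0, hn0l, hn0e⟩ := hu
  obtain ⟨k, rfl⟩ : ∃ k, K = k + 1 := ⟨K - 1, by omega⟩
  have hear0 := hear 0 (by omega)
  have hempty : {x : W | ∃ m < 0, x ∈ Q m} = ∅ := by ext; simp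
  rw [hempty] at hear0
  obtain ⟨M, hM, hMn, hMl⟩ : ∃ M, Q 0 = r :: (M ++ [r]) ∧ (r :: M).Nodup ∧ 2 ≤ M.length := by
    generalize hq : Q 0 = l at hear0
    cases hear0 with
    | path s M t hst hs ht hM hV => simp at hs
    | cyc M h0 hM hl => exact ⟨M, rfl, hM, hl⟩
  have hwalk : ∀ n < k + 1, ∃ (s t : W) (p : H.Walk s t), p.support = Q n := by
    intro n hn
    refine exists_walk ?_ (fun e he => (hH e).2 ⟨n, hn, he⟩)
    have := (hear n hn).length
    intro h; simp [h] at this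
  obtain ⟨c, hc⟩ : ∃ c : H.Walk r r, c.support = Q 0 := by
    obtain ⟨s, t, p, hp⟩ := hwalk 0 (by omega)
    have hs : s = r := by
      have := p.head_support
      simp [hp, hM] at this; exact this.symm
    have ht : t = r := by
      have := p.getLast_support
      simp [hp, hM] at this; exact this.symm
    subst hs; subst ht
    exact ⟨p, hp⟩
  have hcc : c.IsCycle := by
    rw [Walk.isCycle_def]
    refine ⟨⟨?_⟩, ?_, ?_⟩
    · rw [walk_edges, hc]; exact hear0.ledges_nodup
    · rintro rfl; simp [hM] at hc
    · rw [hc, hM]; simp only [List.tail_cons]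
      rw [List.nodup_append_comm]; simpa using hMn
  choose s t p hp using fun i : Fin k => hwalk (i + 1) (by omega)
  have hr0 : r ∈ Q 0 := by simp [hM]
  have hpf : ∀ i : Fin k, ∃ M, Q (i + 1) = s i :: (M ++ [t i]) ∧ s i ≠ t i ∧
      s i ∈ {x | ∃ m < (i : ℕ) + 1, x ∈ Q m} ∧ t i ∈ {x | ∃ m < (i : ℕ) + 1, x ∈ Q m} ∧ M.Nodup ∧
      ∀ x ∈ M, x ∉ {x | ∃ m < (i : ℕ) + 1, x ∈ Q m} := by
    intro i
    obtain ⟨s', M, t', e, h⟩ := (hear (i + 1) (by omega)).path_form (q := r) ⟨0, by omega, hr0⟩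
    have hs : s' = s i := by
      have := (p i).head_support
      simp [hp, e] at this; exact this
    have ht : t' = t i := by
      have := (p i).getLast_support
      simp [hp, e] at this; exact this
    subst hs; subst ht
    exact ⟨M, e, h⟩
  let D : EarDecomposition H :=
    { k := k
      v0 := r
      cycle := c
      cycle_isCycle := hcc
      s := s
      t := t
      path := p
      path_isPath := by
        intro i
        rw [Walk.isPath_def, hp]
        exact (hear (i + 1) (by omega)).nodup (q := r) ⟨0, by omega, hr0⟩
      path_length_pos := by
        intro i
        have := (hear (i + 1) (by omega)).length
        rw [← hp, Walk.length_support] at this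
        omega
      edges_cover := by
        intro e he
        obtain ⟨n, hn, h⟩ := (hH e).1 he
        cases n with
        | zero => left; rw [walk_edges, hc]; exact h
        | succ n => right; exact ⟨⟨n, by omega⟩, by rw [walk_edges, hp]; exact h⟩
      cycle_path_disjoint := by
        intro i e he he'
        rw [walk_edges, hp] at he
        rw [walk_edges, hc] at he'
        exact hdis 0 (i + 1) (by omega) (by omega) e he' he
      path_path_disjoint := by
        intro i j hij e he he'
        rw [walk_edges, hp] at he he'
        have : (i : ℕ) ≠ j := fun h => hij (Fin.ext h)
        rcases lt_or_gt_of_ne this with h | h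
        · exact hdis (i + 1) (j + 1) (by omega) (by omega) e he he'
        · exact hdis (j + 1) (i + 1) (by omega) (by omega) e he' he
      meets_prev := by
        intro i x hx
        obtain ⟨M, e, hst, hs, ht, hM, hV⟩ := hpf i
        have key : (x ∈ c.support ∨ ∃ j, j < i ∧ x ∈ (p j).support) ↔
            x ∈ {x | ∃ m < (i : ℕ) + 1, x ∈ Q m} := by
          constructor
          · rintro (h | ⟨j, hj, h⟩)
            · exact ⟨0, by omega, hc ▸ h⟩
            · exact ⟨j + 1, by have : (j : ℕ) < i := hj; omega, hp j ▸ h⟩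
          · rintro ⟨m, hm, h⟩
            cases m with
            | zero => left; rw [hc]; exact h
            | succ m => exact .inr ⟨⟨m, by omega⟩, by rw [Fin.lt_def]; simp; omega, by rw [hp]; exact h⟩
        rw [key]
        rw [hp, e] at hx
        constructor
        · intro h
          by_contra hne
          push Not at hne
          exact hV x (by simpa [hne.1, hne.2] using hx) h
        · rintro (rfl | rfl) <;> assumption }
  have hl : ∀ n ≤ k, D.lst n = Q n := by
    intro n hn
    cases n with
    | zero => exact hc
    | succ n => rw [D.lst_succ (j := n) (show n < k by omega)]; exact hp _
  have hinner : ∀ n ≤ k, ∀ x, x ∈ D.inner n ↔ x ∈ Q n ∧ ∀ m < n, x ∉ Q m := by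
    intro n hn x
    cases n with
    | zero =>
      simp [EarDecomposition.inner, EarDecomposition.earSupport_eq, hl]
    | succ n =>
      have hn' : n < k := by omega
      have hnD : n < D.k := hn'
      obtain ⟨M, e, hst, hs, ht, hM, hV⟩ := hpf ⟨n, hn'⟩
      simp only [EarDecomposition.inner, Nat.add_sub_cancel, hnD, dif_pos, if_neg (Nat.succ_ne_zero n)]
      have e1 : (D.path ⟨n, hnD⟩).support = Q (n + 1) := hp ⟨n, hn'⟩
      have e2 : D.s ⟨n, hnD⟩ = s ⟨n, hn'⟩ := rfl
      have e3 : D.t ⟨n, hnD⟩ = t ⟨n, hn'⟩ := rfl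
      change x ∈ (D.path ⟨n, hnD⟩).support ∧ x ≠ s ⟨n, hn'⟩ ∧ x ≠ t ⟨n, hn'⟩ ↔ _
      rw [e1]
      refine and_congr_right fun hx => ?_
      constructor
      · rintro ⟨h1, h2⟩ m hm hxm
        simp only [] at e
        rw [e] at hx
        exact hV x (by simpa [h1, h2] using hx) ⟨m, hm, hxm⟩
      · intro h
        constructor
        · rintro rfl
          obtain ⟨m, hm, hms⟩ := hs
          exact h m hm hms
        · rintro rfl
          obtain ⟨m, hm, hms⟩ := ht
          exact h m hm hms
  -- the last ear with a new vertex
  have hex : ∃ m, m ≤ k ∧ (∃ x ∈ Q m, ∀ j < m, x ∉ Q j) ∧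
      ∀ n ≤ k, m < n → ¬ ∃ x ∈ Q n, ∀ j < n, x ∉ Q j := by
    classical
    let F := (Finset.range (k + 1)).filter (fun m => ∃ x ∈ Q m, ∀ j < m, x ∉ Q j)
    have hF : F.Nonempty := ⟨0, by simp [F]; exact ⟨r, hr0⟩⟩
    refine ⟨F.max' hF, ?_, ?_, ?_⟩
    · have := F.max'_mem hF; exact Nat.lt_succ_iff.1 (Finset.mem_range.1 (Finset.mem_filter.1 this).1)
    · have := F.max'_mem hF; exact (Finset.mem_filter.1 this).2
    · intro n hn hlt hx
      have : n ∈ F := Finset.mem_filter.2 ⟨by simp; omega, hx⟩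
      exact absurd (F.le_max' n this) (by omega)
  obtain ⟨m, hmk, ⟨x0, hx0, hx0'⟩, hmax⟩ := hex
  have hall : ∀ y, ∃ j ≤ m, y ∈ Q j := by
    intro y
    have hy := hcov y
    classical
    have h1 := Nat.find_spec hy
    refine ⟨Nat.find hy, ?_, h1.2⟩
    by_contra hlt
    refine hmax (Nat.find hy) (by omega) (by omega) ⟨y, h1.2, fun j hj hyj => ?_⟩
    exact Nat.find_min hy hj ⟨by omega, hyj⟩
  have huniq : ∀ x ∈ Q m, (∀ j < m, x ∉ Q j) → x = u' := by
    intro x hx hx'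
    by_contra hne
    obtain ⟨y, _, hy⟩ := hns m (by omega) x hx hx' hne
    obtain ⟨j, hj, hyj⟩ := hall y
    exact hy j hj hyj
  obtain rfl := huniq x0 hx0 hx0'
  have hb : D.birth x0 = m := D.birth_eq (by rw [hl m hmk]; exact hx0)
    (fun j hj => by rw [hl j (by omega)]; exact hx0' j hj)
  have hlongm : 3 ≤ (Q m).length := (hear m (by omega)).len_of_new hx0 (by simpa using hx0')
  refine ⟨D, ⟨?_, ?_, ?_, ?_, ?_, ?_⟩, ?_⟩
  · rw [D.earSupport_eq, hl 0 (by omega)]; exact hr0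
  · rw [hb, D.isLong_iff hmk, hl m hmk]; exact hlongm
  · intro j hj hjl
    rw [D.isLong_iff hj, hl j hj] at hjl
    rw [hb]
    by_contra hlt
    have hj' : j ≤ k := hj
    obtain ⟨x, hx, hx'⟩ := (hear j (by omega)).exists_new hjl
    exact hmax j hj (by omega) ⟨x, hx, by simpa using hx'⟩
  · rw [hb]; ext x
    rw [hinner m hmk]
    constructor
    · rintro ⟨h1, h2⟩; exact huniq x h1 h2
    · rintro rfl; exact ⟨hx0, hx0'⟩
  · rw [hb, D.earEdges_eq, hl m hmk]
    intro he
    have hne : n0 ≠ m := by rintro rfl; omega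
    rcases lt_or_gt_of_ne hne with h | h
    · exact hdis n0 m h (by omega) _ hn0e he
    · exact hdis m n0 h (by omega) _ he hn0e
  · intro i hi hne x hx
    have hi' : i ≤ k := hi
    rw [hinner i hi] at hx
    obtain ⟨z, hz⟩ := hne
    rw [D.mem_Vbar] at hz
    have hxu : x ≠ x0 := by
      rintro rfl
      have him : i = m := by
        rcases lt_trichotomy i m with h | h | h
        · exact absurd hx.1 (hx0' i h)
        · exact h
        · exact absurd hx0 (hx.2 m h)
      obtain ⟨j, hj, hzj⟩ := hall z
      exact hz j (by omega) (by rw [hl j (by omega)]; exact hzj)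
    obtain ⟨y, hy, hy'⟩ := hns i (by omega) x hx.1 hx.2 hxu
    refine ⟨y, (D.mem_Vbar i y).2 fun j hj => ?_, hy⟩
    rw [hl j (by omega)]; exact hy' j hj
  · unfold EarDecomposition.earList
    apply List.map_congr_left
    intro n hn
    rw [D.earEdges_eq, hl n (by have : n < k + 1 := by simpa using hn
                                omega)]

end Build

section Assemble
variable {W : Type u}

/-- every edge of a long ear has a new endpoint -/
theorem EarV.edge_new {r : W} {Vis : Set W} {l : List W} (h : EarV r Vis l) (hl : 3 ≤ l.length)
    {x y : W} (he : s(x, y) ∈ ledges l) (hx : x ∈ Vis) (hy : y ∈ Vis) : False := by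
  cases h with
  | cyc M h0 hM hl => simp [h0] at hx
  | path s M t hst hs ht hM hV =>
    have key : ∀ (N : List W) (s : W), (∀ x ∈ N, x ∉ Vis) → N ≠ [] → ∀ e ∈ ledges (s :: (N ++ [t])),
        ∃ z ∈ N, z ∈ e := by
      intro N
      induction N with
      | nil => intro s _ h; simp at h
      | cons a N ih =>
        intro s hN _ e he
        rw [List.cons_append, ledges_cons2] at he
        rcases List.mem_cons.1 he with rfl | he
        · exact ⟨a, by simp, by simp⟩
        · by_cases hN0 : N = []
          · subst hN0
            simp [ledges] at he
            exact ⟨a, by simp, by simp [he]⟩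
          · obtain ⟨z, hz, h⟩ := ih a (fun x hx => hN x (by simp [hx])) hN0 e he
            exact ⟨z, by simp [hz], h⟩
    obtain ⟨z, hz, h⟩ := key M s hV (by rintro rfl; simp at hl) _ he
    rcases Sym2.mem_iff.1 h with rfl | rfl
    · exact hV _ hz hx
    · exact hV _ hz hy

/-- A valid sequence of ears. -/
def FSeq (H : SimpleGraph W) (r u' : W) : Set W → List (List W) → Prop
  | _, [] => True
  | Vis, Q :: Qs => EarV r Vis Q ∧
      (∀ x ∈ Q, x ∉ Vis → x ≠ u' → ∃ y, H.Adj x y ∧ y ∉ Vis ∧ y ∉ Q) ∧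
      FSeq H r u' (Vis ∪ {x | x ∈ Q}) Qs

variable {H : SimpleGraph W} {r u' : W}

theorem FSeq.append : ∀ {A B : List (List W)} {Vis : Set W}, FSeq H r u' Vis A →
    FSeq H r u' (Vis ∪ {x | ∃ Q ∈ A, x ∈ Q}) B → FSeq H r u' Vis (A ++ B)
  | [], B, Vis, _, h => by simpa using h
  | Q :: A, B, Vis, ⟨h1, h2, h3⟩, h => by
    refine ⟨h1, h2, h3.append ?_⟩
    convert h using 1
    ext x; simp; tauto

theorem FSeq.getD : ∀ {Ls : List (List W)} {Vis : Set W}, FSeq H r u' Vis Ls → ∀ n < Ls.length,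
    EarV r (Vis ∪ {x | ∃ m < n, x ∈ Ls.getD m []}) (Ls.getD n []) ∧
    ∀ x ∈ Ls.getD n [], x ∉ (Vis ∪ {x | ∃ m < n, x ∈ Ls.getD m []}) → x ≠ u' →
      ∃ y, H.Adj x y ∧ y ∉ (Vis ∪ {x | ∃ m < n, x ∈ Ls.getD m []}) ∧ y ∉ Ls.getD n []
  | [], Vis, _, n, hn => by simp at hn
  | Q :: Ls, Vis, ⟨h1, h2, h3⟩, 0, hn => by simpa using ⟨h1, h2⟩
  | Q :: Ls, Vis, ⟨h1, h2, h3⟩, n + 1, hn => by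
    have := h3.getD n (by simpa using hn)
    have e : (Vis ∪ {x | ∃ m < n + 1, x ∈ (Q :: Ls).getD m []}) =
        ((Vis ∪ {x | x ∈ Q}) ∪ {x | ∃ m < n, x ∈ Ls.getD m []}) := by
      ext x
      constructor
      · rintro (h | ⟨m, hm, h⟩)
        · exact .inl (.inl h)
        · cases m with
          | zero => exact .inl (.inr (by simpa using h))
          | succ m => exact .inr ⟨m, by omega, by simpa using h⟩
      · rintro ((h | h) | ⟨m, hm, h⟩)
        · exact .inl h
        · exact .inr ⟨0, by omega, by simpa using h⟩
        · exact .inr ⟨m + 1, by omega, by simpa using h⟩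
    rw [e]
    simpa only [List.getD_cons_succ] using this

theorem FSeq.ear_edge : ∀ {Ls : List (List W)} {Vis : Set W}, FSeq H r u' Vis Ls →
    (∀ Q ∈ Ls, 3 ≤ Q.length) → ∀ Q ∈ Ls, ∀ x y, s(x, y) ∈ ledges Q → x ∈ Vis → y ∈ Vis → False
  | [], Vis, _, _, Q, hQ, _, _, _, _, _ => by simp at hQ
  | Q :: Ls, Vis, ⟨h1, h2, h3⟩, hl, Q', hQ, x, y, he, hx, hy => by
    rcases List.mem_cons.1 hQ with rfl | hQ
    · exact h1.edge_new (hl _ (by simp)) he hx hy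
    · exact h3.ear_edge (fun Q hQ => hl Q (by simp [hQ])) Q' hQ x y he (.inl hx) (.inl hy)

theorem FSeq.pairwise : ∀ {Ls : List (List W)} {Vis : Set W}, FSeq H r u' Vis Ls →
    (∀ Q ∈ Ls, 3 ≤ Q.length) → Ls.Pairwise (fun Q Q' => ∀ e ∈ ledges Q, e ∉ ledges Q')
  | [], Vis, _, _ => .nil
  | Q :: Ls, Vis, ⟨h1, h2, h3⟩, hl => by
    refine .cons ?_ (h3.pairwise (fun Q hQ => hl Q (by simp [hQ])))
    intro Q' hQ' e he he'
    induction e with | _ x y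
    exact h3.ear_edge (fun Q hQ => hl Q (by simp [hQ])) Q' hQ' x y he'
      (.inr (left_mem_of_mem_ledges he)) (.inr (right_mem_of_mem_ledges he))

theorem assemble (H : SimpleGraph W) (r u' : W) (K : ℕ) (g : ℕ → List (List W)) (vis : ℕ → Set W)
    (h0 : vis 0 = ∅)
    (hstep : ∀ j < K, vis (j + 1) = vis j ∪ {x | ∃ Q ∈ g j, x ∈ Q})
    (hseq : ∀ j < K, FSeq H r u' (vis j) (g j))
    (hlong : ∀ j < K, (∀ Q ∈ g j, 3 ≤ Q.length) ∨ (g j).length ≤ 1)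
    (hdis : ∀ j j', j < j' → j' < K → ∀ Q ∈ g j, ∀ Q' ∈ g j', ∀ e ∈ ledges Q, e ∉ ledges Q')
    (hH : ∀ e, e ∈ H.edgeSet ↔ ∃ j < K, ∃ Q ∈ g j, e ∈ ledges Q)
    (hcov : ∀ x, x ∈ vis K)
    (hu : ∃ j < K, ∃ Q ∈ g j, Q.length = 2 ∧ s(r, u') ∈ ledges Q) :
    ∃ D' : EarDecomposition H, IsMondshein D' r u' ∧
      D'.earList = (List.range K).flatMap (fun j => (g j).map (fun l => {e | e ∈ ledges l})) := by
  have hall : ∀ j ≤ K, FSeq H r u' ∅ ((List.range j).flatMap g) ∧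
      vis j = {x | ∃ Q ∈ (List.range j).flatMap g, x ∈ Q} := by
    intro j
    induction j with
    | zero => intro _; simp [h0, FSeq]
    | succ j ih =>
      intro hj
      obtain ⟨i1, i2⟩ := ih (by omega)
      have hr : (List.range (j + 1)).flatMap g = (List.range j).flatMap g ++ g j := by
        rw [List.range_succ, List.flatMap_append]; simp
      rw [hr]
      constructor
      · refine i1.append ?_
        rw [← i2]; simpa using hseq j (by omega)
      · rw [hstep j (by omega), i2]
        ext x; simp only [List.mem_append, Set.mem_union, Set.mem_setOf_eq]
        constructor
        · rintro (⟨Q, h, h'⟩ | ⟨Q, h, h'⟩)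
          · exact ⟨Q, .inl h, h'⟩
          · exact ⟨Q, .inr h, h'⟩
        · rintro ⟨Q, h | h, h'⟩
          · exact .inl ⟨Q, h, h'⟩
          · exact .inr ⟨Q, h, h'⟩
  obtain ⟨hF, hvis⟩ := hall K le_rfl
  have hpw : ((List.range K).flatMap g).Pairwise (fun Q Q' => ∀ e ∈ ledges Q, e ∉ ledges Q') := by
    rw [List.pairwise_flatMap]
    constructor
    · intro j hj
      have hj : j < K := by simpa using hj
      rcases hlong j hj with h | h
      · exact (hseq j hj).pairwise h
      · generalize g j = l at h
        match l, h with
        | [], _ => exact .nil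
        | [a], _ => exact List.pairwise_singleton _ _
    · have : (List.range K).Pairwise (fun a b => a < b ∧ b < K) := by
        refine List.Pairwise.imp_of_mem ?_ List.pairwise_lt_range
        intro a b ha hb hab
        exact ⟨hab, by simpa using hb⟩
      exact this.imp fun {a b} ⟨h1, h2⟩ Q hQ Q' hQ' => hdis a b h1 h2 Q hQ Q' hQ'
  have hmem : ∀ Q, Q ∈ (List.range K).flatMap g ↔ ∃ j < K, Q ∈ g j := by
    intro Q; simp [List.mem_flatMap]
  have hrhs : (List.range K).flatMap (fun j => (g j).map (fun l => {e | e ∈ ledges l})) =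
      ((List.range K).flatMap g).map (fun l => {e | e ∈ ledges l}) := by
    rw [List.map_flatMap]
  rw [hrhs]
  generalize hLs : (List.range K).flatMap g = Ls at *
  have hget : ∀ Q ∈ Ls, ∃ n < Ls.length, Ls.getD n [] = Q := by
    intro Q hQ
    obtain ⟨n, hn, rfl⟩ := List.mem_iff_getElem.1 hQ
    exact ⟨n, hn, by simp [hn]⟩
  have hget' : ∀ n < Ls.length, Ls.getD n [] ∈ Ls := by
    intro n hn; simp [hn]
  obtain ⟨D', h1, h2⟩ := build H r u' Ls.length (fun n => Ls.getD n [])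
    (fun n hn => by simpa using (hF.getD n hn).1)
    (fun n hn x hx hx' hxu => by
      obtain ⟨y, h1, h2, h3⟩ := (hF.getD n hn).2 x hx (by simpa using hx') hxu
      refine ⟨y, h1, fun m hm hy => ?_⟩
      rcases hm.lt_or_eq with hm | rfl
      · exact h2 (.inr ⟨m, hm, hy⟩)
      · exact h3 hy)
    (fun m n hmn hn e he => by
      have := List.pairwise_iff_getElem.1 hpw m n (by omega) hn hmn
      have e1 : Ls.getD m [] = Ls[m] := by simp [show m < Ls.length by omega]
      have e2 : Ls.getD n [] = Ls[n] := by simp [hn]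
      simp only [e1, e2] at he ⊢
      exact this e he)
    (fun e => by
      rw [hH]
      constructor
      · rintro ⟨j, hj, Q, hQ, he⟩
        obtain ⟨n, hn, rfl⟩ := hget Q ((hmem Q).2 ⟨j, hj, hQ⟩)
        exact ⟨n, hn, he⟩
      · rintro ⟨n, hn, he⟩
        obtain ⟨j, hj, hQ⟩ := (hmem _).1 (hget' n hn)
        exact ⟨j, hj, _, hQ, he⟩)
    (fun x => by
      have := hcov x
      rw [hvis] at this
      obtain ⟨Q, hQ, hx⟩ := this
      obtain ⟨n, hn, rfl⟩ := hget Q hQ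
      exact ⟨n, hn, hx⟩)
    (by
      obtain ⟨j, hj, Q, hQ, h1, h2⟩ := hu
      obtain ⟨n, hn, rfl⟩ := hget Q ((hmem Q).2 ⟨j, hj, hQ⟩)
      exact ⟨n, hn, h1, h2⟩)
  refine ⟨D', h1, h2.trans ?_⟩
  apply List.ext_getElem
  · simp
  · intro n h1 h2
    simp at h1
    simp [h1]

theorem BSeq.toFSeq {Z : Set W} {S : Set (Sym2 W)} (hS : ∀ e ∈ S, e ∈ H.edgeSet) {U : Set W} :
    ∀ {Qs : List (List W)} {Vis : Set W}, BSeq r Z S Vis Qs → (Vis ⊆ U) →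
    (∀ Q ∈ Qs, ∀ x ∈ Q, x ∈ U) →
    (∀ Q ∈ Qs, ∀ x ∈ Q, x ∉ Vis → x ∉ Z → x ≠ u' → ∃ y, H.Adj x y ∧ y ∉ U) →
    FSeq H r u' Vis Qs
  | [], Vis, _, _, _, _ => trivial
  | Q :: Qs, Vis, ⟨h1, h2, h3⟩, hU, hQU, hns => by
    refine ⟨h1, ?_, h3.toFSeq hS ?_ (fun Q' hQ' => hQU Q' (by simp [hQ'])) ?_⟩
    · intro x hx hxV hxu
      by_cases hxZ : x ∈ Z
      · obtain ⟨y, hy, h⟩ := h2 x hx hxV hxZ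
        exact ⟨y, hS _ hy, h⟩
      · obtain ⟨y, hy, h⟩ := hns Q (by simp) x hx hxV hxZ hxu
        exact ⟨y, hy, fun h' => h (hU h'), fun h' => h (hQU Q (by simp) y h')⟩
    · rintro x (hx | hx)
      · exact hU hx
      · exact hQU Q (by simp) x hx
    · intro Q' hQ' x hx hxV
      exact hns Q' (by simp [hQ']) x hx (fun h => hxV (.inl h))
end Assemble

section Extract
variable {V : Type u}

/-- combinatorial data extracted from a Mondshein sequence -/
structure Mon (G : SimpleGraph V) (r u : V) (k : ℕ) (P : ℕ → List V) (bt : V → ℕ) : Prop where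
  ear : ∀ j ≤ k, EarV r {x | bt x < j} (P j)
  mem : ∀ j ≤ k, ∀ x ∈ P j, bt x ≤ j
  self : ∀ x, x ∈ P (bt x)
  le : ∀ x, bt x ≤ k
  dis : ∀ i j, i < j → j ≤ k → ∀ e ∈ ledges (P i), e ∉ ledges (P j)
  edges : ∀ e, e ∈ G.edgeSet ↔ ∃ j ≤ k, e ∈ ledges (P j)
  ns : ∀ x, x ≠ u → ∃ y, G.Adj x y ∧ bt x < bt y
  umax : ∀ x, x ≠ u → bt x < bt u
  ulast : ∃ s t, P (bt u) = [s, u, t]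
  ru : s(r, u) ∉ ledges (P (bt u))

theorem walk_form {G : SimpleGraph V} {x y : V} (p : G.Walk x y) (h : 0 < p.length) :
    ∃ M, p.support = x :: (M ++ [y]) := by
  cases p with
  | nil => simp at h
  | cons h q =>
    refine ⟨q.support.dropLast, ?_⟩
    rw [Walk.support_cons]
    congr 1
    conv_lhs => rw [← List.dropLast_append_getLast q.support_ne_nil, q.getLast_support]

theorem extract [Fintype V] (G : SimpleGraph V) (r u : V)
    (hG : KConnected 3 G) (D : EarDecomposition G) (hD : IsMondshein D r u) :
    ∃ P : ℕ → List V, Mon G r u D.k P D.birth ∧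
      (∀ j ≤ D.k, D.earEdges j = {e | e ∈ ledges (P j)}) ∧
      (∀ j ≤ D.k, D.IsLong j ↔ 3 ≤ (P j).length) ∧
      (∀ j ≤ D.k, ∀ e ∈ ledges (P j), D.birthEdge e = j) := by
  classical
  obtain ⟨hr, hL1, hL2, hin, hru, hns⟩ := hD
  have hr' : r ∈ D.cycle.support := by
    rw [D.earSupport_eq] at hr; exact hr
  let c := D.cycle.rotate r hr'
  have hc : c.IsCycle := D.cycle_isCycle.rotate hr'
  let P : ℕ → List V := fun j => if j = 0 then c.support else D.lst j
  have hsub : c.toSubgraph = D.cycle.toSubgraph := D.cycle.toSubgraph_rotate hr'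
  have hPmem : ∀ j x, x ∈ P j ↔ x ∈ D.lst j := by
    intro j x
    by_cases hj : j = 0
    · subst hj
      simp only [P, if_true, D.lst_zero]
      rw [← Walk.mem_verts_toSubgraph, ← Walk.mem_verts_toSubgraph, hsub]
    · simp [P, hj]
  have hPed : ∀ j e, e ∈ ledges (P j) ↔ e ∈ ledges (D.lst j) := by
    intro j x
    by_cases hj : j = 0
    · subst hj
      simp only [P, if_true, D.lst_zero]
      rw [← walk_edges, ← walk_edges, ← Walk.mem_edges_toSubgraph, ← Walk.mem_edges_toSubgraph, hsub]
    · simp [P, hj]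
  have hPlen : ∀ j ≤ D.k, D.IsLong j ↔ 3 ≤ (P j).length := by
    intro j hjk
    rw [D.isLong_iff hjk]
    by_cases hj : j = 0
    · subst hj
      have h1 := D.cycle_len
      have h2 := hc.three_le_length
      simp only [P, if_true, h1, true_iff, Walk.length_support]
      omega
    · simp [P, hj]
  have hcovE : ∀ e ∈ G.edgeSet, ∃ j ≤ D.k, e ∈ ledges (D.lst j) := by
    intro e he
    rcases D.edges_cover e he with h | ⟨i, h⟩
    · exact ⟨0, by omega, by rw [D.lst_zero, ← walk_edges]; exact h⟩
    · exact ⟨i + 1, by omega, by rw [D.lst_succ i.2, ← walk_edges]; exact h⟩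
  have hedG : ∀ j, ∀ e ∈ ledges (D.lst j), e ∈ G.edgeSet := by
    intro j e he
    have : e ∈ D.earEdges j := by rw [D.earEdges_eq]; exact he
    exact (D.ear j).edgeSet_subset this
  have hcov : ∀ x, ∃ j ≤ D.k, x ∈ D.lst j := by
    intro x
    have hconn := hG.2 ∅ (by simp)
    have hcard := hG.1
    obtain ⟨y, hy⟩ : ∃ y, y ≠ x := by
      by_contra h
      push Not at h
      have : Nat.card V ≤ 1 := by
        rw [Nat.card_eq_fintype_card]
        exact Fintype.card_le_one_iff.2 fun a b => (h a).trans (h b).symm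
      omega
    obtain ⟨p⟩ := hconn.preconnected ⟨x, by simp⟩ ⟨y, by simp⟩
    cases p with
    | nil => exact absurd rfl hy
    | @cons _ z _ h q =>
      have h' : G.Adj x z.1 := h
      obtain ⟨j, hj, he⟩ := hcovE s(x, z.1) h'
      exact ⟨j, hj, left_mem_of_mem_ledges he⟩
  have hbself : ∀ x, x ∈ D.lst (D.birth x) ∧ D.birth x ≤ D.k := by
    intro x
    obtain ⟨j, hj, hx⟩ := hcov x
    have hne : {i | x ∈ D.earSupport i}.Nonempty := ⟨j, by rw [Set.mem_setOf_eq, D.earSupport_eq]; exact hx⟩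
    constructor
    · have := Nat.sInf_mem hne
      rw [Set.mem_setOf_eq, D.earSupport_eq] at this
      exact this
    · exact (Nat.sInf_le (show j ∈ {i | x ∈ D.earSupport i} by rw [Set.mem_setOf_eq, D.earSupport_eq]; exact hx)).trans hj
  have hble : ∀ j x, x ∈ D.lst j → D.birth x ≤ j := by
    intro j x hx
    exact Nat.sInf_le (by rw [Set.mem_setOf_eq, D.earSupport_eq]; exact hx)
  have hvis : ∀ (i : Fin D.k) x, D.birth x < i + 1 ↔
      (x ∈ D.cycle.support ∨ ∃ j, j < i ∧ x ∈ (D.path j).support) := by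
    intro i x
    constructor
    · intro h
      have hx := (hbself x).1
      cases hb : D.birth x with
      | zero => rw [hb] at hx; exact .inl hx
      | succ n =>
        have hn : n < i := by omega
        have hnk : n < D.k := by omega
        rw [hb, D.lst_succ hnk] at hx
        exact .inr ⟨⟨n, hnk⟩, hn, hx⟩
    · rintro (h | ⟨j, hj, h⟩)
      · have := hble 0 x h; omega
      · have := hble (j + 1) x (by rw [D.lst_succ j.2]; exact h)
        have : (j : ℕ) < i := hj
        omega
  have hdis : ∀ i j, i < j → j ≤ D.k → ∀ e ∈ ledges (D.lst i), e ∉ ledges (D.lst j) := by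
    intro i j hij hj e he he'
    obtain ⟨j, rfl⟩ : ∃ j', j = j' + 1 := ⟨j - 1, by omega⟩
    rw [D.lst_succ (by omega), ← walk_edges] at he'
    cases i with
    | zero =>
      rw [D.lst_zero, ← walk_edges] at he
      exact D.cycle_path_disjoint _ e he' he
    | succ i =>
      rw [D.lst_succ (by omega), ← walk_edges] at he
      exact D.path_path_disjoint _ _ (by simp; omega) e he he'
  have hear : ∀ j ≤ D.k, EarV r {x | D.birth x < j} (P j) := by
    intro j hj
    cases j with
    | zero =>
      have h3 := hc.three_le_length
      obtain ⟨M, hM⟩ := walk_form c (by omega)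
      have hlen : c.support.length = c.length + 1 := c.length_support
      have hnd := hc.support_nodup
      simp only [P, if_true]
      rw [hM] at hlen hnd ⊢
      refine .cyc M (by ext; simp) ?_ (by simp at hlen; omega)
      simp only [List.tail_cons] at hnd
      rw [List.nodup_append_comm] at hnd
      simpa using hnd
    | succ j =>
      have hj' : j < D.k := by omega
      have e0 : P (j + 1) = (D.path ⟨j, hj'⟩).support := by
        simp only [P]; rw [if_neg (by omega), D.lst_succ hj']
      rw [e0]
      obtain ⟨M, hM⟩ := walk_form (D.path ⟨j, hj'⟩) (D.path_length_pos _)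
      have hnd := (D.path_isPath ⟨j, hj'⟩).support_nodup
      have hmp := fun x hx => (hvis ⟨j, hj'⟩ x).trans (D.meets_prev ⟨j, hj'⟩ x hx)
      rw [hM] at hnd hmp ⊢
      simp only [List.nodup_cons, List.mem_append, List.mem_singleton, List.nodup_append, not_or] at hnd
      refine .path _ M _ hnd.1.2 ?_ ?_ hnd.2.1 ?_
      · exact (hmp _ (by simp)).2 (.inl rfl)
      · exact (hmp _ (by simp)).2 (.inr rfl)
      · intro x hx hx'
        rcases (hmp x (by simp [hx])).1 hx' with rfl | rfl
        · exact hnd.1.1 hx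
        · exact hnd.2.2.2 _ hx _ (by simp) rfl
  have hinner : ∀ x, x ∈ D.inner (D.birth x) := by
    intro x
    have hx := hbself x
    cases hb : D.birth x with
    | zero =>
      simp only [EarDecomposition.inner, if_true]
      rw [D.earSupport_eq]; rw [hb] at hx; exact hx.1
    | succ n =>
      have hnk : n < D.k := by omega
      have hxl := hx.1
      rw [hb, D.lst_succ hnk] at hxl
      have hmp := (hvis ⟨n, hnk⟩ x).trans (D.meets_prev ⟨n, hnk⟩ x hxl)
      have hnot : ¬ (x = D.s ⟨n, hnk⟩ ∨ x = D.t ⟨n, hnk⟩) := by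
        rw [← hmp, hb]; simp
      push Not at hnot
      simp only [EarDecomposition.inner, Nat.add_sub_cancel, hnk, dif_pos, if_neg (Nat.succ_ne_zero n)]
      exact ⟨hxl, hnot⟩
  have hnewlong : ∀ x, D.IsLong (D.birth x) := by
    intro x
    rw [hPlen _ (hbself x).2]
    exact (hear _ (hbself x).2).len_of_new ((hPmem _ x).2 (hbself x).1) (by simp)
  have humax : ∀ x, x ≠ u → D.birth x < D.birth u := by
    intro x hxu
    refine lt_of_le_of_ne (hL2 _ (hbself x).2 (hnewlong x)) ?_
    intro h
    have := hinner x
    rw [h, hin] at this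
    exact hxu this
  have hu0 : 0 < D.birth u := by
    by_contra h
    have h0 : D.birth u = 0 := by omega
    have h3 := hc.three_le_length
    obtain ⟨x, hx, hxu⟩ : ∃ x, x ∈ P 0 ∧ x ≠ u := by
      have := hear 0 (by omega)
      generalize P 0 = l at this
      cases this with
      | path s M t hst hs ht hM hV => simp at hs
      | cyc M h0 hM hl =>
        match M, hl with
        | a :: b :: M, _ =>
          by_cases ha : a = u
          · exact ⟨b, by simp, by rintro rfl; simp [ha] at hM⟩
          · exact ⟨a, by simp, ha⟩
    have := humax x hxu
    omega
  refine ⟨P, ⟨hear, ?_, ?_, fun x => (hbself x).2, ?_, ?_, ?_, humax, ?_, ?_⟩, ?_, hPlen, ?_⟩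
  · intro j hj x hx; exact hble j x ((hPmem j x).1 hx)
  · intro x; exact (hPmem _ x).2 (hbself x).1
  · intro i j hij hj e he
    rw [hPed] at he ⊢
    exact hdis i j hij hj e he
  · intro e
    simp only [hPed]
    exact ⟨hcovE e, fun ⟨j, _, h⟩ => hedG j e h⟩
  · intro x hx
    obtain ⟨y, hy, hxy⟩ := hns (D.birth x) (hbself x).2 ⟨u, by
      rw [D.mem_Vbar]
      intro j hj huj
      have := hble j u huj
      have := humax x hx
      omega⟩ x (hinner x)
    refine ⟨y, hxy, ?_⟩
    rw [D.mem_Vbar] at hy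
    by_contra hlt
    exact hy _ (by omega) (hbself y).1
  · have hE := hear _ (hbself u).2
    have hmemu := (hPmem _ u).2 (hbself u).1
    generalize P (D.birth u) = l at hE hmemu
    cases hE with
    | cyc M h0 hM hl =>
      have : r ∈ ({x | D.birth x < D.birth u} : Set V) := by
        have := hble 0 r hr'
        simp; omega
      rw [h0] at this; exact absurd this (by simp)
    | path s M t hst hs ht hM hV =>
      have hMu : ∀ x ∈ M, x = u := by
        intro x hx
        by_contra h
        exact hV x hx (humax x h)
      refine ⟨s, t, ?_⟩
      match M, hM, hMu with
      | [], _, _ =>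
        simp at hmemu
        rcases hmemu with rfl | rfl
        · simp at hs
        · simp at ht
      | [a], _, h => simp [h a (by simp)]
      | a :: b :: M, hM, h =>
        have h1 := h a (by simp)
        have h2 := h b (by simp)
        simp [h1, h2] at hM
  · rw [hPed]
    rw [D.earEdges_eq] at hru
    exact hru
  · intro j hj
    rw [D.earEdges_eq]
    ext e; exact (hPed j e).symm
  · intro j hj e he
    rw [hPed] at he
    exact D.birthEdge_eq he (fun i hi h => hdis i j hi hj e h he)

variable {G : SimpleGraph V} {r u : V} {k : ℕ} {P : ℕ → List V} {bt : V → ℕ}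

theorem Mon.edge_cases (h : Mon G r u k P bt) {a b : V} (hab : G.Adj a b) (hle : bt a ≤ bt b) :
    ∃ j ≤ k, s(a, b) ∈ ledges (P j) ∧
      ((j = bt b ∧ 3 ≤ (P j).length) ∨ (bt b < j ∧ (P j = [a, b] ∨ P j = [b, a]))) := by
  obtain ⟨j, hj, he⟩ := (h.edges s(a, b)).1 hab
  refine ⟨j, hj, he, ?_⟩
  have hE := h.ear j hj
  have h1 := h.mem j hj a (left_mem_of_mem_ledges he)
  have h2 := h.mem j hj b (right_mem_of_mem_ledges he)
  by_cases hl : 3 ≤ (P j).length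
  · left
    refine ⟨?_, hl⟩
    by_contra hne
    exact hE.edge_new hl he (show bt a < j by omega) (show bt b < j by omega)
  · right
    have hlen := hE.length
    match hP : P j with
    | [] => simp [hP] at hlen
    | [_] => simp [hP] at hlen
    | [x, y] =>
      rw [hP] at he
      simp [ledges] at he
      refine ⟨?_, by rcases he with ⟨rfl, rfl⟩ | ⟨rfl, rfl⟩ <;> simp⟩
      by_contra hne
      have : b ∈ P j := by rw [hP]; simp; tauto
      have := hE.len_of_new this (show ¬ (bt b < j) by omega)
      omega
    | _ :: _ :: _ :: _ => simp [hP] at hl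
end Extract

section Glue
variable {V W : Type u}

/-- visited vertices before stage `j` -/
def visN (f : V → W) (bt : V → ℕ) (N : ℕ → Set W) (j : ℕ) : Set W :=
  {z | (∃ x, f x = z ∧ bt x < j) ∨ ∃ m < j, z ∈ N m}

/-- image of the `j`-th ear -/
def pm (f : V → W) (k : ℕ) (P : ℕ → List V) (j : ℕ) : List W :=
  if j ≤ k then (P j).map f else []

/-- a group of ears replacing one ear -/
structure Grp (H : SimpleGraph W) (r' u' : W) (Vis : Set W) (PL : List W) (N : Set W)
    (rem Sall : Set (Sym2 W)) (Qs : List (List W)) : Prop where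
  seq : FSeq H r' u' Vis Qs
  long : (∀ Q ∈ Qs, 3 ≤ Q.length) ∨ Qs.length ≤ 1
  verts : ∀ x, (x ∈ Vis ∨ ∃ Q ∈ Qs, x ∈ Q) ↔ (x ∈ Vis ∨ x ∈ PL ∨ x ∈ N)
  edges1 : ∀ Q ∈ Qs, ∀ e ∈ ledges Q, (e ∈ ledges PL ∧ e ∉ rem) ∨ e ∈ Sall
  edges2 : ∀ e ∈ ledges PL, e ∉ rem → ∃ Q ∈ Qs, e ∈ ledges Q

variable {G : SimpleGraph V} {r u : V} {k : ℕ} {P : ℕ → List V} {bt : V → ℕ}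
  {f : V → W} {H : SimpleGraph W} {u' : W} {N : ℕ → Set W} {rem Sall : Set (Sym2 W)}
  {g : ℕ → List (List W)}

theorem glue (M : Mon G r u k P bt) (hf : Function.Injective f)
    (hgrp : ∀ j < k + 2, Grp H (f r) u' (visN f bt N j) (pm f k P j) (N j) rem Sall (g j))
    (hnew : ∀ e ∈ Sall, ∀ j ≤ k, e ∉ ledges ((P j).map f))
    (huni : ∀ j j', j < j' → j' < k + 2 → ∀ e ∈ Sall, (∃ Q ∈ g j, e ∈ ledges Q) →
      (∃ Q ∈ g j', e ∈ ledges Q) → False)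
    (hH : ∀ e, e ∈ H.edgeSet ↔ (∃ e0 ∈ G.edgeSet, e = Sym2.map f e0 ∧ e ∉ rem) ∨
      (e ∈ Sall ∧ ∃ j < k + 2, ∃ Q ∈ g j, e ∈ ledges Q))
    (hcov : ∀ z, (∃ x, f x = z) ∨ ∃ j < k + 2, z ∈ N j)
    (hu : ∃ j < k + 2, ∃ Q ∈ g j, Q.length = 2 ∧ s(f r, u') ∈ ledges Q) :
    ∃ D' : EarDecomposition H, IsMondshein D' (f r) u' ∧
      D'.earList = (List.range (k + 1)).flatMap (fun j => (g j).map (fun l => {e | e ∈ ledges l})) ++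
        (g (k + 1)).map (fun l => {e | e ∈ ledges l}) := by
  have hmapE : ∀ j e, e ∈ ledges (pm f k P j) ↔ j ≤ k ∧ ∃ e0 ∈ ledges (P j), Sym2.map f e0 = e := by
    intro j e
    unfold pm
    split_ifs with h
    · simp [ledges_map, h]
    · simp [h, ledges]
  have hmapI : Function.Injective (Sym2.map f) := Sym2.map.injective hf
  obtain ⟨D', h1, h2⟩ := assemble H (f r) u' (k + 2) g (visN f bt N)
    (by ext; simp [visN])
    (fun j hj => by
      ext x
      have hv := (hgrp j hj).verts x
      rw [Set.mem_union]
      simp only [Set.mem_setOf_eq]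
      rw [hv]
      constructor
      · rintro (⟨y, rfl, hy⟩ | ⟨m, hm, hx⟩)
        · rcases Nat.lt_succ_iff_lt_or_eq.1 hy with h | rfl
          · exact .inl (.inl ⟨y, rfl, h⟩)
          · refine .inr (.inl ?_)
            rw [pm, if_pos (M.le y)]
            exact List.mem_map_of_mem (M.self y)
        · rcases Nat.lt_succ_iff_lt_or_eq.1 hm with h | rfl
          · exact .inl (.inr ⟨m, h, hx⟩)
          · exact .inr (.inr hx)
      · rintro ((⟨y, rfl, hy⟩ | ⟨m, hm, hx⟩) | hx | hx)
        · exact .inl ⟨y, rfl, by omega⟩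
        · exact .inr ⟨m, by omega, hx⟩
        · unfold pm at hx
          split_ifs at hx with hjk
          · obtain ⟨y, hy, rfl⟩ := List.mem_map.1 hx
            exact .inl ⟨y, rfl, Nat.lt_succ_of_le (M.mem j hjk y hy)⟩
          · simp at hx
        · exact .inr ⟨j, by omega, hx⟩)
    (fun j hj => (hgrp j hj).seq)
    (fun j hj => (hgrp j hj).long)
    (fun j j' hjj hj' Q hQ Q' hQ' e he he' => by
      rcases (hgrp j (by omega)).edges1 Q hQ e he with ⟨h, h'⟩ | h
      · rw [hmapE] at h
        obtain ⟨hjk, e0, he0, rfl⟩ := h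
        rcases (hgrp j' hj').edges1 Q' hQ' _ he' with ⟨k1, k2⟩ | k1
        · rw [hmapE] at k1
          obtain ⟨hjk', e1, he1, h⟩ := k1
          obtain rfl := hmapI h
          exact M.dis j j' hjj hjk' _ he0 he1
        · refine hnew _ k1 j hjk ?_
          rw [ledges_map]; exact List.mem_map_of_mem he0
      · exact huni j j' hjj hj' e h ⟨Q, hQ, he⟩ ⟨Q', hQ', he'⟩)
    (fun e => by
      rw [hH]
      constructor
      · rintro (⟨e0, he0, rfl, h⟩ | ⟨_, h⟩)
        · obtain ⟨j, hj, he⟩ := (M.edges e0).1 he0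
          exact ⟨j, by omega, (hgrp j (by omega)).edges2 _ ((hmapE _ _).2 ⟨hj, e0, he, rfl⟩) h⟩
        · exact h
      · rintro ⟨j, hj, Q, hQ, he⟩
        rcases (hgrp j hj).edges1 Q hQ e he with ⟨h, h'⟩ | h
        · obtain ⟨hjk, e0, he0, rfl⟩ := (hmapE _ _).1 h
          exact .inl ⟨e0, (M.edges e0).2 ⟨j, hjk, he0⟩, rfl, h'⟩
        · exact .inr ⟨h, j, hj, Q, hQ, he⟩)
    (fun z => by
      rcases hcov z with ⟨x, rfl⟩ | ⟨j, hj, h⟩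
      · exact .inl ⟨x, rfl, by have := M.le x; omega⟩
      · exact .inr ⟨j, hj, h⟩)
    hu
  refine ⟨D', h1, h2.trans ?_⟩
  rw [List.range_succ, List.flatMap_append]; simp

theorem EarV.map {f : V → W} (hf : Function.Injective f) {r : V} {Vis : Set V} {Vis' : Set W} {l : List V}
    (h : EarV r Vis l) (hV : ∀ x ∈ l, f x ∈ Vis' ↔ x ∈ Vis) (h0 : Vis = ∅ → Vis' = ∅) :
    EarV (f r) Vis' (l.map f) := by
  cases h with
  | path s M t hst hs ht hM hN =>
    refine .path' (f s) (M.map f) (f t) (by simp) (fun h => hst (hf h)) ((hV s (by simp)).2 hs)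
      ((hV t (by simp)).2 ht) (hM.map hf) ?_
    intro x hx
    obtain ⟨y, hy, rfl⟩ := List.mem_map.1 hx
    rw [hV y (by simp [hy])]
    exact hN y hy
  | cyc M hV0 hM hl =>
    have := EarV.cyc (r := f r) (Vis := Vis') (M.map f) (h0 hV0) (by simpa using hM.map hf) (by simpa using hl)
    simpa using this

theorem grp_plain {r' : W} {Vis : Set W} {PL : List W}
    (hE : EarV r' Vis PL) (hrem : ∀ e ∈ ledges PL, e ∉ rem)
    (hns : ∀ x ∈ PL, x ∉ Vis → x ≠ u' → ∃ y, H.Adj x y ∧ y ∉ Vis ∧ y ∉ PL) :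
    Grp H r' u' Vis PL ∅ rem Sall [PL] where
  seq := ⟨hE, hns, trivial⟩
  long := .inr (by simp)
  verts := by simp
  edges1 := by
    intro Q hQ e he
    simp at hQ; subst hQ
    exact .inl ⟨he, hrem e he⟩
  edges2 := fun e he _ => ⟨PL, by simp, he⟩

theorem grp_nil {r' : W} {Vis : Set W} {PL : List W}
    (hV : ∀ x ∈ PL, x ∈ Vis) (hrem : ∀ e ∈ ledges PL, e ∈ rem) :
    Grp H r' u' Vis PL ∅ rem Sall [] where
  seq := trivial
  long := .inr (by simp)
  verts := by intro x; simp; exact hV x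
  edges1 := by simp
  edges2 := fun e he h => absurd (hrem e he) h

theorem grp_short {r' x y : W} {Vis : Set W} {PL : List W}
    (hV : ∀ x ∈ PL, x ∈ Vis) (hrem : ∀ e ∈ ledges PL, e ∈ rem)
    (hx : x ∈ Vis) (hy : y ∈ Vis) (hxy : x ≠ y) (hS : s(x, y) ∈ Sall) :
    Grp H r' u' Vis PL ∅ rem Sall [[x, y]] where
  seq := ⟨.path' x [] y (by simp) hxy hx hy (by simp) (by simp), by
    intro z hz hzV
    simp at hz
    rcases hz with rfl | rfl <;> contradiction, trivial⟩
  long := .inr (by simp)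
  verts := by
    intro z; simp
    constructor
    · rintro (h | rfl | rfl) <;> tauto
    · rintro (h | h)
      · exact .inl h
      · exact .inl (hV z h)
  edges1 := by
    intro Q hQ e he
    simp at hQ; subst hQ
    simp [ledges] at he
    subst he; exact .inr hS
  edges2 := fun e he h => absurd (hrem e he) h

theorem grp_blk {r' : W} {Z Vis NN : Set W} {PL : List W} {S Left : Set (Sym2 W)} {Qs : List (List W)}
    (hB : Blk r' Z Vis PL NN rem S Left Qs)
    (hSH : ∀ e ∈ S, e ∈ H.edgeSet) (hS : ∀ e ∈ S, e ∈ Sall)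
    (hns : ∀ x, x ∉ Vis → (x ∈ PL ∨ x ∈ NN) → x ∉ Z → x ≠ u' →
      ∃ y, H.Adj x y ∧ y ∉ Vis ∧ y ∉ PL ∧ y ∉ NN) :
    Grp H r' u' Vis PL NN rem Sall Qs where
  seq := by
    refine hB.seq.toFSeq (U := {x | x ∈ Vis ∨ x ∈ PL ∨ x ∈ NN}) hSH (fun x hx => .inl hx) ?_ ?_
    · intro Q hQ x hx
      exact (hB.verts x).1 (.inr ⟨Q, hQ, hx⟩)
    · intro Q hQ x hx hxV hxZ hxu
      have := (hB.verts x).1 (.inr ⟨Q, hQ, hx⟩)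
      obtain ⟨y, h1, h2⟩ := hns x hxV (this.resolve_left hxV) hxZ hxu
      exact ⟨y, h1, by simp; tauto⟩
  long := .inl hB.long
  verts := hB.verts
  edges1 := by
    intro Q hQ e he
    rcases (hB.edges e).1 ⟨Q, hQ, he⟩ with h | h
    · exact .inl h
    · exact .inr (hS e h.1)
  edges2 := fun e he h => (hB.edges e).2 (.inl ⟨he, h⟩)

theorem FSeq.earv : ∀ {Ls : List (List W)} {Vis : Set W} {r' : W}, FSeq H r' u' Vis Ls →
    ∀ Q ∈ Ls, ∃ Vis', EarV r' Vis' Q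
  | [], Vis, _, _, Q, hQ => by simp at hQ
  | Q :: Ls, Vis, _, ⟨h1, h2, h3⟩, Q', hQ => by
    rcases List.mem_cons.1 hQ with rfl | hQ
    · exact ⟨_, h1⟩
    · exact h3.earv Q' hQ

theorem ledges_length : ∀ (l : List W), (ledges l).length = l.length - 1
  | [] => rfl
  | [a] => rfl
  | a :: b :: l => by rw [ledges_cons2]; simp [ledges_length (b :: l)]

theorem EarV.not_single {r' : W} {Vis : Set W} {Q : List W} (h : EarV r' Vis Q) (hl : 3 ≤ Q.length) :
    ¬ ∃ e₀, {e | e ∈ ledges Q} = ({e₀} : Set (Sym2 W)) := by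
  rintro ⟨e0, he⟩
  have h1 := h.ledges_nodup
  have h2 := ledges_length Q
  match hL : ledges Q with
  | [] => simp [hL] at h2; omega
  | [_] => simp [hL] at h2; omega
  | a :: b :: l =>
    have ha : a ∈ {e | e ∈ ledges Q} := by simp [hL]
    have hb : b ∈ {e | e ∈ ledges Q} := by simp [hL]
    rw [he] at ha hb
    simp at ha hb
    simp [hL, ha, hb] at h1

theorem set_map_edges (f : V → W) (l : List V) :
    {e | e ∈ ledges (l.map f)} = mapEdgeSet f {e | e ∈ ledges l} := by
  ext e; simp [mapEdgeSet, ledges_map]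
end Glue

section Glue2
variable {V W : Type u} {G : SimpleGraph V} {r u : V} {k : ℕ} {P : ℕ → List V} {bt : V → ℕ}
  {f : V → W} {H : SimpleGraph W} {u' : W} {N : ℕ → Set W} {rem Sall : Set (Sym2 W)}

theorem visN_f (hf : Function.Injective f) (hNf : ∀ m, ∀ z ∈ N m, ∀ x, f x ≠ z) (x : V) (j : ℕ) :
    f x ∈ visN f bt N j ↔ bt x < j := by
  constructor
  · rintro (⟨y, hy, h⟩ | ⟨m, hm, h⟩)
    · rw [← hf hy]; exact h
    · exact absurd rfl (hNf m _ h x)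
  · intro h; exact .inl ⟨x, rfl, h⟩

theorem visN_new {z : W} (hz : ∀ x, f x ≠ z) (j : ℕ) :
    z ∈ visN f bt N j ↔ ∃ m < j, z ∈ N m := by
  constructor
  · rintro (⟨y, hy, h⟩ | h)
    · exact absurd hy (hz y)
    · exact h
  · intro h; exact .inr h

theorem visN_mono {i j : ℕ} (hij : i ≤ j) {z : W} (h : z ∈ visN f bt N i) : z ∈ visN f bt N j := by
  rcases h with ⟨y, hy, h⟩ | ⟨m, hm, h⟩
  · exact .inl ⟨y, hy, by omega⟩
  · exact .inr ⟨m, by omega, h⟩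

theorem Mon.r0 (M : Mon G r u k P bt) : bt r = 0 := by
  have h := M.ear 0 (by omega)
  have : r ∈ P 0 := by
    generalize P 0 = l at h
    cases h with
    | path s M t hst hs ht hM hV => simp at hs
    | cyc M h0 hM hl => simp
  have := M.mem 0 (by omega) r this
  omega

theorem Mon.ear_map (M : Mon G r u k P bt) (hf : Function.Injective f)
    (hNf : ∀ m, ∀ z ∈ N m, ∀ x, f x ≠ z) {j : ℕ} (hj : j ≤ k) :
    EarV (f r) (visN f bt N j) ((P j).map f) := by
  refine (M.ear j hj).map hf (fun x _ => visN_f hf hNf x j) ?_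
  intro h
  have : j = 0 := by
    by_contra hne
    have : r ∈ ({x | bt x < j} : Set V) := by
      have := M.r0
      simp; omega
    rw [h] at this; simp at this
  subst this
  ext; simp [visN]

theorem Mon.sub_vis (M : Mon G r u k P bt) {j : ℕ} (hj : j ≤ k) {x : W} (hx : x ∈ (P j).map f) :
    x ∈ visN f bt N (j + 1) := by
  obtain ⟨y, hy, rfl⟩ := List.mem_map.1 hx
  exact .inl ⟨y, rfl, Nat.lt_succ_of_le (M.mem j hj y hy)⟩

theorem Mon.new_eq (M : Mon G r u k P bt) {j : ℕ} (hj : j ≤ k) {x : W} (hx : x ∈ (P j).map f)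
    (hxV : x ∉ visN f bt N j) : ∃ y, f y = x ∧ bt y = j := by
  obtain ⟨y, hy, rfl⟩ := List.mem_map.1 hx
  refine ⟨y, rfl, le_antisymm (M.mem j hj y hy) ?_⟩
  by_contra h
  exact hxV (.inl ⟨y, rfl, by omega⟩)

theorem grp_plainM (M : Mon G r u k P bt) (hf : Function.Injective f)
    (hNf : ∀ m, ∀ z ∈ N m, ∀ x, f x ≠ z) {j : ℕ} (hj : j ≤ k) (hNj : N j = ∅)
    (hrem : ∀ e ∈ ledges ((P j).map f), e ∉ rem)
    (hns : ∀ x, bt x = j → f x ≠ u' → ∃ y, H.Adj (f x) y ∧ y ∉ visN f bt N (j + 1)) :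
    Grp H (f r) u' (visN f bt N j) (pm f k P j) (N j) rem Sall [(P j).map f] := by
  rw [pm, if_pos hj, hNj]
  refine grp_plain (M.ear_map hf hNf hj) hrem ?_
  intro x hx hxV hxu
  obtain ⟨y, rfl, hy⟩ := M.new_eq hj hx hxV
  obtain ⟨z, h1, h2⟩ := hns y hy hxu
  exact ⟨z, h1, fun h => h2 (visN_mono (by omega) h), fun h => h2 (M.sub_vis hj h)⟩

theorem grp_blkM (M : Mon G r u k P bt) {j : ℕ} (hj : j ≤ k)
    {Z : Set W} {S Left : Set (Sym2 W)} {Qs : List (List W)}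
    (hB : Blk (f r) Z (visN f bt N j) ((P j).map f) (N j) rem S Left Qs)
    (hSH : ∀ e ∈ S, e ∈ H.edgeSet) (hS : ∀ e ∈ S, e ∈ Sall)
    (hNZ : ∀ z ∈ N j, z ∈ Z ∨ z = u')
    (hns : ∀ x, bt x = j → f x ∉ Z → f x ≠ u' → ∃ y, H.Adj (f x) y ∧ y ∉ visN f bt N (j + 1)) :
    Grp H (f r) u' (visN f bt N j) (pm f k P j) (N j) rem Sall Qs := by
  rw [pm, if_pos hj]
  refine grp_blk hB hSH hS ?_
  rintro x hxV (hx | hx) hxZ hxu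
  · obtain ⟨y, rfl, hy⟩ := M.new_eq hj hx hxV
    obtain ⟨z, h1, h2⟩ := hns y hy hxZ hxu
    exact ⟨z, h1, fun h => h2 (visN_mono (by omega) h), fun h => h2 (M.sub_vis hj h),
      fun h => h2 (.inr ⟨j, by omega, h⟩)⟩
  · rcases hNZ x hx with h | h <;> contradiction

theorem flatMap_single {α β : Type*} (l : List α) (h : α → β) : l.flatMap (fun j => [h j]) = l.map h := by
  induction l with
  | nil => rfl
  | cons a l ih => simp [List.flatMap_cons, ih]

theorem flatMap_congr' {α β : Type*} {l : List α} {h h' : α → List β} (H : ∀ a ∈ l, h a = h' a) :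
    l.flatMap h = l.flatMap h' := by
  induction l with
  | nil => rfl
  | cons a l ih =>
    rw [List.flatMap_cons, List.flatMap_cons, H a (by simp), ih (fun a ha => H a (by simp [ha]))]

theorem Mon.ru_short (M : Mon G r u k P bt) (hru : G.Adj r u) :
    ∃ j ≤ k, bt u < j ∧ (P j = [r, u] ∨ P j = [u, r]) := by
  obtain ⟨j, hj, he, ⟨rfl, h⟩ | h⟩ := M.edge_cases hru (by rw [M.r0]; omega)
  · exact absurd he M.ru
  · exact ⟨j, hj, h⟩

theorem vv_final (M : Mon G r u k P bt) (hru : G.Adj r u) (e : V ≃ W) (x y : V) (hxy : x ≠ y)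
    (hn : ¬ G.Adj x y)
    (hH : ∀ z z' : V, H.Adj (e z) (e z') ↔ (G.Adj z z' ∨ (z = x ∧ z' = y) ∨ (z = y ∧ z' = x))) :
    ∃ D' : EarDecomposition H, IsMondshein D' (e r) (e u) ∧
      D'.earList = (List.range (k + 1)).map (fun j => {a | a ∈ ledges ((P j).map e)}) ++
        [{s(e x, e y)}] := by
  have hf := e.injective
  have hNf : ∀ m, ∀ z ∈ (fun _ => ∅ : ℕ → Set W) m, ∀ x, e x ≠ z := by simp
  have hold : ∀ z z', G.Adj z z' → H.Adj (e z) (e z') := fun z z' h => (hH z z').2 (.inl h)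
  have hxye : ∀ e0 ∈ G.edgeSet, Sym2.map e e0 ≠ s(e x, e y) := by
    intro e0 he0 h
    have : e0 = s(x, y) := Sym2.map.injective hf h
    subst this; exact hn he0
  obtain ⟨D', h1, h2⟩ := glue (f := e) (H := H) (u' := e u) (N := fun _ => ∅) (rem := ∅)
    (Sall := {s(e x, e y)}) (g := fun j => if j ≤ k then [(P j).map e] else [[e x, e y]]) M hf
    (by
      intro j hj
      by_cases hjk : j ≤ k
      · simp only [if_pos hjk]
        refine grp_plainM (N := fun _ => ∅) M hf hNf hjk rfl (by simp) ?_
        intro z hz hzu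
        obtain ⟨y, h1, h2⟩ := M.ns z (fun h => hzu (h ▸ rfl))
        refine ⟨e y, hold _ _ h1, ?_⟩
        rw [visN_f hf hNf]; omega
      · simp only [if_neg hjk]
        rw [pm, if_neg hjk]
        refine grp_short (by simp) (by simp [ledges]) ?_ ?_ (fun h => hxy (hf h)) (by simp)
        · rw [visN_f hf hNf]; have := M.le x; omega
        · rw [visN_f hf hNf]; have := M.le y; omega)
    (by
      intro e' he j hj h
      rw [ledges_map] at h
      obtain ⟨e0, he0, rfl⟩ := List.mem_map.1 h
      exact hxye e0 ((M.edges _).2 ⟨j, hj, he0⟩) he)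
    (by
      rintro j j' hjj hj' e' he ⟨Q, hQ, h⟩ _
      have hjk : j ≤ k := by omega
      simp only [if_pos hjk, List.mem_singleton] at hQ
      subst hQ
      rw [ledges_map] at h
      obtain ⟨e0, he0, rfl⟩ := List.mem_map.1 h
      exact hxye e0 ((M.edges _).2 ⟨j, hjk, he0⟩) he)
    (by
      intro e'
      induction e' with | _ p q
      obtain ⟨p, rfl⟩ := e.surjective p
      obtain ⟨q, rfl⟩ := e.surjective q
      rw [SimpleGraph.mem_edgeSet, hH]
      constructor
      · rintro (h | h)
        · exact .inl ⟨s(p, q), h, rfl, by simp⟩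
        · refine .inr ⟨?_, k + 1, by omega, [e x, e y], by simp, ?_⟩
          · simp; tauto
          · simp [ledges]; tauto
      · rintro (⟨e0, he0, h, _⟩ | ⟨h, _⟩)
        · have : s(p, q) = e0 := Sym2.map.injective hf h
          subst this; exact .inl he0
        · simp at h; exact .inr h)
    (fun z => .inl (e.surjective z))
    (by
      obtain ⟨j, hj, _, h⟩ := M.ru_short hru
      refine ⟨j, by omega, (P j).map e, by simp [hj], ?_⟩
      rcases h with h | h <;> simp [h, ledges])
  refine ⟨D', h1, h2.trans ?_⟩
  congr 1
  · rw [← flatMap_single]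
    apply flatMap_congr'
    intro j hj
    have : j ≤ k := by simp at hj; omega
    simp [this]
  · simp [ledges]
end Glue2

section EV
variable {V W : Type u} {G : SimpleGraph V} {r u : V} {k : ℕ} {P : ℕ → List V} {bt : V → ℕ}
  {f : V → W} {H : SimpleGraph W} {v : W} {a b q : V} {jab : ℕ}

/-- hypotheses of an edge-vertex-addition -/
structure EVH (G : SimpleGraph V) (r u : V) (k : ℕ) (P : ℕ → List V) (bt : V → ℕ) (f : V → W)
    (H : SimpleGraph W) (v : W) (a b q : V) (jab : ℕ) : Prop where
  M : Mon G r u k P bt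
  hru : G.Adj r u
  hf : Function.Injective f
  hv : ∀ x, f x ≠ v
  cov : ∀ z : W, z = v ∨ ∃ x, f x = z
  hab : G.Adj a b
  hqa : q ≠ a
  hqb : q ≠ b
  hH1 : ∀ x y : V, H.Adj (f x) (f y) ↔ (G.Adj x y ∧ s(x, y) ≠ s(a, b))
  hH2 : ∀ x : V, H.Adj v (f x) ↔ (x = a ∨ x = b ∨ x = q)
  hle : bt a ≤ bt b
  hj : jab ≤ k
  hje : s(a, b) ∈ ledges (P jab)
  hjc : (jab = bt b ∧ 3 ≤ (P jab).length) ∨ (bt b < jab ∧ (P jab = [a, b] ∨ P jab = [b, a]))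

theorem Mon.long (M : Mon G r u k P bt) (x : V) : 3 ≤ (P (bt x)).length :=
  (M.ear _ (M.le x)).len_of_new (M.self x) (by simp)

theorem Mon.edge_uniq (M : Mon G r u k P bt) {i j : ℕ} (hi : i ≤ k) (hj : j ≤ k) {e : Sym2 V}
    (h1 : e ∈ ledges (P i)) (h2 : e ∈ ledges (P j)) : i = j := by
  rcases lt_trichotomy i j with h | h | h
  · exact absurd h2 (M.dis i j h hj e h1)
  · exact h
  · exact absurd h1 (M.dis j i h hi e h2)

theorem short_mem {a b y : V} {l : List V} (h : l = [a, b] ∨ l = [b, a]) (hy : y ∈ l) : y = a ∨ y = b := by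
  rcases h with rfl | rfl <;> simp at hy <;> tauto

theorem short_edges {a b : V} {l : List V} (f : V → W) (h : l = [a, b] ∨ l = [b, a]) :
    ∀ e ∈ ledges (l.map f), e ∈ ({s(f a, f b)} : Set (Sym2 W)) := by
  rcases h with rfl | rfl <;> simp [ledges, Sym2.eq_swap]

theorem short_edge_eq {a b r u : V} {l : List V} (h : l = [r, u] ∨ l = [u, r])
    (h' : s(a, b) ∈ ledges l) : s(a, b) = s(r, u) := by
  rcases h with rfl | rfl <;> simp [ledges] at h' <;> simp <;> tauto

theorem short_self {r u : V} {l : List V} (f : V → W) (h : l = [r, u] ∨ l = [u, r]) :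
    (l.map f).length = 2 ∧ s(f r, f u) ∈ ledges (l.map f) := by
  rcases h with rfl | rfl <;> simp [ledges]

set_option maxHeartbeats 1000000 in
theorem ev_glue (h : EVH G r u k P bt f H v a b q jab) {u' : W} {Z : Set W} {S Left : Set (Sym2 W)}
    {Qs sl tl : List (List W)} {N : ℕ → Set W} (hNd : N = fun j => {z | z = v ∧ j = bt b})
    (hS : ∀ e, e ∈ S ↔ e = s(v, f a) ∨ e = s(v, f b) ∨ e = s(v, f q))
    (hB : Blk (f r) Z (visN f bt N (bt b)) ((P (bt b)).map f) {v} {s(f a, f b)} S Left Qs)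
    (hsl : jab ≠ bt b → (sl = [] ∨ ∃ y, (y = a ∨ y = b ∨ y = q) ∧ bt y < jab ∧ sl = [[v, f y]]))
    (htl : tl = [] ∨ tl = [[v, f q]])
    (hL : ∀ e ∈ S, e ∈ Left ↔ (jab ≠ bt b ∧ ∃ Q ∈ sl, e ∈ ledges Q) ∨ ∃ Q ∈ tl, e ∈ ledges Q)
    (hex : jab ≠ bt b → sl = [] ∨ tl = [])
    (hvZ : v ∈ Z ∨ v = u')
    (hu : (u' = f u ∧ s(a, b) ≠ s(r, u)) ∨
      (u' = v ∧ jab ≠ bt b ∧ a = r ∧ b = u ∧ sl = [[v, f a]] ∧ f u ∈ Z)) :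
    ∃ (D' : EarDecomposition H) (g : ℕ → List (List W)), IsMondshein D' (f r) u' ∧
      D'.earList = (List.range (k + 1)).flatMap (fun j => (g j).map (fun l => {e | e ∈ ledges l})) ++
        tl.map (fun l => {e | e ∈ ledges l}) ∧
      (∀ j ≤ k, j ≠ bt b → j ≠ jab → g j = [(P j).map f]) ∧
      g (bt b) = Qs ∧ (∀ Q ∈ Qs, ∃ Vis, EarV (f r) Vis Q) ∧
      (jab ≠ bt b → g jab = sl) := by
  obtain ⟨M, hru, hf, hv, cov, hab, hqa, hqb, hH1, hH2, hle, hj, hje, hjc⟩ := h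
  have hNf : ∀ m, ∀ z ∈ N m, ∀ x, f x ≠ z := by
    subst hNd; rintro m z ⟨rfl, _⟩; exact hv
  have hNi : N (bt b) = {v} := by subst hNd; ext; simp
  have hNj : ∀ j, j ≠ bt b → N j = ∅ := by
    intro j hj; subst hNd; ext; simp [hj]
  have hvv : ∀ j, v ∈ visN f bt N j ↔ bt b < j := by
    intro j; rw [visN_new hv]
    constructor
    · rintro ⟨m, hm, hx⟩
      subst hNd; simp at hx; omega
    · intro hj; exact ⟨bt b, hj, by rw [hNi]; rfl⟩
  have hnn : ∀ x y, s(v, f x) = s(v, f y) ↔ x = y := by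
    intro x y; simp; constructor
    · rintro (h | h)
      · exact hf h
      · exact absurd h.2 (hv x)
    · rintro rfl; exact .inl rfl
  have hSne : ∀ e ∈ S, ∀ e0, Sym2.map f e0 ≠ e := by
    intro e he e0 heq
    have : v ∈ e := by rcases (hS e).1 he with rfl | rfl | rfl <;> simp
    rw [← heq] at this
    obtain ⟨x, _, hx⟩ := Sym2.mem_map.1 this
    exact hv x hx
  have hSP : ∀ e ∈ S, ∀ j, e ∉ ledges ((P j).map f) := by
    intro e he j h
    rw [ledges_map] at h
    obtain ⟨e0, he0, rfl⟩ := List.mem_map.1 h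
    exact hSne _ he e0 rfl
  have hSH : ∀ e ∈ S, e ∈ H.edgeSet := by
    intro e he
    rcases (hS e).1 he with rfl | rfl | rfl <;> exact (hH2 _).2 (by simp)
  have hiff : ∀ x y, s(f x, f y) = s(f a, f b) ↔ s(x, y) = s(a, b) := by
    intro x y; simp [hf.eq_iff]
  have hns : ∀ x, x ≠ u → ∃ y, H.Adj (f x) y ∧ y ∉ visN f bt N (bt x + 1) := by
    intro x hx
    obtain ⟨y, h1, h2⟩ := M.ns x hx
    by_cases he : s(x, y) = s(a, b)
    · have : x = a ∧ y = b := by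
        rcases Sym2.eq_iff.1 he with h | ⟨rfl, rfl⟩
        · exact h
        · omega
      obtain ⟨rfl, rfl⟩ := this
      exact ⟨v, ((hH2 x).2 (.inl rfl)).symm, by rw [hvv]; omega⟩
    · exact ⟨f y, (hH1 x y).2 ⟨h1, he⟩, by rw [visN_f hf hNf]; omega⟩
  have hns' : ∀ x, f x ∉ Z → f x ≠ u' → ∃ y, H.Adj (f x) y ∧ y ∉ visN f bt N (bt x + 1) := by
    intro x hxZ hxu
    refine hns x ?_
    rintro rfl
    rcases hu with h | h
    · exact hxu h.1.symm
    · exact hxZ h.2.2.2.2.2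
  have hshort : jab ≠ bt b → bt b < jab ∧ (P jab = [a, b] ∨ P jab = [b, a]) := by
    intro hne
    rcases hjc with h | h
    · exact absurd h.1 hne
    · exact h
  obtain ⟨g, hg⟩ : ∃ g : ℕ → List (List W), g = fun j => if j = bt b then Qs else if j = jab then sl else
    if j ≤ k then [(P j).map f] else tl := ⟨_, rfl⟩
  have hbk := M.le b
  have gi : g (bt b) = Qs := by simp [hg]
  have gab : jab ≠ bt b → g jab = sl := by intro h; simp [hg, h]
  have gpl : ∀ j ≤ k, j ≠ bt b → j ≠ jab → g j = [(P j).map f] := by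
    intro j h1 h2 h3; simp [hg, h1, h2, h3]
  have gtl : g (k + 1) = tl := by
    simp [hg, show k + 1 ≠ bt b by omega, show k + 1 ≠ jab by omega]
  have cls : ∀ j < k + 2, j = bt b ∨ (j = jab ∧ jab ≠ bt b) ∨ (j ≤ k ∧ j ≠ bt b ∧ j ≠ jab) ∨ j = k + 1 := by
    intro j hj; omega
  have hgrp : ∀ j < k + 2, Grp H (f r) u' (visN f bt N j) (pm f k P j) (N j) {s(f a, f b)} S (g j) := by
    intro j hjk
    rcases cls j hjk with rfl | ⟨rfl, hne⟩ | ⟨h1, h2, h3⟩ | rfl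
    · rw [gi]
      refine grp_blkM M hbk (hNi ▸ hB) hSH (fun e he => he) ?_ ?_
      · rw [hNi]; rintro z rfl; exact hvZ
      · intro x hx h1 h2
        rw [← hx]; exact hns' x h1 h2
    · rw [gab hne, hNj _ hne]
      obtain ⟨h1, h2⟩ := hshort hne
      have hV : ∀ x ∈ pm f k P j, x ∈ visN f bt N j := by
        rw [pm, if_pos hj]
        intro x hx
        obtain ⟨y, hy, rfl⟩ := List.mem_map.1 hx
        rw [visN_f hf hNf]
        have : y = a ∨ y = b := short_mem h2 hy
        rcases this with rfl | rfl <;> omega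
      have hrem : ∀ e ∈ ledges (pm f k P j), e ∈ ({s(f a, f b)} : Set (Sym2 W)) := by
        rw [pm, if_pos hj]
        exact short_edges f h2
      rcases hsl hne with rfl | ⟨y, hy, hyj, rfl⟩
      · exact grp_nil hV hrem
      · refine grp_short hV hrem ((hvv j).2 h1) ((visN_f hf hNf _ _).2 hyj) (fun h => hv y h.symm) ?_
        rw [hS]; rcases hy with rfl | rfl | rfl <;> simp
    · rw [gpl j h1 h2 h3]
      refine grp_plainM M hf hNf h1 (hNj j h2) ?_ ?_
      · intro e he he'
        rw [ledges_map] at he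
        obtain ⟨e0, he0, rfl⟩ := List.mem_map.1 he
        have : e0 = s(a, b) := Sym2.map.injective hf (by simpa using he')
        subst this
        exact h3 (M.edge_uniq h1 hj he0 hje)
      · intro x hx hxu
        rw [← hx]
        rcases hu with h | ⟨h, h', rfl, rfl, _⟩
        · exact hns x (fun h' => hxu (h' ▸ h.1.symm))
        · exact hns x (fun h'' => by subst h''; omega)
    · rw [gtl, hNj _ (by omega), pm, if_neg (by omega)]
      rcases htl with rfl | rfl
      · exact grp_nil (by simp) (by simp [ledges])
      · refine grp_short (by simp) (by simp [ledges]) ((hvv _).2 (by omega))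
          ((visN_f hf hNf _ _).2 (by have := M.le q; omega)) (fun h => hv q h.symm) ?_
        rw [hS]; simp
  have hcovS : ∀ e ∈ S, ∃ j < k + 2, ∃ Q ∈ g j, e ∈ ledges Q := by
    intro e he
    by_cases hl : e ∈ Left
    · rcases (hL e he).1 hl with ⟨hne, h⟩ | h
      · exact ⟨jab, by omega, by rw [gab hne]; exact h⟩
      · exact ⟨k + 1, by omega, by rw [gtl]; exact h⟩
    · exact ⟨bt b, by omega, by rw [gi]; exact (hB.edges e).2 (.inr ⟨he, hl⟩)⟩
  have hwhere : ∀ j < k + 2, ∀ e ∈ S, (∃ Q ∈ g j, e ∈ ledges Q) →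
      (j = bt b ∧ e ∉ Left) ∨ (j = jab ∧ jab ≠ bt b ∧ sl ≠ [] ∧ e ∈ Left) ∨ (j = k + 1 ∧ tl ≠ [] ∧ e ∈ Left) := by
    intro j hjk e he hQ
    rcases cls j hjk with rfl | ⟨rfl, hne⟩ | ⟨h1, h2, h3⟩ | rfl
    · rw [gi, hB.edges] at hQ
      rcases hQ with h | h
      · exact absurd h.1 (hSP e he _)
      · exact .inl ⟨rfl, h.2⟩
    · rw [gab hne] at hQ
      exact .inr (.inl ⟨rfl, hne, by rintro rfl; simp at hQ, (hL e he).2 (.inl ⟨hne, hQ⟩)⟩)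
    · rw [gpl j h1 h2 h3] at hQ
      obtain ⟨Q, hQ, h⟩ := hQ
      simp at hQ; subst hQ
      exact absurd h (hSP e he _)
    · rw [gtl] at hQ
      exact .inr (.inr ⟨rfl, by rintro rfl; simp at hQ, (hL e he).2 (.inr hQ)⟩)
  obtain ⟨D', h1, h2⟩ := glue (f := f) (H := H) (u' := u') (N := N) (rem := {s(f a, f b)})
    (Sall := S) (g := g) M hf hgrp (fun e he j _ => hSP e he j)
    (by
      intro j j' hjj hj' e he hq1 hq2
      rcases hwhere j (by omega) e he hq1 with ⟨h, h'⟩ | ⟨h, h1, h2, h'⟩ | ⟨h, h1, h'⟩ <;>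
      rcases hwhere j' (by omega) e he hq2 with ⟨p, p'⟩ | ⟨p, p1, p2, p'⟩ | ⟨p, p1, p'⟩ <;>
      first | contradiction | omega | (rcases hex h1 with h | h <;> contradiction))
    (by
      intro e
      constructor
      · intro he
        induction e with | _ x y
        have he' : H.Adj x y := he
        rcases cov x with rfl | ⟨x, rfl⟩ <;> rcases cov y with rfl | ⟨y, rfl⟩
        · exact absurd he' (by simp)
        · right
          have : s(x, f y) ∈ S := (hS _).2 (by
            rcases (hH2 y).1 he' with rfl | rfl | rfl <;> simp)
          exact ⟨this, hcovS _ this⟩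
        · right
          have : s(f x, y) ∈ S := (hS _).2 (by
            rw [Sym2.eq_swap]
            rcases (hH2 x).1 he'.symm with rfl | rfl | rfl <;> simp)
          exact ⟨this, hcovS _ this⟩
        · left
          obtain ⟨k1, k2⟩ := (hH1 x y).1 he'
          exact ⟨s(x, y), k1, rfl, fun h => k2 ((hiff x y).1 h)⟩
      · rintro (⟨e0, he0, rfl, h⟩ | ⟨h, _⟩)
        · induction e0 with | _ x y
          exact (hH1 x y).2 ⟨he0, fun h' => h ((hiff x y).2 h')⟩
        · exact hSH e h)
    (by
      intro z
      rcases cov z with rfl | h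
      · exact .inr ⟨bt b, by omega, by rw [hNi]; rfl⟩
      · exact .inl h)
    (by
      rcases hu with ⟨rfl, hne⟩ | ⟨rfl, h', rfl, rfl, hsl', _⟩
      · obtain ⟨j, hjk, hju, h⟩ := M.ru_short hru
        have hlen := M.long b
        have : j ≠ bt b := by rintro rfl; rcases h with h | h <;> simp [h] at hlen
        have : j ≠ jab := by
          rintro rfl
          apply hne
          exact short_edge_eq h hje
        refine ⟨j, by omega, (P j).map f, by rw [gpl j hjk (by assumption) this]; simp, short_self f h⟩
      · exact ⟨jab, by omega, [u', f a], by rw [gab h', hsl']; simp, by simp [ledges]⟩)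
  rw [gtl] at h2
  exact ⟨D', g, h1, h2, gpl, gi, by rw [← gi]; exact (hgrp _ (by omega)).seq.earv, gab⟩

theorem ev_final (h : EVH G r u k P bt f H v a b q jab) :
    ∃ (D' : EarDecomposition H) (g : ℕ → List (List W)) (tl : List (List W)),
      (∀ u', ((s(a, b) = s(r, u) ∧ u' = v) ∨ (s(a, b) ≠ s(r, u) ∧ u' = f u)) → IsMondshein D' (f r) u') ∧
      D'.earList = (List.range (k + 1)).flatMap (fun j => (g j).map (fun l => {e | e ∈ ledges l})) ++
        tl.map (fun l => {e | e ∈ ledges l}) ∧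
      (tl = [] ∨ tl = [[v, f q]]) ∧
      (∀ j ≤ k, j ≠ bt b → j ≠ jab → g j = [(P j).map f]) ∧
      (1 ≤ (g (bt b)).length ∧ (g (bt b)).length ≤ 3 ∧ ∀ Q ∈ g (bt b),
        (∀ e ∈ ledges Q, e ∈ ledges ((P (bt b)).map f) ∨ e = s(v, f a) ∨ e = s(v, f b) ∨ e = s(v, f q)) ∧
        3 ≤ Q.length ∧ ∃ Vis, EarV (f r) Vis Q) ∧
      (jab ≠ bt b → g jab = [] ∨ g jab = [[v, f a]] ∨ g jab = [[v, f b]] ∨ g jab = [[v, f q]]) := by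
  obtain ⟨M, hru, hf, hv, cov, hab, hqa, hqb, hH1, hH2, hle, hj, hje, hjc⟩ := id h
  obtain ⟨N, hNd⟩ : ∃ N : ℕ → Set W, N = fun j => {z | z = v ∧ j = bt b} := ⟨_, rfl⟩
  obtain ⟨S, hS⟩ : ∃ S : Set (Sym2 W), ∀ e, e ∈ S ↔ e = s(v, f a) ∨ e = s(v, f b) ∨ e = s(v, f q) :=
    ⟨{e | _}, fun e => Iff.rfl⟩
  have hNf : ∀ m, ∀ z ∈ N m, ∀ x, f x ≠ z := by
    subst hNd; rintro m z ⟨rfl, _⟩; exact hv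
  have hvV : v ∉ visN f bt N (bt b) := by
    rw [visN_new hv]; rintro ⟨m, hm, hx⟩; subst hNd; simp at hx; omega
  have hvP : v ∉ (P (bt b)).map f := by
    intro h; obtain ⟨x, _, hx⟩ := List.mem_map.1 h; exact hv x hx
  have hE := M.ear_map hf hNf (M.le b)
  have hlong : 3 ≤ ((P (bt b)).map f).length := by simpa using M.long b
  have hbV : f b ∉ visN f bt N (bt b) := by rw [visN_f hf hNf]; omega
  have hbP : f b ∈ (P (bt b)).map f := List.mem_map_of_mem (M.self b)
  have hvis : ∀ x, bt x ≤ bt b → f x ∈ visN f bt N (bt b) ∨ f x ∈ (P (bt b)).map f := by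
    intro x hx
    rcases hx.lt_or_eq with h | h
    · left; rwa [visN_f hf hNf]
    · right; rw [← h]; exact List.mem_map_of_mem (M.self x)
  have habne : f a ≠ f b := fun h => hab.ne (hf h)
  have hmem : s(f a, f b) ∈ ledges ((P (bt b)).map f) ↔ jab = bt b := by
    rw [ledges_map]
    constructor
    · intro h
      obtain ⟨e0, he0, h⟩ := List.mem_map.1 h
      have : e0 = s(a, b) := Sym2.map.injective hf h
      subst this
      exact M.edge_uniq hj (M.le b) hje he0
    · intro h; rw [← h]; exact List.mem_map.2 ⟨s(a, b), hje, rfl⟩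
  have hjab : jab ≠ bt b → bt b < jab := by intro h; rcases hjc with h' | h' <;> omega
  have hnn : ∀ x y, s(v, f x) = s(v, f y) ↔ x = y := by
    intro x y; simp; constructor
    · rintro (h | h)
      · exact hf h
      · exact absurd h.2 (hv x)
    · rintro rfl; exact .inl rfl
  -- packaging
  have fin : ∀ {u' : W} {Z : Set W} {Left : Set (Sym2 W)} {Qs sl tl : List (List W)}
      (hB : Blk (f r) Z (visN f bt N (bt b)) ((P (bt b)).map f) {v} {s(f a, f b)} S Left Qs)
      (hsl : jab ≠ bt b → (sl = [] ∨ ∃ y, (y = a ∨ y = b ∨ y = q) ∧ bt y < jab ∧ sl = [[v, f y]]))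
      (htl : tl = [] ∨ tl = [[v, f q]])
      (hL : ∀ e ∈ S, e ∈ Left ↔ (jab ≠ bt b ∧ ∃ Q ∈ sl, e ∈ ledges Q) ∨ ∃ Q ∈ tl, e ∈ ledges Q)
      (hex : jab ≠ bt b → sl = [] ∨ tl = [])
      (hvZ : v ∈ Z ∨ v = u')
      (hu : (u' = f u ∧ s(a, b) ≠ s(r, u)) ∨
        (u' = v ∧ jab ≠ bt b ∧ a = r ∧ b = u ∧ sl = [[v, f a]] ∧ f u ∈ Z)), 
      ∃ (D' : EarDecomposition H) (g : ℕ → List (List W)) (tl : List (List W)),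
      (∀ u', ((s(a, b) = s(r, u) ∧ u' = v) ∨ (s(a, b) ≠ s(r, u) ∧ u' = f u)) → IsMondshein D' (f r) u') ∧
      D'.earList = (List.range (k + 1)).flatMap (fun j => (g j).map (fun l => {e | e ∈ ledges l})) ++
        tl.map (fun l => {e | e ∈ ledges l}) ∧
      (tl = [] ∨ tl = [[v, f q]]) ∧
      (∀ j ≤ k, j ≠ bt b → j ≠ jab → g j = [(P j).map f]) ∧
      (1 ≤ (g (bt b)).length ∧ (g (bt b)).length ≤ 3 ∧ ∀ Q ∈ g (bt b),
        (∀ e ∈ ledges Q, e ∈ ledges ((P (bt b)).map f) ∨ e = s(v, f a) ∨ e = s(v, f b) ∨ e = s(v, f q)) ∧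
        3 ≤ Q.length ∧ ∃ Vis, EarV (f r) Vis Q) ∧
      (jab ≠ bt b → g jab = [] ∨ g jab = [[v, f a]] ∨ g jab = [[v, f b]] ∨ g jab = [[v, f q]]) := by
    intro u' Z Left Qs sl tl hB hsl htl hL hex hvZ hu
    obtain ⟨D', g, h1, h2, h3, h4, h5, h6⟩ := ev_glue h hNd hS hB hsl htl hL hex hvZ hu
    refine ⟨D', g, tl, ?_, h2, htl, h3, ?_, ?_⟩
    · rintro u'' (⟨k1, rfl⟩ | ⟨k1, rfl⟩)
      · rcases hu with ⟨rfl, h⟩ | ⟨rfl, h⟩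
        · exact absurd k1 h
        · exact h1
      · rcases hu with ⟨rfl, h⟩ | ⟨rfl, h, rfl, rfl, _⟩
        · exact h1
        · exact absurd rfl k1
    · rw [h4]
      refine ⟨hB.ne, hB.le, fun Q hQ => ⟨?_, hB.long Q hQ, h5 Q hQ⟩⟩
      intro e he
      rcases (hB.edges e).1 ⟨Q, hQ, he⟩ with h | h
      · exact .inl h.1
      · exact .inr ((hS e).1 h.1)
    · intro hne
      rw [h6 hne]
      rcases hsl hne with h | ⟨y, rfl | rfl | rfl, _, h⟩ <;> simp [h]
  by_cases hr : s(a, b) = s(r, u)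
  · -- the edge `ru` is subdivided
    have hab' : a = r ∧ b = u := by
      rcases Sym2.eq_iff.1 hr with h | ⟨rfl, rfl⟩
      · exact h
      · have := M.umax b hab.ne'; omega
    obtain ⟨rfl, rfl⟩ := hab'
    have hne : jab ≠ bt b := by rintro rfl; exact M.ru hje
    have hqV : f q ∈ visN f bt N (bt b) := by rw [visN_f hf hNf]; exact M.umax q hqb
    have haV : f a ∈ visN f bt N (bt b) := by rw [visN_f hf hNf]; exact M.umax a hab.ne
    refine fin (u' := v) (sl := [[v, f a]]) (tl := []) (blk_ru hE hlong hbV hbP hqV haV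
      (fun h => hqa (hf h).symm) hvV hvP hS ?_) ?_ (.inl rfl) ?_ (fun _ => .inr rfl) (.inr rfl) ?_
    · intro e he he'
      have : e = s(f a, f b) := he'
      subst this
      exact hne (hmem.1 he)
    · intro _; right; exact ⟨a, .inl rfl, by have := hjab hne; omega, rfl⟩
    · intro e he; simp [ledges, hne]
    · right; exact ⟨rfl, hne, rfl, rfl, rfl, rfl⟩
  · have hrem : ∀ e ∈ ledges ((P (bt b)).map f), e ∈ ({s(f a, f b)} : Set (Sym2 W)) ↔ e = s(f a, f b) := by
      intro e _; rfl
    by_cases hq : bt q ≤ bt b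
    · obtain ⟨Qs, Left, ⟨hB, _⟩, ho⟩ := ev_out hE hlong habne (fun h => hqa (hf h)) (fun h => hqb (hf h))
        (hvis a hle) hbV hbP hvV hvP (hvis q hq) hS hrem
      rw [hmem] at ho
      rcases ho with ⟨h1, rfl⟩ | ⟨h1, ho⟩
      · exact fin (u' := f u) (sl := []) (tl := []) hB (fun h => absurd h1 h) (.inl rfl) (by simp)
          (fun _ => .inl rfl) (.inl rfl) (.inl ⟨rfl, hr⟩)
      · have : ∃ y, (y = a ∨ y = b ∨ y = q) ∧ Left = {s(v, f y)} := by
          rcases ho with h | h | h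
          · exact ⟨a, by simp, h⟩
          · exact ⟨b, by simp, h⟩
          · exact ⟨q, by simp, h⟩
        obtain ⟨y, hy, rfl⟩ := this
        have hlt := hjab h1
        refine fin (u' := f u) (sl := [[v, f y]]) (tl := []) hB (fun h => .inr ⟨y, hy, ?_, rfl⟩) (.inl rfl) ?_
          (fun _ => .inr rfl) (.inl rfl) (.inl ⟨rfl, hr⟩)
        · rcases hy with rfl | rfl | rfl <;> omega
        · intro e he; simp [ledges, h1]
    · have hqV : f q ∉ visN f bt N (bt b) := by rw [visN_f hf hNf]; omega
      have hqP : f q ∉ (P (bt b)).map f := by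
        intro h
        obtain ⟨x, hx, h⟩ := List.mem_map.1 h
        have := M.mem _ (M.le b) x hx
        rw [hf h] at this; omega
      obtain ⟨Qs, hB⟩ := ev_out_later hE hlong habne (hvis a hle) hbP hvV hvP hqV hqP (hv q) hS hrem
      refine fin (u' := f u) (sl := []) (tl := [[v, f q]]) hB (fun h => .inl rfl) (.inr rfl) ?_
        (fun _ => .inl rfl) (.inl rfl) (.inl ⟨rfl, hr⟩)
      intro e he; simp [ledges]
end EV

section EE
variable {V W : Type u} {G : SimpleGraph V} {r u : V} {k : ℕ} {P : ℕ → List V} {bt : V → ℕ}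
  {f : V → W} {H : SimpleGraph W} {v w : W} {a b c d : V} {jab jcd : ℕ}

/-- hypotheses of an edge-edge-addition -/
structure EEV (G : SimpleGraph V) (r u : V) (k : ℕ) (P : ℕ → List V) (bt : V → ℕ) (f : V → W)
    (H : SimpleGraph W) (v w : W) (a b c d : V) (jab jcd : ℕ) : Prop where
  M : Mon G r u k P bt
  hru : G.Adj r u
  hf : Function.Injective f
  hvw : v ≠ w
  hv : ∀ x, f x ≠ v
  hw : ∀ x, f x ≠ w
  cov : ∀ z : W, z = v ∨ z = w ∨ ∃ x, f x = z
  hab : G.Adj a b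
  hcd : G.Adj c d
  hne : s(a, b) ≠ s(c, d)
  hH1 : ∀ x y : V, H.Adj (f x) (f y) ↔ (G.Adj x y ∧ s(x, y) ≠ s(a, b) ∧ s(x, y) ≠ s(c, d))
  hH2 : ∀ x : V, H.Adj v (f x) ↔ (x = a ∨ x = b)
  hH3 : ∀ x : V, H.Adj w (f x) ↔ (x = c ∨ x = d)
  hH4 : H.Adj v w
  hle : bt a ≤ bt b
  hle2 : bt c ≤ bt d
  hdb : bt d ≤ bt b
  hj : jab ≤ k
  hje : s(a, b) ∈ ledges (P jab)
  hjc : (jab = bt b ∧ 3 ≤ (P jab).length) ∨ (bt b < jab ∧ (P jab = [a, b] ∨ P jab = [b, a]))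
  hk : jcd ≤ k
  hke : s(c, d) ∈ ledges (P jcd)
  hkc : (jcd = bt d ∧ 3 ≤ (P jcd).length) ∨ (bt d < jcd ∧ (P jcd = [c, d] ∨ P jcd = [d, c]))

/-- new vertices -/
def eeN (v w : W) (i nw : ℕ) : ℕ → Set W := fun j => {z | (z = v ∧ j = i) ∨ (z = w ∧ j = nw)}

/-- removed edges -/
def eeR (f : V → W) (a b c d : V) : Set (Sym2 W) := {e | e = s(f a, f b) ∨ e = s(f c, f d)}

/-- new edges -/
def eeS (f : V → W) (v w : W) (a b c d : V) : Set (Sym2 W) :=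
  {e | e = s(v, f a) ∨ e = s(v, f b) ∨ e = s(v, w) ∨ e = s(w, f c) ∨ e = s(w, f d)}

theorem EEV.N_f (h : EEV G r u k P bt f H v w a b c d jab jcd) (i nw : ℕ) :
    ∀ m, ∀ z ∈ eeN v w i nw m, ∀ x, f x ≠ z := by
  rintro m z (⟨rfl, _⟩ | ⟨rfl, _⟩) x
  · exact h.hv x
  · exact h.hw x

theorem EEV.vis_v (h : EEV G r u k P bt f H v w a b c d jab jcd) (i nw j : ℕ) :
    v ∈ visN f bt (eeN v w i nw) j ↔ i < j := by
  rw [visN_new h.hv]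
  constructor
  · rintro ⟨m, hm, ⟨_, rfl⟩ | ⟨h', _⟩⟩
    · exact hm
    · exact absurd h' h.hvw
  · intro hj; exact ⟨i, hj, .inl ⟨rfl, rfl⟩⟩

theorem EEV.vis_w (h : EEV G r u k P bt f H v w a b c d jab jcd) (i nw j : ℕ) :
    w ∈ visN f bt (eeN v w i nw) j ↔ nw < j := by
  rw [visN_new h.hw]
  constructor
  · rintro ⟨m, hm, ⟨h', _⟩ | ⟨_, rfl⟩⟩
    · exact absurd h'.symm h.hvw
    · exact hm
  · intro hj; exact ⟨nw, hj, .inr ⟨rfl, rfl⟩⟩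

theorem EEV.vis_f (h : EEV G r u k P bt f H v w a b c d jab jcd) (i nw j : ℕ) (x : V) :
    f x ∈ visN f bt (eeN v w i nw) j ↔ bt x < j := visN_f h.hf (h.N_f i nw) x j

theorem EEV.short (h : EEV G r u k P bt f H v w a b c d jab jcd) (hne : jab ≠ bt b) :
    bt b < jab ∧ (P jab = [a, b] ∨ P jab = [b, a]) := by
  rcases h.hjc with h | h
  · exact absurd h.1 hne
  · exact h

theorem EEV.jj (h : EEV G r u k P bt f H v w a b c d jab jcd) (hne : jab ≠ bt b) : jab ≠ jcd := by
  rintro rfl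
  exact h.hne (short_edge_eq (h.short hne).2 h.hke).symm

theorem EEV.iff_f (h : EEV G r u k P bt f H v w a b c d jab jcd) (x y x' y' : V) :
    s(f x, f y) = s(f x', f y') ↔ s(x, y) = s(x', y') := by
  simp [h.hf.eq_iff]

theorem EEV.ns (h : EEV G r u k P bt f H v w a b c d jab jcd) {nw : ℕ} (hnw : bt d ≤ nw) :
    ∀ x, x ≠ u → ∃ y, H.Adj (f x) y ∧ y ∉ visN f bt (eeN v w (bt b) nw) (bt x + 1) := by
  intro x hx
  obtain ⟨y, h1, h2⟩ := h.M.ns x hx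
  by_cases he : s(x, y) = s(a, b)
  · have : x = a ∧ y = b := by
      rcases Sym2.eq_iff.1 he with h' | ⟨rfl, rfl⟩
      · exact h'
      · have := h.hle; omega
    obtain ⟨rfl, rfl⟩ := this
    exact ⟨v, ((h.hH2 x).2 (.inl rfl)).symm, by rw [h.vis_v]; omega⟩
  by_cases he' : s(x, y) = s(c, d)
  · have : x = c ∧ y = d := by
      rcases Sym2.eq_iff.1 he' with h' | ⟨rfl, rfl⟩
      · exact h'
      · have := h.hle2; omega
    obtain ⟨rfl, rfl⟩ := this
    exact ⟨w, ((h.hH3 x).2 (.inl rfl)).symm, by rw [h.vis_w]; omega⟩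
  · exact ⟨f y, (h.hH1 x y).2 ⟨h1, he, he'⟩, by rw [h.vis_f]; omega⟩

theorem EEV.S_ne (h : EEV G r u k P bt f H v w a b c d jab jcd) :
    ∀ e ∈ eeS f v w a b c d, ∀ j, e ∉ ledges ((P j).map f) := by
  intro e he j hj
  rw [ledges_map] at hj
  obtain ⟨e0, he0, rfl⟩ := List.mem_map.1 hj
  have : v ∈ Sym2.map f e0 ∨ w ∈ Sym2.map f e0 := by
    rcases he with he | he | he | he | he <;> rw [he] <;> simp
  rcases this with h' | h'
  · obtain ⟨x, _, hx⟩ := Sym2.mem_map.1 h'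
    exact h.hv x hx
  · obtain ⟨x, _, hx⟩ := Sym2.mem_map.1 h'
    exact h.hw x hx

theorem EEV.S_H (h : EEV G r u k P bt f H v w a b c d jab jcd) :
    ∀ e ∈ eeS f v w a b c d, e ∈ H.edgeSet := by
  rintro e (rfl | rfl | rfl | rfl | rfl)
  · exact (h.hH2 _).2 (by simp)
  · exact (h.hH2 _).2 (by simp)
  · exact h.hH4
  · exact (h.hH3 _).2 (by simp)
  · exact (h.hH3 _).2 (by simp)

theorem EEV.mem_R (h : EEV G r u k P bt f H v w a b c d jab jcd) {j : ℕ} (hj : j ≤ k)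
    {e : Sym2 W} (he : e ∈ ledges ((P j).map f)) (hR : e ∈ eeR f a b c d) : j = jab ∨ j = jcd := by
  rw [ledges_map] at he
  obtain ⟨e0, he0, rfl⟩ := List.mem_map.1 he
  rcases hR with hR | hR
  · have : e0 = s(a, b) := Sym2.map.injective h.hf (by simpa using hR)
    subst this
    exact .inl (h.M.edge_uniq hj h.hj he0 h.hje)
  · have : e0 = s(c, d) := Sym2.map.injective h.hf (by simpa using hR)
    subst this
    exact .inr (h.M.edge_uniq hj h.hk he0 h.hke)

theorem EEV.grp_ab (h : EEV G r u k P bt f H v w a b c d jab jcd) {u' : W} {nw : ℕ} (hnw : nw ≤ bt b)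
    (hne : jab ≠ bt b) {sl : List (List W)}
    (hsl : sl = [] ∨ ∃ y, (y = f a ∨ y = f b ∨ y = w) ∧ sl = [[v, y]]) :
    Grp H (f r) u' (visN f bt (eeN v w (bt b) nw) jab) (pm f k P jab) (eeN v w (bt b) nw jab)
      (eeR f a b c d) (eeS f v w a b c d) sl := by
  obtain ⟨h1, h2⟩ := h.short hne
  have hN : eeN v w (bt b) nw jab = ∅ := by
    ext z; simp only [eeN, Set.mem_setOf_eq, Set.mem_empty_iff_false, iff_false]; omega
  rw [hN]
  have hle := h.hle
  have hV : ∀ x ∈ pm f k P jab, x ∈ visN f bt (eeN v w (bt b) nw) jab := by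
    rw [pm, if_pos h.hj]
    intro x hx
    obtain ⟨y, hy, rfl⟩ := List.mem_map.1 hx
    rw [h.vis_f]
    rcases short_mem h2 hy with rfl | rfl <;> omega
  have hrem : ∀ e ∈ ledges (pm f k P jab), e ∈ eeR f a b c d := by
    rw [pm, if_pos h.hj]
    intro e he
    exact .inl (short_edges f h2 e he)
  rcases hsl with rfl | ⟨y, hy, rfl⟩
  · exact grp_nil hV hrem
  · have hv := (h.vis_v (bt b) nw jab).2 h1
    rcases hy with rfl | rfl | rfl
    · exact grp_short hV hrem hv ((h.vis_f _ _ _ _).2 (by omega)) (fun h' => h.hv a h'.symm) (by simp [eeS])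
    · exact grp_short hV hrem hv ((h.vis_f _ _ _ _).2 (by omega)) (fun h' => h.hv b h'.symm) (by simp [eeS])
    · exact grp_short hV hrem hv ((h.vis_w _ _ _).2 (by omega)) h.hvw (by simp [eeS])

theorem EEV.grp_cd (h : EEV G r u k P bt f H v w a b c d jab jcd) {u' : W}
    (h1 : bt d < jcd) (h2 : P jcd = [c, d] ∨ P jcd = [d, c]) {X : List (List W)}
    (hX : X = [] ∨ (bt b < jcd ∧ ∃ y, (y = f c ∨ y = f d) ∧ X = [[w, y]])) :
    jcd ≠ bt b ∧
    Grp H (f r) u' (visN f bt (eeN v w (bt b) (bt b)) jcd) (pm f k P jcd) (eeN v w (bt b) (bt b) jcd)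
      (eeR f a b c d) (eeS f v w a b c d) X := by
  have hnb : jcd ≠ bt b := by
    rintro rfl
    have := h.M.long b
    rcases h2 with h2 | h2 <;> simp [h2] at this
  have hN : eeN v w (bt b) (bt b) jcd = ∅ := by
    ext z; simp only [eeN, Set.mem_setOf_eq, Set.mem_empty_iff_false, iff_false]; omega
  rw [hN]
  have hle := h.hle2
  have hV : ∀ x ∈ pm f k P jcd, x ∈ visN f bt (eeN v w (bt b) (bt b)) jcd := by
    rw [pm, if_pos h.hk]
    intro x hx
    obtain ⟨y, hy, rfl⟩ := List.mem_map.1 hx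
    rw [h.vis_f]
    rcases short_mem h2 hy with rfl | rfl <;> omega
  have hrem : ∀ e ∈ ledges (pm f k P jcd), e ∈ eeR f a b c d := by
    rw [pm, if_pos h.hk]
    intro e he
    exact .inr (short_edges f h2 e he)
  refine ⟨hnb, ?_⟩
  rcases hX with rfl | ⟨hb, y, hy, rfl⟩
  · exact grp_nil hV hrem
  · have hv := (h.vis_w (bt b) (bt b) jcd).2 hb
    rcases hy with rfl | rfl
    · exact grp_short hV hrem hv ((h.vis_f _ _ _ _).2 (by omega)) (fun h' => h.hw c h'.symm) (by simp [eeS])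
    · exact grp_short hV hrem hv ((h.vis_f _ _ _ _).2 (by omega)) (fun h' => h.hw d h'.symm) (by simp [eeS])

/-- subdividing an edge of an ear list -/
theorem sub_list {r' : W} {Vis : Set W} {l : List W} {x y z : W} (hE : EarV r' Vis l)
    (he : s(x, y) ∈ ledges l) (hxy : x ≠ y) (hz : z ∉ Vis) (hzl : z ∉ l) :
    ∃ Q, EarV r' Vis Q ∧ (∀ p, p ∈ Q ↔ p ∈ l ∨ p = z) ∧
      ∀ e, e ∈ ledges Q ↔ (e ∈ ledges l ∧ e ≠ s(x, y)) ∨ e = s(z, x) ∨ e = s(z, y) := by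
  obtain ⟨A, p, q, B, rfl, he'⟩ := exists_split_of_mem_ledges he
  have hpq : p ≠ q := by
    rintro rfl
    rcases Sym2.eq_iff.1 he' with ⟨rfl, rfl⟩ | ⟨rfl, rfl⟩ <;> exact hxy rfl
  have hn := hE.ledges_nodup
  rw [ledges_split2] at hn
  have hE' : EarV r' Vis (A ++ p :: ([] ++ q :: B)) := hE
  simp only [List.mem_append, List.mem_cons, not_or] at hzl
  refine ⟨A ++ p :: ([z] ++ q :: B), hE'.replace (.inl hpq) (by simp) (by simp) ?_, ?_, ?_⟩
  · intro z' hz'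
    simp at hz'; subst hz'
    exact ⟨hz, hzl.1, hzl.2.1, hzl.2.2.1, hzl.2.2.2⟩
  · intro t; simp; tauto
  · intro e
    have hsw : (e = s(z, x) ∨ e = s(z, y)) ↔ (e = s(p, z) ∨ e = s(z, q)) := by
      rw [Sym2.eq_swap (a := p)]
      rcases Sym2.eq_iff.1 he' with ⟨rfl, rfl⟩ | ⟨rfl, rfl⟩
      · rfl
      · exact or_comm
    rw [hsw, he', ledges_split2]
    have : A ++ p :: ([z] ++ q :: B) = A ++ p :: z :: (q :: B) := by simp
    rw [this, ledges_split2, ledges_cons2]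
    have h1 : s(p, q) ∉ ledges (A ++ [p]) := by
      intro h; exact (List.nodup_append.1 hn).2.2 _ h _ (by simp) rfl
    have h2 : s(p, q) ∉ ledges (q :: B) := (List.nodup_cons.1 (List.nodup_append.1 hn).2.1).1
    simp only [List.mem_append, List.mem_cons]
    constructor
    · rintro (h | h | h | h)
      · exact .inl ⟨.inl h, by rintro rfl; exact h1 h⟩
      · exact .inr (.inl h)
      · exact .inr (.inr h)
      · exact .inl ⟨.inr (.inr h), by rintro rfl; exact h2 h⟩
    · rintro (⟨h | h | h, h'⟩ | h | h)
      · exact .inl h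
      · exact absurd h h'
      · exact .inr (.inr (.inr h))
      · exact .inr (.inl h)
      · exact .inr (.inr (.inl h))

theorem EEV.grp_sub (h : EEV G r u k P bt f H v w a b c d jab jcd) {u' : W}
    (h1 : jcd = bt d) (h2 : bt d < bt b) :
    ∃ Q, Grp H (f r) u' (visN f bt (eeN v w (bt b) jcd) jcd) (pm f k P jcd) (eeN v w (bt b) jcd jcd)
      (eeR f a b c d) (eeS f v w a b c d) [Q] ∧
      ∀ e, e ∈ ledges Q ↔ (e ∈ ledges ((P jcd).map f) ∧ e ≠ s(f c, f d)) ∨ e = s(w, f c) ∨ e = s(w, f d) := by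
  have hE := h.M.ear_map h.hf (h.N_f (bt b) jcd) h.hk
  have hwP : w ∉ (P jcd).map f := by
    intro h'; obtain ⟨x, _, hx⟩ := List.mem_map.1 h'; exact h.hw x hx
  obtain ⟨Q, hQ, hQv, hQe⟩ := sub_list (x := f c) (y := f d) (z := w) hE
    (by rw [ledges_map]; exact List.mem_map.2 ⟨s(c, d), h.hke, rfl⟩) (fun h' => h.hcd.ne (h.hf h'))
    (by rw [h.vis_w]; omega) hwP
  refine ⟨Q, ?_, hQe⟩
  have hN : eeN v w (bt b) jcd jcd = {w} := by
    ext z; simp [eeN]; omega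
  rw [pm, if_pos h.hk, hN]
  have hQsub : ∀ y ∈ Q, y ∈ visN f bt (eeN v w (bt b) jcd) (jcd + 1) := by
    intro y hy
    rcases (hQv y).1 hy with h' | rfl
    · exact h.M.sub_vis h.hk h'
    · rw [h.vis_w]; omega
  refine ⟨⟨hQ, ?_, trivial⟩, .inr (by simp), ?_, ?_, ?_⟩
  · intro x hx hxV hxu
    have : ∃ y, H.Adj x y ∧ y ∉ visN f bt (eeN v w (bt b) jcd) (jcd + 1) := by
      rcases (hQv x).1 hx with h' | rfl
      · obtain ⟨x0, rfl, hx0⟩ := h.M.new_eq h.hk h' hxV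
        rw [← hx0]
        have := h.ns (nw := jcd) (by omega) x0 (by
          rintro rfl
          by_cases hb : b = x0
          · subst hb; omega
          · have := h.M.umax b hb; omega)
        exact hx0 ▸ this
      · exact ⟨v, h.hH4.symm, by rw [h.vis_v]; omega⟩
    obtain ⟨y, hy1, hy2⟩ := this
    exact ⟨y, hy1, fun h' => hy2 (visN_mono (by omega) h'), fun h' => hy2 (hQsub y h')⟩
  · intro x; simp [hQv]
  · intro Q' hQ' e he
    simp at hQ'; subst hQ'
    rcases (hQe e).1 he with ⟨k1, k2⟩ | rfl | rfl
    · refine .inl ⟨k1, ?_⟩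
      rintro (h' | h')
      · rw [h', ledges_map] at k1
        obtain ⟨e0, he0, h''⟩ := List.mem_map.1 k1
        have : e0 = s(a, b) := Sym2.map.injective h.hf h''
        subst this
        have := h.M.edge_uniq h.hk h.hj he0 h.hje
        rcases h.hjc with h' | h' <;> omega
      · exact k2 h'
    · right; simp [eeS]
    · right; simp [eeS]
  · intro e he hR
    refine ⟨Q, by simp, (hQe e).2 (.inl ⟨he, ?_⟩)⟩
    rintro rfl
    exact hR (.inr rfl)

theorem EEV.H_edges (h : EEV G r u k P bt f H v w a b c d jab jcd) (e : Sym2 W) :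
    e ∈ H.edgeSet ↔ (∃ e0 ∈ G.edgeSet, e = Sym2.map f e0 ∧ e ∉ eeR f a b c d) ∨ e ∈ eeS f v w a b c d := by
  constructor
  · intro he
    induction e with | _ x y
    have he' : H.Adj x y := he
    rcases h.cov x with hx | hx | ⟨x, rfl⟩ <;> rcases h.cov y with hy | hy | ⟨y, rfl⟩
    · subst hx hy; exact absurd he' (by simp)
    · subst hx hy; right; simp [eeS]
    · subst hx; right
      rcases (h.hH2 y).1 he' with rfl | rfl <;> simp [eeS]
    · subst hx hy; right; rw [Sym2.eq_swap]; simp [eeS]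
    · subst hx hy; exact absurd he' (by simp)
    · subst hx; right
      rcases (h.hH3 y).1 he' with rfl | rfl <;> simp [eeS]
    · subst hy; right; rw [Sym2.eq_swap]
      rcases (h.hH2 x).1 he'.symm with rfl | rfl <;> simp [eeS]
    · subst hy; right; rw [Sym2.eq_swap]
      rcases (h.hH3 x).1 he'.symm with rfl | rfl <;> simp [eeS]
    · left
      obtain ⟨k1, k2, k3⟩ := (h.hH1 x y).1 he'
      refine ⟨s(x, y), k1, rfl, ?_⟩
      rintro (h' | h')
      · exact k2 ((h.iff_f _ _ _ _).1 h')
      · exact k3 ((h.iff_f _ _ _ _).1 h')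
  · rintro (⟨e0, he0, rfl, h'⟩ | h')
    · induction e0 with | _ x y
      refine (h.hH1 x y).2 ⟨he0, fun h'' => h' (.inl ((h.iff_f _ _ _ _).2 h'')),
        fun h'' => h' (.inr ((h.iff_f _ _ _ _).2 h''))⟩
    · exact h.S_H e h'

set_option maxHeartbeats 1000000 in
theorem ee_glue (h : EEV G r u k P bt f H v w a b c d jab jcd) {u' : W} {Z : Set W}
    {S Left LB LC : Set (Sym2 W)}
    {Qs sl X : List (List W)} {nw : ℕ} (hnw : bt d ≤ nw)
    (hnw' : nw = bt b ∨ (nw = jcd ∧ jcd = bt d ∧ bt d < bt b))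
    (hS : ∀ e ∈ S, e ∈ eeS f v w a b c d)
    (hB : Blk (f r) Z (visN f bt (eeN v w (bt b) nw) (bt b)) ((P (bt b)).map f)
      (eeN v w (bt b) nw (bt b)) (eeR f a b c d) S Left Qs)
    (hsl : jab ≠ bt b → (sl = [] ∨ ∃ y, (y = f a ∨ y = f b ∨ y = w) ∧ sl = [[v, y]]))
    (hX : jcd ≠ bt b → Grp H (f r) u' (visN f bt (eeN v w (bt b) nw) jcd) (pm f k P jcd)
      (eeN v w (bt b) nw jcd) (eeR f a b c d) (eeS f v w a b c d) X)
    (hLB : ∀ e ∈ eeS f v w a b c d, e ∈ LB ↔ jab ≠ bt b ∧ ∃ Q ∈ sl, e ∈ ledges Q)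
    (hLC : ∀ e ∈ eeS f v w a b c d, e ∈ LC ↔ jcd ≠ bt b ∧ ∃ Q ∈ X, e ∈ ledges Q)
    (hA : ∀ e ∈ eeS f v w a b c d, (e ∈ S ∧ e ∉ Left) ↔ (e ∉ LB ∧ e ∉ LC))
    (hBC : ∀ e ∈ LB, e ∉ LC)
    (hNZ : ∀ z ∈ eeN v w (bt b) nw (bt b), z ∈ Z ∨ z = u')
    (hu : (u' = f u ∧ s(a, b) ≠ s(r, u) ∧ s(c, d) ≠ s(r, u)) ∨
      (f u ∈ Z ∧ bt b = bt u ∧ ((jab ≠ bt b ∧ sl = [[u', f r]]) ∨ (jcd ≠ bt b ∧ X = [[u', f r]])))) :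
    ∃ (D' : EarDecomposition H) (g : ℕ → List (List W)), IsMondshein D' (f r) u' ∧
      D'.earList = (List.range (k + 1)).flatMap (fun j => (g j).map (fun l => {e | e ∈ ledges l})) ∧
      (∀ j ≤ k, j ≠ bt b → j ≠ jab → j ≠ jcd → g j = [(P j).map f]) ∧
      g (bt b) = Qs ∧ (∀ Q ∈ Qs, ∃ Vis, EarV (f r) Vis Q) ∧
      (jab ≠ bt b → g jab = sl) ∧ (jcd ≠ bt b → g jcd = X) := by
  have hj := h.hj
  have hk := h.hk
  have hdb := h.hdb
  have hbk := h.M.le b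
  have hns := h.ns hnw
  obtain ⟨g, hg⟩ : ∃ g : ℕ → List (List W), g = fun j => if j = bt b then Qs else if j = jab then sl else
    if j = jcd then X else if j ≤ k then [(P j).map f] else [] := ⟨_, rfl⟩
  have gi : g (bt b) = Qs := by simp [hg]
  have gab : jab ≠ bt b → g jab = sl := by intro h; simp [hg, h]
  have gcd' : jcd ≠ bt b → g jcd = X := by
    intro h'
    by_cases hh : jab = bt b
    · simp [hg, h', hh]
    · simp [hg, h', (h.jj hh).symm]
  have gpl : ∀ j ≤ k, j ≠ bt b → j ≠ jab → j ≠ jcd → g j = [(P j).map f] := by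
    intro j h1 h2 h3 h4; simp [hg, h1, h2, h3, h4]
  have gtl : g (k + 1) = [] := by
    simp [hg, show k + 1 ≠ bt b by omega, show k + 1 ≠ jab by omega, show k + 1 ≠ jcd by omega]
  have cls : ∀ j < k + 2, j = bt b ∨ (j = jab ∧ jab ≠ bt b) ∨ (j = jcd ∧ jcd ≠ bt b) ∨
      (j ≤ k ∧ j ≠ bt b ∧ j ≠ jab ∧ j ≠ jcd) ∨ j = k + 1 := by
    intro j hj; omega
  have hNj : ∀ j, j ≠ bt b → j ≠ jcd → eeN v w (bt b) nw j = ∅ := by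
    intro j h1 h2
    ext z; simp only [eeN, Set.mem_setOf_eq, Set.mem_empty_iff_false, iff_false]; omega
  have hgrp : ∀ j < k + 2, Grp H (f r) u' (visN f bt (eeN v w (bt b) nw) j) (pm f k P j)
      (eeN v w (bt b) nw j) (eeR f a b c d) (eeS f v w a b c d) (g j) := by
    intro j hjk
    rcases cls j hjk with rfl | ⟨rfl, hne⟩ | ⟨rfl, hne⟩ | ⟨h1, h2, h3, h4⟩ | rfl
    · rw [gi]
      refine grp_blkM h.M hbk hB (fun e he => h.S_H e (hS e he)) hS hNZ ?_
      intro x hx h1 h2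
      have hxu : x ≠ u := by
        rintro rfl
        rcases hu with h' | h'
        · exact h2 h'.1.symm
        · exact h1 h'.1
      have := hns x hxu
      rw [hx] at this
      exact this
    · rw [gab hne]
      exact h.grp_ab (by omega) hne (hsl hne)
    · rw [gcd' hne]
      exact hX hne
    · rw [gpl j h1 h2 h3 h4]
      refine grp_plainM h.M h.hf (h.N_f _ _) h1 (hNj j h2 h4) ?_ ?_
      · intro e he he'
        rcases h.mem_R h1 he he' with h' | h'
        · exact h3 h'
        · exact h4 h'
      · intro x hx hxu
        rw [← hx]
        refine hns x ?_
        rintro rfl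
        rcases hu with h' | h'
        · exact hxu h'.1.symm
        · omega
    · rw [gtl, hNj _ (by omega) (by omega), pm, if_neg (by omega)]
      exact grp_nil (by simp) (by simp [ledges])
  have hcovS : ∀ e ∈ eeS f v w a b c d, ∃ j < k + 2, ∃ Q ∈ g j, e ∈ ledges Q := by
    intro e he
    by_cases h1 : e ∈ LB
    · obtain ⟨hne, h'⟩ := (hLB e he).1 h1
      exact ⟨jab, by omega, by rw [gab hne]; exact h'⟩
    by_cases h2 : e ∈ LC
    · obtain ⟨hne, h'⟩ := (hLC e he).1 h2
      exact ⟨jcd, by omega, by rw [gcd' hne]; exact h'⟩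
    · exact ⟨bt b, by omega, by rw [gi]; exact (hB.edges e).2 (.inr ((hA e he).2 ⟨h1, h2⟩))⟩
  have hwhere : ∀ j < k + 2, ∀ e ∈ eeS f v w a b c d, (∃ Q ∈ g j, e ∈ ledges Q) →
      (j = bt b ∧ e ∉ LB ∧ e ∉ LC) ∨ (j = jab ∧ e ∈ LB) ∨ (j = jcd ∧ e ∈ LC) := by
    intro j hjk e he hQ
    rcases cls j hjk with rfl | ⟨rfl, hne⟩ | ⟨rfl, hne⟩ | ⟨h1, h2, h3, h4⟩ | rfl
    · rw [gi, hB.edges] at hQ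
      rcases hQ with h' | h'
      · exact absurd h'.1 (h.S_ne e he _)
      · exact .inl ⟨rfl, (hA e he).1 h'⟩
    · rw [gab hne] at hQ
      exact .inr (.inl ⟨rfl, (hLB e he).2 ⟨hne, hQ⟩⟩)
    · rw [gcd' hne] at hQ
      exact .inr (.inr ⟨rfl, (hLC e he).2 ⟨hne, hQ⟩⟩)
    · rw [gpl j h1 h2 h3 h4] at hQ
      obtain ⟨Q, hQ, h'⟩ := hQ
      simp at hQ; subst hQ
      exact absurd h' (h.S_ne e he _)
    · rw [gtl] at hQ; simp at hQ
  obtain ⟨D', h1, h2⟩ := glue (f := f) (H := H) (u' := u') (N := eeN v w (bt b) nw)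
    (rem := eeR f a b c d) (Sall := eeS f v w a b c d) (g := g) h.M h.hf hgrp
    (fun e he j _ => h.S_ne e he j)
    (by
      intro j j' hjj hj' e he hq1 hq2
      have hbc := hBC e
      rcases hwhere j (by omega) e he hq1 with ⟨p, p1, p2⟩ | ⟨p, p1⟩ | ⟨p, p1⟩ <;>
      rcases hwhere j' (by omega) e he hq2 with ⟨q, q1, q2⟩ | ⟨q, q1⟩ | ⟨q, q1⟩ <;>
      first | contradiction | omega | exact hbc p1 q1 | exact hbc q1 p1)
    (by
      intro e
      rw [h.H_edges e]
      constructor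
      · rintro (h' | h')
        · exact .inl h'
        · exact .inr ⟨h', hcovS e h'⟩
      · rintro (h' | h')
        · exact .inl h'
        · exact .inr h'.1)
    (by
      intro z
      rcases h.cov z with rfl | rfl | h'
      · exact .inr ⟨bt b, by omega, .inl ⟨rfl, rfl⟩⟩
      · exact .inr ⟨nw, by omega, .inr ⟨rfl, rfl⟩⟩
      · exact .inl h')
    (by
      rcases hu with ⟨rfl, hne, hne'⟩ | ⟨_, _, ⟨h', h''⟩ | ⟨h', h''⟩⟩
      · obtain ⟨j, hjk, hju, h'⟩ := h.M.ru_short h.hru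
        have hlen := h.M.long b
        have k1 : j ≠ bt b := by rintro rfl; rcases h' with h' | h' <;> simp [h'] at hlen
        have k2 : j ≠ jab := by
          rintro rfl
          exact hne (short_edge_eq h' h.hje)
        have k3 : j ≠ jcd := by
          rintro rfl
          exact hne' (short_edge_eq h' h.hke)
        exact ⟨j, by omega, (P j).map f, by rw [gpl j hjk k1 k2 k3]; simp, short_self f h'⟩
      · exact ⟨jab, by omega, [u', f r], by rw [gab h', h'']; simp, by simp [ledges]⟩
      · exact ⟨jcd, by omega, [u', f r], by rw [gcd' h', h'']; simp, by simp [ledges]⟩)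
  rw [gtl] at h2
  exact ⟨D', g, h1, by simpa using h2, gpl, gi, by rw [← gi]; exact (hgrp _ (by omega)).seq.earv, gab, gcd'⟩
end EE

section EE2
variable {V W : Type u} {G : SimpleGraph V} {r u : V} {k : ℕ} {P : ℕ → List V} {bt : V → ℕ}
  {f : V → W} {H : SimpleGraph W} {v w : W} {a b c d : V} {jab jcd : ℕ}

/-- the vertex of the new graph playing the role of `u` -/
def EEU (r u : V) (f : V → W) (v w : W) (a b c d : V) (u' : W) : Prop :=
  (s(a, b) = s(r, u) ∧ u' = v) ∨ (s(a, b) ≠ s(r, u) ∧ s(c, d) = s(r, u) ∧ u' = w) ∨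
    (s(a, b) ≠ s(r, u) ∧ s(c, d) ≠ s(r, u) ∧ u' = f u)

/-- result of an edge-edge-addition, on the level of lists -/
def EEConc (r u : V) (k : ℕ) (P : ℕ → List V) (bt : V → ℕ) (f : V → W)
    (H : SimpleGraph W) (v w : W) (a b c d : V) (jab jcd : ℕ) : Prop :=
  ∃ (D' : EarDecomposition H) (g : ℕ → List (List W)),
    (∀ u', EEU r u f v w a b c d u' → IsMondshein D' (f r) u') ∧
    D'.earList = (List.range (k + 1)).flatMap (fun j => (g j).map (fun l => {e | e ∈ ledges l})) ∧
    (∀ j ≤ k, j ≠ bt b → j ≠ jab → j ≠ jcd → g j = [(P j).map f]) ∧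
    (1 ≤ (g (bt b)).length ∧ (g (bt b)).length ≤ 3 ∧ ∀ Q ∈ g (bt b),
      (∀ e ∈ ledges Q, e ∈ ledges ((P (bt b)).map f) ∨ e ∈ eeS f v w a b c d) ∧
      3 ≤ Q.length ∧ ∃ Vis, EarV (f r) Vis Q) ∧
    (jcd = bt d → bt d < bt b → ∃ Q, g jcd = [Q] ∧ ∀ e, e ∈ ledges Q ↔
      (e ∈ ledges ((P jcd).map f) ∧ e ≠ s(f c, f d)) ∨ e = s(w, f c) ∨ e = s(w, f d)) ∧
    (jab ≠ bt b → (g jab = [] ∨ ∃ y, (y = f a ∨ y = f b ∨ y = w) ∧ g jab = [[v, y]])) ∧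
    (bt d < jcd → (g jcd = [] ∨ ∃ y, (y = f c ∨ y = f d) ∧ g jcd = [[w, y]]))

theorem EEV.jcd_ne (h : EEV G r u k P bt f H v w a b c d jab jcd) (h' : bt d < jcd) :
    (P jcd = [c, d] ∨ P jcd = [d, c]) ∧ jcd ≠ bt b := by
  rcases h.hkc with h'' | h''
  · omega
  · refine ⟨h''.2, ?_⟩
    rintro rfl
    have := h.M.long b
    rcases h''.2 with h2 | h2 <;> simp [h2] at this

theorem ee_fin (h : EEV G r u k P bt f H v w a b c d jab jcd) {u' : W} {Z : Set W}
    {S Left LB LC : Set (Sym2 W)}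
    {Qs sl X : List (List W)} {nw : ℕ} (hnw : bt d ≤ nw)
    (hnw' : nw = bt b ∨ (nw = jcd ∧ jcd = bt d ∧ bt d < bt b))
    (hS : ∀ e ∈ S, e ∈ eeS f v w a b c d)
    (hB : Blk (f r) Z (visN f bt (eeN v w (bt b) nw) (bt b)) ((P (bt b)).map f)
      (eeN v w (bt b) nw (bt b)) (eeR f a b c d) S Left Qs)
    (hsl : jab ≠ bt b → (sl = [] ∨ ∃ y, (y = f a ∨ y = f b ∨ y = w) ∧ sl = [[v, y]]))
    (hX : jcd ≠ bt b → Grp H (f r) u' (visN f bt (eeN v w (bt b) nw) jcd) (pm f k P jcd)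
      (eeN v w (bt b) nw jcd) (eeR f a b c d) (eeS f v w a b c d) X)
    (hLB : ∀ e ∈ eeS f v w a b c d, e ∈ LB ↔ jab ≠ bt b ∧ ∃ Q ∈ sl, e ∈ ledges Q)
    (hLC : ∀ e ∈ eeS f v w a b c d, e ∈ LC ↔ jcd ≠ bt b ∧ ∃ Q ∈ X, e ∈ ledges Q)
    (hA : ∀ e ∈ eeS f v w a b c d, (e ∈ S ∧ e ∉ Left) ↔ (e ∉ LB ∧ e ∉ LC))
    (hBC : ∀ e ∈ LB, e ∉ LC)
    (hNZ : ∀ z ∈ eeN v w (bt b) nw (bt b), z ∈ Z ∨ z = u')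
    (hu : (u' = f u ∧ s(a, b) ≠ s(r, u) ∧ s(c, d) ≠ s(r, u)) ∨
      (f u ∈ Z ∧ bt b = bt u ∧ ((jab ≠ bt b ∧ sl = [[u', f r]]) ∨ (jcd ≠ bt b ∧ X = [[u', f r]]))))
    (hU : EEU r u f v w a b c d u')
    (hX2 : jcd = bt d → bt d < bt b → ∃ Q, X = [Q] ∧ ∀ e, e ∈ ledges Q ↔
      (e ∈ ledges ((P jcd).map f) ∧ e ≠ s(f c, f d)) ∨ e = s(w, f c) ∨ e = s(w, f d))
    (hX3 : bt d < jcd → (X = [] ∨ ∃ y, (y = f c ∨ y = f d) ∧ X = [[w, y]])) :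
    EEConc r u k P bt f H v w a b c d jab jcd := by
  obtain ⟨D', g, h1, h2, h3, h4, h5, h6, h7⟩ :=
    ee_glue h hnw hnw' hS hB hsl hX hLB hLC hA hBC hNZ hu
  refine ⟨D', g, ?_, h2, h3, ?_, ?_, ?_, ?_⟩
  · intro u'' hu''
    have : u'' = u' := by
      rcases hU with ⟨k1, rfl⟩ | ⟨k1, k2, rfl⟩ | ⟨k1, k2, rfl⟩ <;>
      rcases hu'' with ⟨l1, rfl⟩ | ⟨l1, l2, rfl⟩ | ⟨l1, l2, rfl⟩ <;> first | rfl | contradiction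
    rw [this]; exact h1
  · rw [h4]
    refine ⟨hB.ne, hB.le, fun Q hQ => ⟨?_, hB.long Q hQ, h5 Q hQ⟩⟩
    intro e he
    rcases (hB.edges e).1 ⟨Q, hQ, he⟩ with h | h
    · exact .inl h.1
    · exact .inr (hS e h.1)
  · intro k1 k2
    rw [h7 (by omega)]
    exact hX2 k1 k2
  · intro k1; rw [h6 k1]; exact hsl k1
  · intro k1
    rw [h7 (h.jcd_ne k1).2]
    exact hX3 k1

theorem Mon.leu (M : Mon G r u k P bt) (x : V) : bt x ≤ bt u := by
  by_cases hx : x = u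
  · rw [hx]
  · exact (M.umax x hx).le

theorem Mon.equ (M : Mon G r u k P bt) {x : V} (h : bt x = bt u) : x = u := by
  by_contra hx
  exact absurd h (M.umax x hx).ne

theorem Mon.ru_dir (M : Mon G r u k P bt) (hru : G.Adj r u) {x y : V} (hle : bt x ≤ bt y)
    (h : s(x, y) = s(r, u)) : x = r ∧ y = u := by
  rcases Sym2.eq_iff.1 h with h | ⟨rfl, rfl⟩
  · exact h
  · have := M.umax y hru.ne; omega

theorem EEV.notin (h : EEV G r u k P bt f H v w a b c d jab jcd) (j : ℕ) :
    v ∉ (P j).map f ∧ w ∉ (P j).map f := by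
  constructor
  · intro h'; obtain ⟨x, _, hx⟩ := List.mem_map.1 h'; exact h.hv x hx
  · intro h'; obtain ⟨x, _, hx⟩ := List.mem_map.1 h'; exact h.hw x hx

theorem Mon.mem_img (M : Mon G r u k P bt) (hf : Function.Injective f) {x y : V} {i j : ℕ}
    (hi : i ≤ k) (hj : j ≤ k) (h : s(x, y) ∈ ledges (P j)) :
    s(f x, f y) ∈ ledges ((P i).map f) ↔ j = i := by
  rw [ledges_map]
  constructor
  · intro h'
    obtain ⟨e0, he0, h'⟩ := List.mem_map.1 h'
    have : e0 = s(x, y) := Sym2.map.injective hf h'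
    subst this
    exact M.edge_uniq hj hi h he0
  · rintro rfl; exact List.mem_map.2 ⟨s(x, y), h, rfl⟩

/-- the block when `w` is visited before -/
theorem EEV.blk1 (h : EEV G r u k P bt f H v w a b c d jab jcd) (hlt : bt d < bt b)
    (hcb : jcd ≠ bt b) {S1 : Set (Sym2 W)}
    (hS1 : ∀ e, e ∈ S1 ↔ e = s(v, f a) ∨ e = s(v, f b) ∨ e = s(v, w)) :
    ∃ Qs Left Z sl u', Blk (f r) Z (visN f bt (eeN v w (bt b) (bt d)) (bt b)) ((P (bt b)).map f) {v}
      (eeR f a b c d) S1 Left Qs ∧ Qs.length ≤ 2 ∧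
      ((jab = bt b ∧ Left = ∅ ∧ sl = []) ∨ (jab ≠ bt b ∧ ∃ y, (y = f a ∨ y = f b ∨ y = w) ∧ Left = {s(v, y)}
        ∧ sl = [[v, y]])) ∧
      (v ∈ Z ∨ v = u') ∧ EEU r u f v w a b c d u' ∧
      ((u' = f u ∧ s(a, b) ≠ s(r, u) ∧ s(c, d) ≠ s(r, u)) ∨
      (f u ∈ Z ∧ bt b = bt u ∧ (jab ≠ bt b ∧ sl = [[u', f r]]))) := by
  have hM := h.M
  have hcdr : s(c, d) ≠ s(r, u) := by
    intro h'
    have := (hM.ru_dir h.hru h.hle2 h').2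
    subst this
    have := hM.leu b; omega
  have hE := hM.ear_map h.hf (h.N_f (bt b) (bt d)) (hM.le b)
  have hlong : 3 ≤ ((P (bt b)).map f).length := by simpa using hM.long b
  have hbV : f b ∉ visN f bt (eeN v w (bt b) (bt d)) (bt b) := by rw [h.vis_f]; omega
  have hbP : f b ∈ (P (bt b)).map f := List.mem_map_of_mem (hM.self b)
  have hwV : w ∈ visN f bt (eeN v w (bt b) (bt d)) (bt b) := by rw [h.vis_w]; exact hlt
  have hvV : v ∉ visN f bt (eeN v w (bt b) (bt d)) (bt b) := by rw [h.vis_v]; omega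
  have habne : f a ≠ f b := fun h' => h.hab.ne (h.hf h')
  have hmab := hM.mem_img h.hf (hM.le b) h.hj h.hje
  have hmcd := hM.mem_img h.hf (hM.le b) h.hk h.hke
  by_cases hr : s(a, b) = s(r, u)
  · obtain ⟨rfl, rfl⟩ := hM.ru_dir h.hru h.hle hr
    have hne : jab ≠ bt b := by rintro rfl; exact hM.ru h.hje
    have haV : f a ∈ visN f bt (eeN v w (bt b) (bt d)) (bt b) := by
      rw [h.vis_f]; exact hM.umax a h.hab.ne
    refine ⟨_, _, _, [[v, f a]], v, blk_ru (a := f a) (q := w) hE hlong hbV hbP hwV haV (h.hw a) hvV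
      (h.notin _).1 hS1 ?_, by simp, .inr ⟨hne, f a, by simp, rfl, rfl⟩, .inr rfl, .inl ⟨rfl, rfl⟩,
      .inr ⟨by simp, rfl, hne, rfl⟩⟩
    rintro e he (h' | h')
    · rw [h'] at he; exact hne (hmab.1 he)
    · rw [h'] at he; exact hcb (hmcd.1 he)
  · obtain ⟨Qs, Left, ⟨hB, hl⟩, ho⟩ := ev_out (rem := eeR f a b c d) hE hlong habne (fun h' => h.hw a h'.symm)
      (fun h' => h.hw b h'.symm) (by
        rcases h.hle.lt_or_eq with h' | h'
        · left; rwa [h.vis_f]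
        · right; rw [← h']; exact List.mem_map_of_mem (hM.self a)) hbV hbP hvV (h.notin _).1 (.inl hwV) hS1 (by
        intro e he
        constructor
        · rintro (h' | h')
          · exact h'
          · rw [h'] at he; exact absurd (hmcd.1 he) hcb
        · intro h'; exact .inl h')
    rw [hmab] at ho
    rcases ho with ⟨h1, rfl⟩ | ⟨h1, ho⟩
    · exact ⟨Qs, ∅, {v}, [], f u, hB, hl, .inl ⟨h1, rfl, rfl⟩, .inl rfl, .inr (.inr ⟨hr, hcdr, rfl⟩),
        .inl ⟨rfl, hr, hcdr⟩⟩
    · have : ∃ y, (y = f a ∨ y = f b ∨ y = w) ∧ Left = {s(v, y)} := by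
        rcases ho with h | h | h
        · exact ⟨f a, by simp, h⟩
        · exact ⟨f b, by simp, h⟩
        · exact ⟨w, by simp, h⟩
      obtain ⟨y, hy, hL⟩ := this
      exact ⟨Qs, Left, {v}, [[v, y]], f u, hB, hl, .inr ⟨h1, y, hy, hL, rfl⟩, .inl rfl,
        .inr (.inr ⟨hr, hcdr, rfl⟩), .inl ⟨rfl, hr, hcdr⟩⟩

/-- the block when `ru` is subdivided, and the other edge is also incident to `u` -/
theorem ru_blk (M : Mon G r u k P bt) (hf : Function.Injective f) {N : ℕ → Set W}
    (hNf : ∀ m, ∀ z ∈ N m, ∀ x, f x ≠ z) {v w : W} {c : V} {S rem : Set (Sym2 W)}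
    (hru : G.Adj r u) (hv : ∀ x, f x ≠ v) (hw : ∀ x, f x ≠ w) (hvw : v ≠ w) (hc : c ≠ u)
    (hvV : v ∉ visN f bt N (bt u)) (hwV : w ∉ visN f bt N (bt u))
    (hS : ∀ e, e ∈ S ↔ e = s(v, f r) ∨ e = s(v, f u) ∨ e = s(v, w) ∨ e = s(w, f c) ∨ e = s(w, f u))
    (hrem : ∀ e ∈ ledges ((P (bt u)).map f), e ∈ rem ↔ e = s(f c, f u)) :
    ∃ Qs, Blk (f r) {w, f u} (visN f bt N (bt u)) ((P (bt u)).map f) {v, w} rem S {s(v, f r)} Qs := by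
  have hE := M.ear_map hf hNf (M.le u)
  have hV : ∀ x, x ≠ u → f x ∈ visN f bt N (bt u) := by
    intro x hx; rw [visN_f hf hNf]; exact M.umax x hx
  have huV : f u ∉ visN f bt N (bt u) := by rw [visN_f hf hNf]; omega
  have hni : ∀ z, (∀ x, f x ≠ z) → z ∉ (P (bt u)).map f := by
    intro z hz h; obtain ⟨x, _, hx⟩ := List.mem_map.1 h; exact hz x hx
  by_cases hl : s(f c, f u) ∈ ledges ((P (bt u)).map f)
  · obtain ⟨s, t, hst⟩ := M.ulast
    have hear := M.ear _ (M.le u)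
    rw [hst] at hear
    have hst' : s ≠ t ∧ s ≠ u ∧ t ≠ u := by
      have hnd := hear.nodup (q := r) (by
        have := M.umax r hru.ne; simpa using this)
      simp at hnd
      exact ⟨hnd.1.2, hnd.1.1, fun h => hnd.2 h.symm⟩
    obtain ⟨hst1, hs, ht⟩ := hst'
    rw [hst] at hl hrem ⊢
    have : c = s ∨ c = t := by
      simp [ledges, hf.eq_iff, hc] at hl; tauto
    rcases this with rfl | rfl
    · exact ⟨_, blk_ruL (hV _ hs) (hV _ ht) (fun h => hst1 (hf h)) huV (hV _ hru.ne) hvV hwV hvw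
        (fun h => hv u h.symm) (fun h => hw u h.symm) hS hrem⟩
    · refine ⟨[[f c, w, f u, f s], [f u, v, w]], Blk.reverse ?_⟩
      have := blk_ruL (r := f r) (c := f c) (t := f s) (a := f r) (b := f u) (v := v) (w := w)
          (rem := rem) (S := S) (hV _ ht) (hV _ hs) (fun h => hst1 (hf h).symm) huV (hV _ hru.ne) hvV hwV hvw
          (fun h => hv u h.symm) (fun h => hw u h.symm) hS (by
            intro e he
            refine hrem e ?_
            rw [← mem_ledges_reverse]; simpa using he)
      simpa using this
  · refine ⟨_, blk_ruS hE (by simpa using M.long u) (hV _ hc) huV (List.mem_map_of_mem (M.self u))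
      (hV _ hru.ne) hvV hwV hvw (hni v hv) (hni w hw) hS ?_⟩
    intro e he he'
    rw [(hrem e he).1 he'] at he
    exact hl he

theorem sl_edges {p q : W} (e : Sym2 W) : (∃ Q ∈ [[p, q]], e ∈ ledges Q) ↔ e = s(p, q) := by
  simp [ledges]

set_option maxHeartbeats 1000000 in
theorem ee_final (h : EEV G r u k P bt f H v w a b c d jab jcd) :
    EEConc r u k P bt f H v w a b c d jab jcd := by
  have hM := h.M
  have hle := h.hle
  have hle2 := h.hle2
  have hdb := h.hdb
  have hvw := h.hvw
  have hva : ∀ x, s(v, f x) ≠ s(w, f c) ∧ s(v, f x) ≠ s(w, f d) := by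
    intro x; simp [hvw, (h.hv _).symm]
  have hvc : s(v, w) ≠ s(w, f c) ∧ s(v, w) ≠ s(w, f d) := by
    simp [hvw, (h.hv _).symm]
  rcases hdb.lt_or_eq with hlt | heq
  · -- `w` can be placed earlier
    obtain ⟨S1, hS1⟩ : ∃ S1 : Set (Sym2 W), ∀ e, e ∈ S1 ↔ e = s(v, f a) ∨ e = s(v, f b) ∨ e = s(v, w) :=
      ⟨{e | _}, fun e => Iff.rfl⟩
    have hcb : jcd ≠ bt b := by
      rcases h.hkc with h' | h'
      · omega
      · exact (h.jcd_ne h'.1).2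
    obtain ⟨Qs, Left, Z, sl, u', hB, hlen, hsl, hvZ, hU, hu⟩ := h.blk1 hlt hcb hS1
    have hslp : jab ≠ bt b → (sl = [] ∨ ∃ y, (y = f a ∨ y = f b ∨ y = w) ∧ sl = [[v, y]]) := by
      intro hne
      rcases hsl with h' | ⟨_, y, hy, _, h'⟩
      · exact .inl h'.2.2
      · exact .inr ⟨y, hy, h'⟩
    have hLB : ∀ e, e ∈ Left ↔ jab ≠ bt b ∧ ∃ Q ∈ sl, e ∈ ledges Q := by
      intro e
      rcases hsl with ⟨h1, h2, h3⟩ | ⟨h1, y, hy, h2, h3⟩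
      · simp [h1, h2]
      · rw [h2, h3, sl_edges]; simp [h1]
    have hLS : ∀ e ∈ Left, e ∈ S1 := by
      intro e he
      rcases hsl with ⟨h1, h2, h3⟩ | ⟨h1, y, hy, h2, h3⟩
      · rw [h2] at he; simp at he
      · rw [h2] at he
        have : e = s(v, y) := he
        rw [hS1, this]
        rcases hy with rfl | rfl | rfl <;> simp
    have hSw : ∀ e ∈ S1, e ≠ s(w, f c) ∧ e ≠ s(w, f d) := by
      intro e he
      rcases (hS1 e).1 he with rfl | rfl | rfl
      · exact hva a
      · exact hva b
      · exact hvc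
    rcases h.hkc with ⟨hc1, _⟩ | ⟨hc1, hc2⟩
    · -- `cd` lies in a long ear
      obtain ⟨Q, hQ, hQe⟩ := h.grp_sub (u' := u') hc1 hlt
      have hN : eeN v w (bt b) jcd (bt b) = {v} := by
        ext z; simp [eeN]; omega
      refine ee_fin h (u' := u') (Z := Z) (S := S1) (Left := Left) (LB := Left)
        (LC := {e | e = s(w, f c) ∨ e = s(w, f d)}) (Qs := Qs) (sl := sl) (X := [Q]) (nw := jcd)
        (by omega) (.inr ⟨rfl, hc1, hlt⟩) ?_ ?_ hslp (fun _ => hQ) (fun e _ => hLB e) ?_ ?_ ?_ ?_ ?_ hU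
        (fun _ _ => ⟨Q, rfl, hQe⟩) (fun h' => by omega)
      · intro e he
        rcases (hS1 e).1 he with rfl | rfl | rfl <;> simp [eeS]
      · rw [hN, hc1]; exact hB
      · intro e he
        have h1 := h.S_ne e he jcd
        have h2 := hQe e
        constructor
        · intro h'; exact ⟨hcb, Q, by simp, h2.2 (.inr h')⟩
        · rintro ⟨_, Q', hQ', h'⟩
          simp at hQ'; subst hQ'
          rcases h2.1 h' with h' | h'
          · exact absurd h'.1 h1
          · exact h'
      · intro e he
        have hs : e ∈ S1 ↔ e ∉ ({e | e = s(w, f c) ∨ e = s(w, f d)} : Set (Sym2 W)) := by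
          constructor
          · rintro h' (h'' | h'')
            · exact (hSw e h').1 h''
            · exact (hSw e h').2 h''
          · intro h'
            rw [hS1]
            rcases he with he | he | he | he | he
            · exact .inl he
            · exact .inr (.inl he)
            · exact .inr (.inr he)
            · exact absurd (.inl he) h'
            · exact absurd (.inr he) h'
        rw [hs, and_comm]
      · rintro e he (h' | h')
        · exact (hSw e (hLS e he)).1 h'
        · exact (hSw e (hLS e he)).2 h'
      · rw [hN]; rintro z rfl; exact hvZ
      · rcases hu with h' | ⟨k1, k2, k3⟩
        · exact .inl h'
        · exact .inr ⟨k1, k2, .inl k3⟩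
    · -- `cd` is a short ear
      have hN : eeN v w (bt b) (bt b) (bt b) = {v} ∪ {w} := by
        ext z; simp [eeN]; exact or_comm
      have hVis : visN f bt (eeN v w (bt b) (bt d)) (bt b) = visN f bt (eeN v w (bt b) (bt b)) (bt b) ∪ {w} := by
        ext z
        rcases h.cov z with rfl | rfl | ⟨x, rfl⟩
        · rw [Set.mem_union, h.vis_v, h.vis_v]; simp [hvw]
        · rw [Set.mem_union, h.vis_w, h.vis_w]; simp [hlt]
        · rw [Set.mem_union, h.vis_f, h.vis_f]; simp [h.hw]
      rw [hVis] at hB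
      have hB' := hB.pre (c := f c) (d := f d) (v := v) (S' := eeS f v w a b c d) hlen
        ((h.vis_f _ _ _ _).2 (by omega)) ((h.vis_f _ _ _ _).2 (by omega)) (fun h' => h.hcd.ne (h.hf h'))
        (by rw [h.vis_w]; omega) (by rw [h.vis_v]; omega) hvw
        ((hS1 _).2 (by rw [Sym2.eq_swap]; simp)) (fun h' => (hSw _ (hLS _ h')).1 rfl)
        (fun h' => (hSw _ (hLS _ h')).2 rfl) (by
          intro e; rw [hS1]; simp only [eeS, Set.mem_setOf_eq, or_assoc])
      refine ee_fin h (u' := u') (Z := Z ∪ {w}) (S := eeS f v w a b c d) (Left := Left) (LB := Left)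
        (LC := ∅) (sl := sl) (X := []) (nw := bt b)
        (by omega) (.inl rfl) (fun e he => he) (hN ▸ hB') hslp (fun _ => (h.grp_cd hc1 hc2 (.inl rfl)).2)
        (fun e _ => hLB e) ?_ ?_ ?_ ?_ ?_ hU
        (fun h' => by omega) (fun _ => .inl rfl)
      · simp
      · intro e he; simp [he]
      · simp
      · rw [hN]
        rintro z (hz | hz)
        · have : z = v := hz
          rw [this]
          rcases hvZ with h' | h'
          · exact .inl (.inl h')
          · exact .inr h'
        · exact .inl (.inr hz)
      · rcases hu with h' | ⟨k1, k2, k3⟩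
        · exact .inl h'
        · exact .inr ⟨.inl k1, k2, .inl k3⟩
  · -- `birth d = birth b`
    have hN : eeN v w (bt b) (bt b) (bt b) = {v, w} := by
      ext z; simp [eeN]
    have hvV : v ∉ visN f bt (eeN v w (bt b) (bt b)) (bt b) := by rw [h.vis_v]; omega
    have hwV : w ∉ visN f bt (eeN v w (bt b) (bt b)) (bt b) := by rw [h.vis_w]; omega
    have hmab := hM.mem_img h.hf (hM.le b) h.hj h.hje
    have hmcd := hM.mem_img h.hf (hM.le b) h.hk h.hke
    have hjcd : jcd ≠ bt b → bt d < jcd ∧ (P jcd = [c, d] ∨ P jcd = [d, c]) := by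
      intro hne
      rcases h.hkc with h' | h'
      · omega
      · exact h'
    by_cases hr : s(a, b) = s(r, u)
    · obtain ⟨rfl, rfl⟩ := hM.ru_dir h.hru hle hr
      have := hM.equ heq
      subst this
      have hne : jab ≠ bt d := by rintro rfl; exact hM.ru h.hje
      obtain ⟨Qs, hB⟩ := ru_blk (w := w) (c := c) (S := eeS f v w a d c d) (rem := eeR f a d c d) hM h.hf
        (h.N_f (bt d) (bt d)) h.hru h.hv h.hw hvw h.hcd.ne hvV hwV (fun e => Iff.rfl) (by
          intro e he
          constructor
          · rintro (h' | h')
            · rw [h'] at he; exact absurd (hmab.1 he) hne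
            · exact h'
          · intro h'; exact .inr h')
      refine ee_fin h (u' := v) (S := eeS f v w a d c d) (LB := {s(v, f a)})
        (LC := ∅) (sl := [[v, f a]]) (X := []) (nw := bt d)
        (by omega) (.inl rfl) (fun e he => he) (hN ▸ hB) (fun _ => .inr ⟨f a, by simp, rfl⟩)
        (fun hn => (h.grp_cd (hjcd hn).1 (hjcd hn).2 (.inl rfl)).2)
        ?_ ?_ ?_ ?_ ?_ (.inr ⟨by simp, rfl, .inl ⟨hne, rfl⟩⟩) (.inl ⟨rfl, rfl⟩)
        (fun h' => by omega) (fun _ => .inl rfl)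
      · intro e _; rw [sl_edges]; simp [hne]
      · simp
      · intro e he; simp [he]
      · simp
      · rw [hN]; rintro z (hz | hz)
        · exact .inr hz
        · left; left; exact hz
    by_cases hr2 : s(c, d) = s(r, u)
    · obtain ⟨rfl, rfl⟩ := hM.ru_dir h.hru hle2 hr2
      have := hM.equ heq.symm
      subst this
      have hne : jcd ≠ bt b := by rintro rfl; exact hM.ru h.hke
      obtain ⟨Qs, hB⟩ := ru_blk (v := w) (w := v) (c := a) (S := eeS f v w a b c b) (rem := eeR f a b c b) hM h.hf
        (h.N_f (bt b) (bt b)) h.hru h.hw h.hv hvw.symm h.hab.ne hwV hvV (by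
          intro e; rw [Sym2.eq_swap (a := w) (b := v)]; simp only [eeS, Set.mem_setOf_eq]
          constructor
          · rintro (h | h | h | h | h) <;> simp [h]
          · rintro (h | h | h | h | h) <;> simp [h]) (by
          intro e he
          constructor
          · rintro (h' | h')
            · exact h'
            · rw [h'] at he; exact absurd (hmcd.1 he) hne
          · intro h'; exact .inl h')
      rw [Set.pair_comm w v] at hB
      refine ee_fin h (u' := w) (S := eeS f v w a b c b) (LB := ∅)
        (LC := {s(w, f c)}) (sl := []) (X := [[w, f c]]) (nw := bt b)
        (by omega) (.inl rfl) (fun e he => he) (hN ▸ hB) (fun _ => .inl rfl)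
        (fun hn => (h.grp_cd (hjcd hn).1 (hjcd hn).2 (.inr ⟨(hjcd hn).1, f c, by simp, rfl⟩)).2)
        ?_ ?_ ?_ ?_ ?_ (.inr ⟨by simp, rfl, .inr ⟨hne, rfl⟩⟩) (.inr (.inl ⟨hr, rfl, rfl⟩))
        (fun h' => by omega) (fun _ => .inr ⟨f c, by simp, rfl⟩)
      · simp
      · intro e _; rw [sl_edges]; simp [hne]
      · intro e he; simp [he]
      · simp
      · rw [hN]; rintro z (hz | hz)
        · left; left; exact hz
        · exact .inr hz
    · have hvis : ∀ x, bt x ≤ bt b → f x ∈ visN f bt (eeN v w (bt b) (bt b)) (bt b) ∨ f x ∈ (P (bt b)).map f := by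
        intro x hx
        rcases hx.lt_or_eq with h' | h'
        · left; rwa [h.vis_f]
        · right; rw [← h']; exact List.mem_map_of_mem (hM.self x)
      have hEEH : EEH (f r) v w (f a) (f b) (f c) (f d) (visN f bt (eeN v w (bt b) (bt b)) (bt b))
          ((P (bt b)).map f) (eeR f a b c d) (eeS f v w a b c d) :=
        { ear := hM.ear_map h.hf (h.N_f _ _) (hM.le b)
          long := by simpa using hM.long b
          ab := fun h' => h.hab.ne (h.hf h')
          cd := fun h' => h.hcd.ne (h.hf h')
          ne := fun h' => h.hne ((h.iff_f _ _ _ _).1 h')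
          ha := hvis a hle
          hb := hvis b le_rfl
          hc := hvis c (by omega)
          hd := hvis d (by omega)
          hab := .inr (by rw [h.vis_f]; omega)
          hcd := .inr (by rw [h.vis_f]; omega)
          hv := hvV
          hw := hwV
          hvw := hvw
          hvP := (h.notin _).1
          hwP := (h.notin _).2
          hS := fun e => Iff.rfl
          hrem := fun e _ => Iff.rfl }
      obtain ⟨Qs, L, La, Lc, hB, rfl, hLa, hLc⟩ := ee_out hEEH
      rw [hmab] at hLa
      rw [hmcd] at hLc
      obtain ⟨sl, hsl1, hsl2, hsl3⟩ : ∃ sl : List (List W),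
          (sl = [] ∨ ∃ y, (y = f a ∨ y = f b ∨ y = w) ∧ sl = [[v, y]]) ∧
          (∀ e, e ∈ La ↔ jab ≠ bt b ∧ ∃ Q ∈ sl, e ∈ ledges Q) ∧
          (∀ e ∈ La, e = s(v, f a) ∨ e = s(v, f b)) := by
        rcases hLa with rfl | ⟨h1, rfl | rfl⟩
        · exact ⟨[], .inl rfl, by simp, by simp⟩
        · refine ⟨[[v, f a]], .inr ⟨f a, by simp, rfl⟩, ?_, fun e he => .inl he⟩
          intro e; rw [sl_edges]; simp [h1]
        · refine ⟨[[v, f b]], .inr ⟨f b, by simp, rfl⟩, ?_, fun e he => .inr he⟩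
          intro e; rw [sl_edges]; simp [h1]
      obtain ⟨X, hX1, hX2, hX3⟩ : ∃ X : List (List W),
          (X = [] ∨ ∃ y, (y = f c ∨ y = f d) ∧ X = [[w, y]]) ∧
          (∀ e, e ∈ Lc ↔ jcd ≠ bt b ∧ ∃ Q ∈ X, e ∈ ledges Q) ∧
          (∀ e ∈ Lc, e = s(w, f c) ∨ e = s(w, f d)) := by
        rcases hLc with rfl | ⟨h1, rfl | rfl⟩
        · exact ⟨[], .inl rfl, by simp, by simp⟩
        · refine ⟨[[w, f c]], .inr ⟨f c, by simp, rfl⟩, ?_, fun e he => .inl he⟩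
          intro e; rw [sl_edges]; simp [h1]
        · refine ⟨[[w, f d]], .inr ⟨f d, by simp, rfl⟩, ?_, fun e he => .inr he⟩
          intro e; rw [sl_edges]; simp [h1]
      refine ee_fin h (u' := f u) (S := eeS f v w a b c d) (LB := La)
        (LC := Lc) (sl := sl) (X := X) (nw := bt b)
        (by omega) (.inl rfl) (fun e he => he) (hN ▸ hB) (fun _ => hsl1) ?_
        (fun e _ => hsl2 e) (fun e _ => hX2 e) ?_ ?_ ?_ (.inl ⟨rfl, hr, hr2⟩) (.inr (.inr ⟨hr, hr2, rfl⟩))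
        (fun h' => by omega) (fun _ => hX1)
      · intro hn
        refine (h.grp_cd (hjcd hn).1 (hjcd hn).2 ?_).2
        rcases hX1 with h' | h'
        · exact .inl h'
        · exact .inr ⟨by have := (hjcd hn).1; omega, h'⟩
      · intro e he; simp [he]
      · intro e he he'
        rcases hsl3 e he with rfl | rfl
        · rcases hX3 _ he' with h' | h'
          · exact (hva a).1 h'
          · exact (hva a).2 h'
        · rcases hX3 _ he' with h' | h'
          · exact (hva b).1 h'
          · exact (hva b).2 h'
      · rw [hN]; intro z hz; exact .inl hz
end EE2

theorem edges_pair {W : Type u} (p q : W) : {e | e ∈ ledges [p, q]} = ({s(p, q)} : Set (Sym2 W)) := by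
  ext e; simp [ledges]

/-- Path Replacement Lemma, structured form. Let `G` be a finite simple
3-connected graph with an edge `ru`, let `D = (P₀, …, P_{m-n})` be a Mondshein sequence
of `G` avoiding `ru`, and let `G'` be obtained from `G` by one BG-operation adding the
edge `vw`, where (if applicable) `v` subdivides the edge `ab` of `G` with
`birth a ≤ birth b` and `w` subdivides the edge `cd` of `G` with `birth c ≤ birth d` and
`birth d ≤ birth b`; `S ⊆ {av, vb, vw, cw, wd}` is the set of new edges of `G'`. Then
there is a Mondshein sequence `D' = (P'₀, …, P'_{m-n+1})` of `G'` avoiding the edge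
corresponding to `ru` that is obtained from `D` by the following modifications only
(expressed below by a replacement function `g` on ear indices and an optional `tail`):
(M1) replacing the long ear `P_{birth b}` with between 1 and 3 consecutive long ears,
each consisting of edges in `P_{birth b} ∪ S`; (M2) if `P_{birth cd}` is long and
`birth d < birth b`, replacing `P_{birth cd}` with the long ear obtained from it by
subdividing `cd` with `w`; (M3) if `P_{birth ab}` is short, deleting it or replacing it
with a single edge from `{va, vb, vw}`, and if `P_{birth cd}` is short, deleting it or
replacing it with a single edge from `{wc, wd}`; (M4) possibly adding `vw` as a new
last ear. -/
theorem path_replacement_structured {V W : Type u} [Fintype V] [Fintype W] [DecidableEq V]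
    (G : SimpleGraph V) (G' : SimpleGraph W) (r u : V) (hru : G.Adj r u)
    (hG : KConnected 3 G) (D : EarDecomposition G) (hD : IsMondshein D r u) :
    -- vertex-vertex-addition: only (M4) applies
    (∀ (e : V ≃ W) (x y : V), x ≠ y → ¬G.Adj x y →
      (∀ z z' : V, G'.Adj (e z) (e z') ↔
        (G.Adj z z' ∨ (z = x ∧ z' = y) ∨ (z = y ∧ z' = x))) →
      ∃ (D' : EarDecomposition G') (tail : List (Set (Sym2 W))),
        IsMondshein D' (e r) (e u) ∧
        (tail = [] ∨ tail = [{s(e x, e y)}]) ∧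
        D'.earList = D.earList.map (mapEdgeSet ⇑e) ++ tail) ∧
    -- edge-vertex-addition (subdividing `ab` with `v`, adding the edge `v (f w₀)`):
    -- (M1), (M3) and (M4) apply
    (∀ (f : V ↪ W) (v : W) (a b w₀ : V),
      (∀ x, f x ≠ v) → (∀ z : W, z = v ∨ ∃ x, f x = z) →
      G.Adj a b → w₀ ≠ a → w₀ ≠ b →
      (∀ x y : V, G'.Adj (f x) (f y) ↔ (G.Adj x y ∧ s(x, y) ≠ s(a, b))) →
      (∀ x : V, G'.Adj v (f x) ↔ (x = a ∨ x = b ∨ x = w₀)) →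
      D.birth a ≤ D.birth b →
      ∃ (D' : EarDecomposition G') (g : ℕ → List (Set (Sym2 W)))
        (tail : List (Set (Sym2 W))),
        IsMondshein D' (f r) (if s(a, b) = s(r, u) then v else f u) ∧
        D'.earList = (List.range (D.k + 1)).flatMap g ++ tail ∧
        -- (M4)
        (tail = [] ∨ tail = [{s(v, f w₀)}]) ∧
        -- all ears other than `P_{birth b}` and `P_{birth ab}` are kept unchanged
        (∀ i ≤ D.k, i ≠ D.birth b → i ≠ D.birthEdge s(a, b) →
          g i = [mapEdgeSet ⇑f (D.earEdges i)]) ∧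
        -- (M1)
        (1 ≤ (g (D.birth b)).length ∧ (g (D.birth b)).length ≤ 3 ∧
          ∀ Es ∈ g (D.birth b),
            Es ⊆ mapEdgeSet ⇑f (D.earEdges (D.birth b)) ∪
                  {s(f a, v), s(v, f b), s(v, f w₀)} ∧
            ¬∃ e₀, Es = {e₀}) ∧
        -- (M3)
        (¬D.IsLong (D.birthEdge s(a, b)) →
          (g (D.birthEdge s(a, b)) = [] ∨ g (D.birthEdge s(a, b)) = [{s(f a, v)}] ∨
           g (D.birthEdge s(a, b)) = [{s(v, f b)}] ∨
           g (D.birthEdge s(a, b)) = [{s(v, f w₀)}]))) ∧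
    -- edge-edge-addition (subdividing `ab` with `v` and `cd` with `w`, adding `vw`):
    -- (M1)–(M4) apply
    (∀ (f : V ↪ W) (v w : W) (a b c d : V),
      v ≠ w → (∀ x, f x ≠ v ∧ f x ≠ w) → (∀ z : W, z = v ∨ z = w ∨ ∃ x, f x = z) →
      G.Adj a b → G.Adj c d → s(a, b) ≠ s(c, d) →
      (∀ x y : V, G'.Adj (f x) (f y) ↔
        (G.Adj x y ∧ s(x, y) ≠ s(a, b) ∧ s(x, y) ≠ s(c, d))) →
      (∀ x : V, G'.Adj v (f x) ↔ (x = a ∨ x = b)) →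
      (∀ x : V, G'.Adj w (f x) ↔ (x = c ∨ x = d)) →
      G'.Adj v w →
      D.birth a ≤ D.birth b → D.birth c ≤ D.birth d → D.birth d ≤ D.birth b →
      ∃ (D' : EarDecomposition G') (g : ℕ → List (Set (Sym2 W)))
        (tail : List (Set (Sym2 W))),
        IsMondshein D' (f r)
          (if s(a, b) = s(r, u) then v else if s(c, d) = s(r, u) then w else f u) ∧
        D'.earList = (List.range (D.k + 1)).flatMap g ++ tail ∧
        -- (M4)
        (tail = [] ∨ tail = [{s(v, w)}]) ∧
        -- all ears other than `P_{birth b}`, `P_{birth ab}`, `P_{birth cd}`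
        -- are kept unchanged
        (∀ i ≤ D.k, i ≠ D.birth b → i ≠ D.birthEdge s(a, b) → i ≠ D.birthEdge s(c, d) →
          g i = [mapEdgeSet ⇑f (D.earEdges i)]) ∧
        -- (M1)
        (1 ≤ (g (D.birth b)).length ∧ (g (D.birth b)).length ≤ 3 ∧
          ∀ Es ∈ g (D.birth b),
            Es ⊆ mapEdgeSet ⇑f (D.earEdges (D.birth b)) ∪
                  {s(f a, v), s(v, f b), s(v, w), s(f c, w), s(w, f d)} ∧
            ¬∃ e₀, Es = {e₀}) ∧
        -- (M2)
        (D.IsLong (D.birthEdge s(c, d)) → D.birth d < D.birth b →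
          g (D.birthEdge s(c, d)) =
            [mapEdgeSet ⇑f (D.earEdges (D.birthEdge s(c, d)) \ {s(c, d)}) ∪
              {s(f c, w), s(w, f d)}]) ∧
        -- (M3) for `ab`
        (¬D.IsLong (D.birthEdge s(a, b)) →
          (g (D.birthEdge s(a, b)) = [] ∨ g (D.birthEdge s(a, b)) = [{s(f a, v)}] ∨
           g (D.birthEdge s(a, b)) = [{s(v, f b)}] ∨
           g (D.birthEdge s(a, b)) = [{s(v, w)}])) ∧
        -- (M3) for `cd`
        (¬D.IsLong (D.birthEdge s(c, d)) →
          (g (D.birthEdge s(c, d)) = [] ∨ g (D.birthEdge s(c, d)) = [{s(f c, w)}] ∨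
           g (D.birthEdge s(c, d)) = [{s(w, f d)}]))) := by
  classical
  obtain ⟨P, M, hE, hL, hB⟩ := extract G r u hG D hD
  refine ⟨?_, ?_, ?_⟩
  · intro e x y hxy hn hH
    obtain ⟨D', h1, h2⟩ := vv_final M hru e x y hxy hn hH
    refine ⟨D', [{s(e x, e y)}], h1, .inr rfl, ?_⟩
    rw [h2]
    congr 1
    rw [EarDecomposition.earList, List.map_map]
    refine List.map_congr_left ?_
    intro j hj
    have hj' : j ≤ D.k := by simpa [Nat.lt_succ_iff] using hj
    rw [set_map_edges, Function.comp, hE j hj']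
  · intro f v a b q hv cov hab hqa hqb hH1 hH2 hle
    obtain ⟨jab, hj, hje, hjc⟩ := M.edge_cases hab hle
    have hbe : D.birthEdge s(a, b) = jab := hB jab hj _ hje
    obtain ⟨D', g, tl, h1, h2, h3, h4, ⟨h5, h6, h7⟩, h8⟩ := ev_final
      (f := f) (H := G') ⟨M, hru, f.injective, hv, cov, hab, hqa, hqb, hH1, hH2, hle, hj, hje, hjc⟩
    refine ⟨D', fun j => (g j).map (fun l => {e | e ∈ ledges l}),
      tl.map (fun l => {e | e ∈ ledges l}), ?_, h2, ?_, ?_, ⟨?_, ?_, ?_⟩, ?_⟩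
    · apply h1
      split_ifs with hc
      · exact .inl ⟨hc, rfl⟩
      · exact .inr ⟨hc, rfl⟩
    · rcases h3 with rfl | rfl
      · exact .inl rfl
      · exact .inr (by rw [List.map_singleton, edges_pair])
    · intro i hi hib hij
      rw [hbe] at hij
      simp only [h4 i hi hib hij, List.map_singleton, set_map_edges, hE i hi]
    · simpa using h5
    · simpa using h6
    · intro Es hEs
      obtain ⟨Q, hQ, rfl⟩ := List.mem_map.1 hEs
      obtain ⟨k1, k2, Vis, k3⟩ := h7 Q hQ
      refine ⟨?_, k3.not_single k2⟩
      intro e he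
      rw [hE _ (M.le b), ← set_map_edges]
      rcases k1 e he with k | k | k | k
      · exact .inl k
      · right; simp [k, Sym2.eq_swap]
      · right; simp [k]
      · right; simp [k]
    · rw [hbe]
      intro hnl
      have hne : jab ≠ D.birth b := by
        rintro rfl
        exact hnl ((hL _ hj).2 (M.long b))
      have hs : s(f a, v) = s(v, f a) := Sym2.eq_swap
      rcases h8 hne with k | k | k | k
      · left; simp [k]
      · right; left; simp only [k, List.map_singleton, edges_pair, hs]
      · right; right; left; simp only [k, List.map_singleton, edges_pair]
      · right; right; right; simp only [k, List.map_singleton, edges_pair]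
  · intro f v w a b c d hvw hfv cov hab hcd hne hH1 hH2 hH3 hH4 hle hle2 hdb
    obtain ⟨jab, hj, hje, hjc⟩ := M.edge_cases hab hle
    obtain ⟨jcd, hk, hke, hkc⟩ := M.edge_cases hcd hle2
    have hbe : D.birthEdge s(a, b) = jab := hB jab hj _ hje
    have hbe2 : D.birthEdge s(c, d) = jcd := hB jcd hk _ hke
    have hs : s(f a, v) = s(v, f a) := Sym2.eq_swap
    have hs2 : s(f c, w) = s(w, f c) := Sym2.eq_swap
    obtain ⟨D', g, h1, h2, h4, ⟨h5, h6, h7⟩, h8, h9, h10⟩ := ee_final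
      (f := f) (H := G') ⟨M, hru, f.injective, hvw, fun x => (hfv x).1, fun x => (hfv x).2, cov,
        hab, hcd, hne, hH1, hH2, hH3, hH4, hle, hle2, hdb, hj, hje, hjc, hk, hke, hkc⟩
    refine ⟨D', fun j => (g j).map (fun l => {e | e ∈ ledges l}), [], ?_, ?_, .inl rfl, ?_,
      ⟨?_, ?_, ?_⟩, ?_, ?_, ?_⟩
    · apply h1
      split_ifs with hc hc'
      · exact .inl ⟨hc, rfl⟩
      · exact .inr (.inl ⟨hc, hc', rfl⟩)
      · exact .inr (.inr ⟨hc, hc', rfl⟩)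
    · rw [h2, List.append_nil]
    · intro i hi hib hij hij2
      rw [hbe] at hij
      rw [hbe2] at hij2
      simp only [h4 i hi hib hij hij2, List.map_singleton, set_map_edges, hE i hi]
    · simpa using h5
    · simpa using h6
    · intro Es hEs
      obtain ⟨Q, hQ, rfl⟩ := List.mem_map.1 hEs
      obtain ⟨k1, k2, Vis, k3⟩ := h7 Q hQ
      refine ⟨?_, k3.not_single k2⟩
      intro e he
      rw [hE _ (M.le b), ← set_map_edges]
      rcases k1 e he with k | k | k | k | k | k
      · exact .inl k
      · right; rw [hs]; simp [k]
      · right; simp [k]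
      · right; simp [k]
      · right; rw [hs2]; simp [k]
      · right; simp [k]
    · rw [hbe2]
      intro hlong hlt
      have hjd : jcd = D.birth d := by
        rcases hkc with k | k
        · exact k.1
        · exfalso
          have := (hL _ hk).1 hlong
          rcases k.2 with k2 | k2 <;> simp [k2] at this
      obtain ⟨Q, hQ, hQe⟩ := h8 hjd hlt
      simp only [hQ, List.map_singleton]
      congr 1
      ext e
      rw [hE _ hk, mapEdgeSet, Set.image_sdiff (Sym2.map.injective f.injective)]
      have hm : Sym2.map f '' {e | e ∈ ledges (P jcd)} = {e | e ∈ ledges ((P jcd).map f)} := by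
        rw [set_map_edges]; rfl
      rw [hm, hs2, Set.mem_ofPred_eq, hQe]
      simp
      exact or_comm.trans or_assoc
    · rw [hbe]
      intro hnl
      have hne : jab ≠ D.birth b := by
        rintro rfl
        exact hnl ((hL _ hj).2 (M.long b))
      rcases h9 hne with k | ⟨y, rfl | rfl | rfl, k⟩
      · left; simp [k]
      · right; left; simp only [k, List.map_singleton, edges_pair, hs]
      · right; right; left; simp only [k, List.map_singleton, edges_pair]
      · right; right; right; simp only [k, List.map_singleton, edges_pair]
    · rw [hbe2]
      intro hnl
      have hlt : D.birth d < jcd := by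
        rcases hkc with k | k
        · exact absurd ((hL _ hk).2 k.2) hnl
        · exact k.1
      rcases h10 hlt with k | ⟨y, rfl | rfl, k⟩
      · left; simp [k]
      · right; left; simp only [k, List.map_singleton, edges_pair, hs2]
      · right; right; simp only [k, List.map_singleton, edges_pair]
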